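/- The Betti table of any finitely generated graded Cohen-Macaulay module of codimension c over S = K[x_1,...,x_n] can be expressed uniquely as a positive rational linear combination of Betti tables of codimension c Cohen-Macaulay S-modules with pure resolutions whose degree sequences form a chain (i.e., are totally ordered in the termwise partial order). -/

import Mathlib

open MvPolynomial Finset Module

noncomputable section

/-- The standard graded polynomial ring `S = K[x_1, …, x_n]`. -/
abbrev PolyS (K : Type) [Field K] (n : ℕ) : Type := MvPolynomial (Fin n) K

/-- The `K`-subspace of homogeneous polynomials of integer degree `z`
(it is `0` if `z < 0`). -/
def homogZ (K : Type) [Field K] (n : ℕ) (z : ℤ) : Submodule K (PolyS K n) :=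
  ⨆ (_ : 0 ≤ z), MvPolynomial.homogeneousSubmodule (Fin n) K z.toNat

/-- The degree-`ℓ` piece of the graded free module `⊕ₚ S(-dg p)`. -/
def freePiece {K : Type} [Field K] {n r : ℕ} (dg : Fin r → ℤ) (ℓ : ℤ) :
    Submodule K (Fin r → PolyS K n) :=
  Submodule.pi Set.univ fun p => homogZ K n (ℓ - dg p)

/-- A (homologically indexed) finite complex of graded free `S`-modules
`F₀ ← F₁ ← ⋯ ← F_len ← 0`, where `Fᵢ = ⊕ₚ S(-deg i p)` and the (degree `0`)
map `Fᵢ₊₁ → Fᵢ` is given by the matrix `dd i`, whose entries are homogeneous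
of the appropriate degrees. -/
structure FreeComplex (K : Type) [Field K] (n : ℕ) where
  len : ℕ
  rk : ℕ → ℕ
  deg : (i : ℕ) → Fin (rk i) → ℤ
  dd : (i : ℕ) → Matrix (Fin (rk i)) (Fin (rk (i+1))) (PolyS K n)
  rk_eq_zero : ∀ i, len < i → rk i = 0
  isHomog : ∀ i p q, dd i p q ∈ homogZ K n (deg (i+1) q - deg i p)
  isComplex : ∀ i, dd i * dd (i+1) = 0

variable {K : Type} [Field K] {n : ℕ}

/-- `F` is exact in positive homological degrees; that is, it is a graded free
resolution of the finitely generated graded module `M = coker (F₁ → F₀)`. -/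
def IsResolution (F : FreeComplex K n) : Prop :=
  ∀ i, LinearMap.ker ((F.dd i).mulVecLin) = LinearMap.range ((F.dd (i+1)).mulVecLin)

/-- The complex is minimal: entries of the differentials lie in the maximal ideal,
i.e. all (constant) entries between generators of equal degrees vanish. -/
def IsMinimal (F : FreeComplex K n) : Prop :=
  ∀ i p q, F.deg (i+1) q = F.deg i p → F.dd i p q = 0

/-- Betti number `β_{i,j}`: the number of generators of `Fᵢ` of degree `j`. -/
def bettiNum (F : FreeComplex K n) (i : ℕ) (j : ℤ) : ℕ :=
  (Finset.univ.filter fun p => F.deg i p = j).card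

/-- The dimension of the degree-`ℓ` piece of the module `M = coker (F₁ → F₀)`
resolved by `F`. -/
def MPieceDim (F : FreeComplex K n) (ℓ : ℤ) : ℕ :=
  finrank K ((freePiece (F.deg 0) ℓ) ⧸
    (Submodule.comap (freePiece (F.deg 0) ℓ).subtype
      ((LinearMap.range ((F.dd 0).mulVecLin)).restrictScalars K)))

/-- The Hilbert polynomial of the twisted free module `S(-a)` in `n` variables:
`binom (t - a + n - 1, n - 1)`. -/
def genHilb (n : ℕ) (a : ℤ) : Polynomial ℚ :=
  if n = 0 then 0 else
    Polynomial.C (((n - 1).factorial : ℚ))⁻¹ *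
      ∏ k ∈ Finset.range (n - 1),
        (Polynomial.X - Polynomial.C (a : ℚ) + Polynomial.C ((k : ℚ) + 1))

/-- The Hilbert polynomial of `M = coker (F₁ → F₀)`, computed from the free
resolution `F` by additivity. -/
def hilbPoly (F : FreeComplex K n) : Polynomial ℚ :=
  ∑ i ∈ Finset.range (F.len + 1),
    Polynomial.C ((-1 : ℚ) ^ i) * ∑ p : Fin (F.rk i), genHilb n (F.deg i p)

/-- The Krull dimension of a module read off from its Hilbert polynomial:
`0` for the zero polynomial (finite length), `deg + 1` otherwise. -/
def polyDim (P : Polynomial ℚ) : ℕ := if P = 0 then 0 else P.natDegree + 1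

/-- `M = coker (F₁ → F₀)` is a Cohen-Macaulay module of codimension `c`:
`F` is a minimal free resolution of length exactly `c` (so `pd M = c`, and by
Auslander–Buchsbaum `depth M = n - c`) and `dim M = n - c`. -/
def IsCMcodim (F : FreeComplex K n) (c : ℕ) : Prop :=
  IsResolution F ∧ IsMinimal F ∧ (∀ i, c < i → F.rk i = 0) ∧ F.rk c ≠ 0 ∧
    polyDim (hilbPoly F) = n - c

/-- The multiplicity `e(M)` of a module of codimension `c`, computed from the
Betti numbers of a free resolution:
`e(M) = ((-1)^c / c!) ⬝ Σ_{i,j} (-1)^i β_{i,j} j^c`. -/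
def multQ (F : FreeComplex K n) (c : ℕ) : ℚ :=
  ((-1 : ℚ) ^ c / c.factorial) *
    ∑ i ∈ Finset.range (F.len + 1),
      (-1 : ℚ) ^ i * ∑ p : Fin (F.rk i), ((F.deg i p : ℚ)) ^ c



/-- The normalized pure Betti table with degree sequence `d = (d_0 < … < d_c)`:
`π(d)_{i,j} = ∏_{l ≠ i} 1/|d_l - d_i|` if `i ≤ c` and `j = d_i`, and `0` otherwise.
By the Herzog–Kühl equations, the Betti table of any Cohen-Macaulay module of
codimension `c` with pure resolution of degree sequence `d` is a positive
rational multiple of `π(d)`. -/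
def pureTable {c : ℕ} (d : Fin (c + 1) → ℤ) (i : ℕ) (j : ℤ) : ℚ :=
  if h : i < c + 1 then
    (if j = d ⟨i, h⟩ then
      ∏ l ∈ Finset.univ.erase (⟨i, h⟩ : Fin (c + 1)), (((d l - d ⟨i, h⟩).natAbs : ℚ))⁻¹
     else 0)
  else 0

set_option linter.all false

namespace BS

section abstractPush
variable {A Y : Type} [CommRing A] [AddCommGroup Y] [Module A Y]

/-- Abstract data for the push-forward along the projective line. -/
structure PushData (A Y : Type) [CommRing A] [AddCommGroup Y] [Module A Y] where
  D : Y →ₗ[A] Y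
  e0 : Y →ₗ[A] Y
  e1 : Y →ₗ[A] Y
  eP : Y →ₗ[A] Y
  eN : Y →ₗ[A] Y
  DD : ∀ x, D (D x) = 0
  hsum : ∀ x, e0 x + e1 x + eP x + eN x = x
  h00 : ∀ x, e0 (e0 x) = e0 x
  h01 : ∀ x, e0 (e1 x) = 0
  h0P : ∀ x, e0 (eP x) = 0
  h0N : ∀ x, e0 (eN x) = 0
  h10 : ∀ x, e1 (e0 x) = 0
  h11 : ∀ x, e1 (e1 x) = e1 x
  h1P : ∀ x, e1 (eP x) = 0
  h1N : ∀ x, e1 (eN x) = 0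
  hP0 : ∀ x, eP (e0 x) = 0
  hP1 : ∀ x, eP (e1 x) = 0
  hPP : ∀ x, eP (eP x) = eP x
  hPN : ∀ x, eP (eN x) = 0
  hN0 : ∀ x, eN (e0 x) = 0
  hN1 : ∀ x, eN (e1 x) = 0
  hNP : ∀ x, eN (eP x) = 0
  hNN : ∀ x, eN (eN x) = eN x
  s1 : ∀ x, eN (D (e0 x)) = 0
  s2 : ∀ x, eN (D (eP x)) = 0
  s3 : ∀ x, e1 (D (e0 x)) = 0
  s4 : ∀ x, e1 (D (eP x)) = 0
  s5 : ∀ x, eP (D (e0 x)) = 0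
  s6 : ∀ x, eP (D (eN x)) = 0
  s7 : ∀ x, e1 (D (eN x)) = 0

namespace PushData
variable (T : PushData A Y)

def full : Y →ₗ[A] Y :=
  T.e0 ∘ₗ T.D ∘ₗ T.e0 - T.e1 ∘ₗ T.D ∘ₗ T.e1 + T.e0 ∘ₗ T.D ∘ₗ T.eN ∘ₗ T.D ∘ₗ T.e1

lemma full_apply (x : Y) : T.full x = T.e0 (T.D (T.e0 x)) - T.e1 (T.D (T.e1 x)) +
    T.e0 (T.D (T.eN (T.D (T.e1 x)))) := rfl

lemma Dsplit (x : Y) : T.D (T.e0 x) + T.D (T.e1 x) + T.D (T.eP x) + T.D (T.eN x) = T.D x := by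
  rw [← map_add, ← map_add, ← map_add, T.hsum]

lemma a1 (x : Y) : T.e0 (T.D (T.e0 (T.D (T.e0 x)))) = 0 := by
  have := congrArg T.e0 (T.Dsplit (T.D (T.e0 x)))
  simpa [T.s1, T.s3, T.s5, T.DD] using this

lemma a2 (x : Y) : T.e1 (T.D (T.e1 (T.D x))) = 0 := by
  have := congrArg T.e1 (T.Dsplit (T.D x))
  simpa [T.s3, T.s4, T.s7, T.DD] using this

lemma a3 (x : Y) : T.e0 (T.D (T.e0 (T.D (T.eN x)))) = - T.e0 (T.D (T.eN (T.D (T.eN x)))) := by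
  have := congrArg T.e0 (T.Dsplit (T.D (T.eN x)))
  simp only [T.s6, T.s7, T.DD, map_add, map_zero, add_zero] at this
  exact eq_neg_of_add_eq_zero_left this

lemma a4 (x : Y) : T.eN (T.D (T.e1 (T.D x))) = - T.eN (T.D (T.eN (T.D x))) := by
  have := congrArg T.eN (T.Dsplit (T.D x))
  simp only [T.s1, T.s2, T.DD, map_add, map_zero, add_zero, zero_add] at this
  exact eq_neg_of_add_eq_zero_left this

lemma full_full (x : Y) : T.full (T.full x) = 0 := by
  simp only [full_apply, map_add, map_sub, T.h00, T.h01, T.h10, T.h11, T.a1, T.a2, T.a3, T.a4,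
    map_zero, map_neg]
  abel

theorem homology (g : A) (M : ℕ)
    (hm : ∀ x, T.e1 x = 0 → T.eP x = 0 → T.D x = 0 →
      ∃ y, T.e1 y = 0 ∧ T.eP y = 0 ∧ T.D y = g ^ M • x)
    (hp : ∀ x, T.e1 x = 0 → T.eN x = 0 → T.D x = 0 →
      ∃ y, T.e1 y = 0 ∧ T.eN y = 0 ∧ T.D y = g ^ M • x)
    (hY : ∀ x, T.D x = 0 → ∃ y, T.D y = g ^ M • x)
    (h : Y) (hh : T.e0 h + T.e1 h = h) (hc : T.full h = 0) :
    ∃ b, T.e0 b + T.e1 b = b ∧ T.full b = g ^ (M + M) • h := by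
  have c1 : T.e1 (T.D (T.e1 h)) = 0 := by
    have := congrArg T.e1 hc
    simpa [full_apply, T.h10, T.h11] using this
  have c0 : T.e0 (T.D (T.e0 h)) + T.e0 (T.D (T.eN (T.D (T.e1 h)))) = 0 := by
    have := congrArg T.e0 hc
    simpa [full_apply, T.h00, T.h01] using this
  have d0 : T.e0 (T.D (T.e0 h)) = T.D (T.e0 h) := by
    have := T.hsum (T.D (T.e0 h))
    simpa [T.s1, T.s3, T.s5] using this
  have sp : T.e0 (T.D (T.e1 h)) + T.eP (T.D (T.e1 h)) + T.eN (T.D (T.e1 h)) = T.D (T.e1 h) := by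
    have := T.hsum (T.D (T.e1 h))
    simpa [c1] using this
  have dN : T.D (T.eN (T.D (T.e1 h))) + T.D (T.e0 h) = 0 := by
    have e := congrArg T.D sp
    simp only [map_add, T.DD] at e
    have eN' := congrArg T.eN e
    simp only [map_add, T.s1, T.s2, map_zero, zero_add] at eN'
    have := T.hsum (T.D (T.eN (T.D (T.e1 h))))
    rw [T.s6, T.s7, eN'] at this
    simp only [add_zero] at this
    rw [← this, ← d0, add_comm]; exact c0
  have dP : T.D (T.e0 (T.D (T.e1 h)) + T.eP (T.D (T.e1 h)) - T.e0 h) = 0 := by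
    have e := congrArg T.D sp
    simp only [map_add, T.DD] at e
    rw [map_sub, map_add, eq_neg_of_add_eq_zero_left e, eq_neg_of_add_eq_zero_left dN]; abel
  obtain ⟨ym, ym1, ymP, hym⟩ := hm (T.eN (T.D (T.e1 h)) + T.e0 h)
    (by simp [T.h1N, T.h10]) (by simp [T.hPN, T.hP0]) (by rw [map_add, dN])
  obtain ⟨yp, yp1, ypN, hyp⟩ := hp (T.e0 (T.D (T.e1 h)) + T.eP (T.D (T.e1 h)) - T.e0 h)
    (by simp [T.h1P, T.h10]) (by simp [T.hNP, T.hN0]) dP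
  obtain ⟨y, hy⟩ := hY (g ^ M • T.e1 h - yp - ym) (by
    rw [map_sub, map_sub, map_smul, hyp, hym]
    nth_rewrite 1 [← sp]
    simp only [smul_add, smul_sub]; abel)
  refine ⟨g ^ M • T.e0 ym + T.e0 (T.D (T.eN y)) - T.e1 y, ?_, ?_⟩
  · simp [T.h00, T.h11, T.h01, T.h10]; abel
  · have f1 : T.e1 (T.D (T.e1 y)) = g ^ M • g ^ M • T.e1 h := by
      have := congrArg T.e1 (T.Dsplit y)
      simp only [map_add, T.s3, T.s4, T.s7, zero_add, add_zero] at this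
      rw [this, hy]; simp [T.h11, yp1, ym1]
    have f2 : T.e0 (T.D (T.e0 ym)) = g ^ M • T.e0 h - T.e0 (T.D (T.eN ym)) := by
      have := congrArg T.e0 (T.Dsplit ym)
      rw [ym1, ymP, hym] at this
      simp only [map_add, map_zero, add_zero, map_smul, T.h0N, T.h00, zero_add] at this
      exact eq_sub_of_add_eq this
    have f3 : T.eN (T.D (T.eN y)) + T.eN (T.D (T.e1 y)) = - (g ^ M • T.eN ym) := by
      have := congrArg T.eN (T.Dsplit y)
      simp only [map_add, T.s1, T.s2, zero_add, add_zero] at this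
      rw [add_comm, this, hy]; simp [T.hN1, ypN]
    have f4 : T.e0 (T.D (T.eN (T.D (T.eN y)))) + T.e0 (T.D (T.eN (T.D (T.e1 y)))) =
        - (g ^ M • T.e0 (T.D (T.eN ym))) := by
      rw [← map_add, ← map_add, f3]; simp
    simp only [full_apply, map_add, map_sub, T.h00, T.h01, T.h10, T.h11, T.a3, f1, map_smul,
      map_zero, zero_add, sub_zero, smul_zero, zero_sub, map_neg, f2]
    have f5 := eq_sub_of_add_eq f4
    rw [f5, pow_add, mul_smul]
    nth_rewrite 3 [← hh]
    simp only [smul_add, smul_sub, smul_zero]; abel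

end PushData
end abstractPush
end BS

namespace BS

/-- The bivariate polynomial ring `A[s,t]`. -/
abbrev BP (A : Type) [CommRing A] : Type := AddMonoidAlgebra A (ℕ × ℕ)
/-- The bivariate Laurent polynomial ring. -/
abbrev T2 (A : Type) [CommRing A] : Type := AddMonoidAlgebra A (ℤ × ℤ)

def incl : ℕ × ℕ →+ ℤ × ℤ := AddMonoidHom.prodMap (Nat.castAddMonoidHom ℤ) (Nat.castAddMonoidHom ℤ)

lemma incl_apply (m : ℕ × ℕ) : incl m = ((m.1 : ℤ), (m.2 : ℤ)) := rfl

section conc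
variable {A : Type} [CommRing A]

def Th : BP A →+* T2 A := AddMonoidAlgebra.mapDomainRingHom A incl

lemma Th_single (m : ℕ × ℕ) (a : A) : Th (AddMonoidAlgebra.single m a) =
    AddMonoidAlgebra.single (incl m) a := by
  simp [Th]

lemma coeff_Th_mul (f : BP A) (g : T2 A) (z : ℤ × ℤ) :
    (Th f * g).coeff z = f.coeff.sum fun m a => a * g.coeff (z - incl m) := by
  induction f using AddMonoidAlgebra.induction_linear with
  | zero => simp
  | add f f' h h' =>
    rw [map_add, add_mul, AddMonoidAlgebra.coeff_add, Finsupp.add_apply, h, h',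
      AddMonoidAlgebra.coeff_add, Finsupp.sum_add_index']
    · simp
    · intros; ring
  | single m a =>
    rw [Th_single, AddMonoidAlgebra.coeff_single, Finsupp.sum_single_index (by simp),
      AddMonoidAlgebra.coeff_single_mul_apply]
    congr 2; abel

/-- Annihilator of the homology of a differential module. -/
def AnnH {R : Type} [CommRing R] {I : Type} [Fintype I] (D : Matrix I I R) : Ideal R where
  carrier := {r | ∀ w, D.mulVec w = 0 → ∃ y, D.mulVec y = r • w}
  zero_mem' := fun w _ => ⟨0, by simp⟩
  add_mem' := fun {a b} ha hb w hw => by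
    obtain ⟨y, hy⟩ := ha w hw
    obtain ⟨y', hy'⟩ := hb w hw
    exact ⟨y + y', by rw [Matrix.mulVec_add, hy, hy', add_smul]⟩
  smul_mem' := fun r a ha w hw => by
    obtain ⟨y, hy⟩ := ha w hw
    exact ⟨r • y, by rw [Matrix.mulVec_smul, hy, smul_smul, smul_eq_mul]⟩

lemma mem_AnnH {R : Type} [CommRing R] {I : Type} [Fintype I] {D : Matrix I I R} {r : R} :
    r ∈ AnnH D ↔ ∀ w, D.mulVec w = 0 → ∃ y, D.mulVec y = r • w := Iff.rfl

structure IsDM (P : ℤ → AddSubgroup A) {I : Type} [Fintype I] (D : Matrix I I A)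
    (deg pos ord : I → ℤ) : Prop where
  sq : D * D = 0
  mem : ∀ p q, D p q ∈ P (deg q - deg p)
  hpos : ∀ p q, D p q ≠ 0 → pos p + 1 = pos q
  hord : ∀ p q, D p q ≠ 0 → ord p < ord q

def PB (P : ℤ → AddSubgroup A) (k : ℤ) : AddSubgroup (BP A) where
  carrier := {f | ∀ m, f.coeff m ∈ P k ∧ (f.coeff m ≠ 0 → (m.1 : ℤ) + m.2 = k)}
  zero_mem' := fun m => by simp [(P k).zero_mem]
  add_mem' := fun {f g} hf hg m => by
    refine ⟨(P k).add_mem (hf m).1 (hg m).1, fun h => ?_⟩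
    by_contra hk
    have h1 : f.coeff m = 0 := by by_contra h1; exact hk ((hf m).2 h1)
    have h2 : g.coeff m = 0 := by by_contra h2; exact hk ((hg m).2 h2)
    exact h (by simp [h1, h2])
  neg_mem' := fun {f} hf m => by
    refine ⟨?_, fun h => (hf m).2 ?_⟩
    · have : (-f).coeff m = -(f.coeff m) := by simp
      rw [this]; exact (P k).neg_mem (hf m).1
    · intro h0; apply h; simp [h0]

variable {I : Type} [Fintype I] [DecidableEq I]

def Dop (D : Matrix I I (BP A)) : (I → T2 A) →ₗ[A] (I → T2 A) :=
  ((D.map Th).mulVecLin).restrictScalars A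

lemma Dop_apply (D : Matrix I I (BP A)) (y : I → T2 A) : Dop D y = (D.map Th).mulVec y := rfl

lemma coeff_Dop (D : Matrix I I (BP A)) (y : I → T2 A) (p : I) (z : ℤ × ℤ) :
    (Dop D y p).coeff z =
      ∑ q, (D p q).coeff.sum fun m a => a * (y q).coeff (z - incl m) := by
  simp only [Dop_apply, Matrix.mulVec, dotProduct, Matrix.map_apply, AddMonoidAlgebra.coeff_sum,
    Finsupp.finsetSum_apply, coeff_Th_mul]

open Classical in
def proj (s : I → ℤ × ℤ → Prop) : (I → T2 A) →ₗ[A] (I → T2 A) where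
  toFun y := fun p => AddMonoidAlgebra.ofCoeff ((y p).coeff.filter (s p))
  map_add' x y := by
    funext p; apply AddMonoidAlgebra.coeff_injective; ext z
    simp only [Pi.add_apply, AddMonoidAlgebra.coeff_add, Finsupp.filter_apply, Finsupp.add_apply]
    split_ifs <;> simp
  map_smul' a y := by
    funext p; apply AddMonoidAlgebra.coeff_injective; ext z
    simp only [Pi.smul_apply, AddMonoidAlgebra.coeff_smul, Finsupp.filter_apply, Finsupp.smul_apply]
    split_ifs <;> simp

open Classical in
lemma coeff_proj (s : I → ℤ × ℤ → Prop) (y : I → T2 A) (p : I) (z : ℤ × ℤ) :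
    (proj s y p).coeff z = if s p z then (y p).coeff z else 0 := by
  simp [proj, Finsupp.filter_apply]

lemma Yext {x y : I → T2 A} (h : ∀ p z, (x p).coeff z = (y p).coeff z) : x = y := by
  funext p; apply AddMonoidAlgebra.coeff_injective; ext z; exact h p z

lemma Dop_Dop (D : Matrix I I (BP A)) (h : D * D = 0) (x : I → T2 A) : Dop D (Dop D x) = 0 := by
  rw [Dop_apply, Dop_apply, Matrix.mulVec_mulVec, ← Matrix.map_mul, h]
  simp

lemma proj_proj (s t : I → ℤ × ℤ → Prop) (h : ∀ p z, s p z → ¬ t p z) (x : I → T2 A) :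
    proj s (proj t x) = 0 := by
  apply Yext; intro p z
  have := h p z
  simp only [coeff_proj]; split_ifs <;> simp_all

lemma proj_self (s : I → ℤ × ℤ → Prop) (x : I → T2 A) :
    proj s (proj s x) = proj s x := by
  apply Yext; intro p z
  simp only [coeff_proj]; split_ifs <;> simp_all

lemma proj_stab (D : Matrix I I (BP A)) (s t : I → ℤ × ℤ → Prop)
    (h : ∀ p q z (m : ℕ × ℕ), s p z → ¬ t q (z - incl m)) (x : I → T2 A) :
    proj s (Dop D (proj t x)) = 0 := by
  apply Yext; intro p z
  simp only [coeff_proj, coeff_Dop]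
  split_ifs with hs
  · simp only [Pi.zero_apply, AddMonoidAlgebra.coeff_zero, Finsupp.coe_zero]
    refine Finset.sum_eq_zero fun q _ => Finset.sum_eq_zero fun m _ => ?_
    beta_reduce
    rw [if_neg (h p q z m hs), mul_zero]
  · simp

def pd (D : Matrix I I (BP A)) (h : D * D = 0) : PushData A (I → T2 A) where
  D := Dop D
  e0 := proj fun _ z => 0 ≤ z.1 ∧ 0 ≤ z.2
  e1 := proj fun _ z => z.1 < 0 ∧ z.2 < 0
  eP := proj fun _ z => 0 ≤ z.1 ∧ z.2 < 0
  eN := proj fun _ z => z.1 < 0 ∧ 0 ≤ z.2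
  DD := Dop_Dop D h
  hsum x := by
    apply Yext; intro p z
    simp only [Pi.add_apply, AddMonoidAlgebra.coeff_add, Finsupp.add_apply, coeff_proj]
    rcases lt_or_ge z.1 0 with h1 | h1 <;> rcases lt_or_ge z.2 0 with h2 | h2 <;>
      simp [h1, h2, not_le.2, not_lt.2]
  h00 := proj_self _
  h11 := proj_self _
  hPP := proj_self _
  hNN := proj_self _
  h01 := proj_proj _ _ (by intros; omega)
  h0P := proj_proj _ _ (by intros; omega)
  h0N := proj_proj _ _ (by intros; omega)
  h10 := proj_proj _ _ (by intros; omega)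
  h1P := proj_proj _ _ (by intros; omega)
  h1N := proj_proj _ _ (by intros; omega)
  hP0 := proj_proj _ _ (by intros; omega)
  hP1 := proj_proj _ _ (by intros; omega)
  hPN := proj_proj _ _ (by intros; omega)
  hN0 := proj_proj _ _ (by intros; omega)
  hN1 := proj_proj _ _ (by intros; omega)
  hNP := proj_proj _ _ (by intros; omega)
  s1 := proj_stab D _ _ (by intros; simp only [incl_apply, Prod.fst_sub, Prod.snd_sub]; omega)
  s2 := proj_stab D _ _ (by intros; simp only [incl_apply, Prod.fst_sub, Prod.snd_sub]; omega)
  s3 := proj_stab D _ _ (by intros; simp only [incl_apply, Prod.fst_sub, Prod.snd_sub]; omega)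
  s4 := proj_stab D _ _ (by intros; simp only [incl_apply, Prod.fst_sub, Prod.snd_sub]; omega)
  s5 := proj_stab D _ _ (by intros; simp only [incl_apply, Prod.fst_sub, Prod.snd_sub]; omega)
  s6 := proj_stab D _ _ (by intros; simp only [incl_apply, Prod.fst_sub, Prod.snd_sub]; omega)
  s7 := proj_stab D _ _ (by intros; simp only [incl_apply, Prod.fst_sub, Prod.snd_sub]; omega)

/-- lifting Laurent polynomials to polynomials -/
lemma exists_lift (k : ℤ × ℤ) (f : T2 A)
    (h : ∀ z, f.coeff z ≠ 0 → 0 ≤ z.1 + k.1 ∧ 0 ≤ z.2 + k.2) :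
    ∃ w : BP A, Th w = AddMonoidAlgebra.single k 1 * f := by
  refine ⟨∑ z ∈ f.coeff.support, AddMonoidAlgebra.single ((z.1 + k.1).toNat, (z.2 + k.2).toNat)
    (f.coeff z), ?_⟩
  have hf : f = ∑ z ∈ f.coeff.support, AddMonoidAlgebra.single z (f.coeff z) := by
    apply AddMonoidAlgebra.coeff_injective
    rw [AddMonoidAlgebra.coeff_sum]
    simp only [AddMonoidAlgebra.coeff_single]
    exact (Finsupp.sum_single f.coeff).symm
  conv_rhs => rw [hf]
  rw [map_sum, Finset.mul_sum]
  refine Finset.sum_congr rfl fun z hz => ?_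
  have := h z (by simpa using hz)
  rw [Th_single, AddMonoidAlgebra.single_mul_single, one_mul, incl_apply]
  congr 1
  ext <;> simp <;> omega

lemma exists_bound (x : I → T2 A) : ∃ k : ℕ, ∀ p z, (x p).coeff z ≠ 0 →
    0 ≤ z.1 + k ∧ 0 ≤ z.2 + k := by
  have h : ∀ p : I, ∃ k : ℕ, ∀ z, (x p).coeff z ≠ 0 → 0 ≤ z.1 + k ∧ 0 ≤ z.2 + k := by
    intro p
    refine ⟨∑ z ∈ (x p).coeff.support, (z.1.natAbs + z.2.natAbs), fun z hz => ?_⟩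
    have := Finset.single_le_sum (f := fun z : ℤ × ℤ => z.1.natAbs + z.2.natAbs)
      (fun _ _ => Nat.zero_le _) (Finsupp.mem_support_iff.2 hz)
    omega
  choose k hk using h
  refine ⟨∑ p, k p, fun p z hz => ?_⟩
  have := hk p z hz
  have := Finset.single_le_sum (f := k) (fun _ _ => Nat.zero_le _) (Finset.mem_univ p)
  omega

lemma Dop_single (D : Matrix I I (BP A)) (k : ℤ × ℤ) (x : I → T2 A) :
    Dop D (fun p => AddMonoidAlgebra.single k 1 * x p) =
      fun p => AddMonoidAlgebra.single k 1 * Dop D x p := by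
  simp only [Dop_apply]
  exact Matrix.mulVec_smul _ (AddMonoidAlgebra.single k (1 : A)) x

lemma Th_inj : Function.Injective (Th : BP A → T2 A) := by
  have : Function.Injective (incl : ℕ × ℕ → ℤ × ℤ) := by
    rintro ⟨a, b⟩ ⟨c, d⟩ h
    simp [incl_apply] at h
    simp [h]
  exact AddMonoidAlgebra.mapDomain_injective this

lemma Dop_Th (D : Matrix I I (BP A)) (w : I → BP A) :
    Dop D (fun p => Th (w p)) = fun p => Th (D.mulVec w p) := by
  funext p
  simp [Dop_apply, Matrix.mulVec, dotProduct]

/-- core of the homology hypotheses -/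
lemma hom_core (D : Matrix I I (BP A)) (g : A) (M : ℕ) (e : ℕ × ℕ) (k : ℤ × ℤ)
    (hM : (AddMonoidAlgebra.single e g : BP A) ^ M ∈ AnnH D)
    (x : I → T2 A) (hx : ∀ p z, (x p).coeff z ≠ 0 → 0 ≤ z.1 + k.1 ∧ 0 ≤ z.2 + k.2)
    (hc : Dop D x = 0) :
    ∃ y : I → T2 A, Dop D y = g ^ M • x ∧ ∀ p z, (y p).coeff z ≠ 0 →
      0 ≤ z.1 + k.1 + M * e.1 ∧ 0 ≤ z.2 + k.2 + M * e.2 := by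
  choose w hw using fun p => exists_lift k (x p) (hx p)
  have hw0 : D.mulVec w = 0 := by
    have h1 := Dop_Th D w
    simp only [hw] at h1
    rw [Dop_single, hc] at h1
    funext p
    apply Th_inj
    have := congrFun h1 p
    simp at this
    rw [← this]; simp
  obtain ⟨y, hy⟩ := hM w hw0
  refine ⟨fun p => AddMonoidAlgebra.single (-(incl (M • e) + k)) 1 * Th (y p), ?_, ?_⟩
  · rw [Dop_single, Dop_Th, hy]
    funext p
    simp only [Pi.smul_apply, smul_eq_mul, map_mul, hw, AddMonoidAlgebra.single_pow, Th_single]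
    rw [← mul_assoc, ← mul_assoc, AddMonoidAlgebra.single_mul_single,
      AddMonoidAlgebra.single_mul_single]
    have : -(incl (M • e) + k) + incl (M • e) + k = 0 := by abel
    rw [this]
    apply AddMonoidAlgebra.coeff_injective; ext z
    rw [AddMonoidAlgebra.coeff_single_mul_apply]
    simp
  · intro p z hz
    replace hz : (Th (y p) * AddMonoidAlgebra.single (-(incl (M • e) + k)) 1).coeff z ≠ 0 := by
      rw [mul_comm]; exact hz
    rw [coeff_Th_mul] at hz
    obtain ⟨m, hm, hne⟩ := Finset.exists_ne_zero_of_sum_ne_zero hz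
    have : z - incl m = -(incl (M • e) + k) := by
      by_contra h
      apply hne
      beta_reduce
      rw [AddMonoidAlgebra.coeff_single, Finsupp.single_apply, if_neg (Ne.symm h), mul_zero]
    have h1 := congrArg Prod.fst this
    have h2 := congrArg Prod.snd this
    simp [incl_apply] at h1 h2
    constructor <;> [have := h1; have := h2] <;> push_cast at * <;> omega

end conc
end BS

namespace BS
section conc2
variable {A : Type} [CommRing A] {I : Type} [Fintype I] [DecidableEq I]

open Classical in
lemma proj_eq_zero_iff (s : I → ℤ × ℤ → Prop) (y : I → T2 A) :
    proj s y = 0 ↔ ∀ p z, (y p).coeff z ≠ 0 → ¬ s p z := by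
  constructor
  · intro h p z hz hs
    have := congrArg (fun x : I → T2 A => (x p).coeff z) h
    simp [coeff_proj, hs] at this
    exact hz this
  · intro h
    apply Yext; intro p z
    rw [coeff_proj]
    by_cases hz : (y p).coeff z = 0
    · simp [hz]
    · simp [h p z hz]

lemma pd_homology (D : Matrix I I (BP A)) (h : D * D = 0) (g : A)
    (hs : (AddMonoidAlgebra.single (1, 0) g : BP A) ∈ (AnnH D).radical)
    (ht : (AddMonoidAlgebra.single (0, 1) g : BP A) ∈ (AnnH D).radical) :
    ∃ M : ℕ, ∀ x, (pd D h).e0 x + (pd D h).e1 x = x → (pd D h).full x = 0 →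
      ∃ b, (pd D h).e0 b + (pd D h).e1 b = b ∧ (pd D h).full b = g ^ M • x := by
  obtain ⟨M1, hM1⟩ := hs
  obtain ⟨M2, hM2⟩ := ht
  have hM1' : (AddMonoidAlgebra.single (1, 0) g : BP A) ^ (M1 + M2) ∈ AnnH D := by
    rw [pow_add]; exact Ideal.mul_mem_right _ _ hM1
  have hM2' : (AddMonoidAlgebra.single (0, 1) g : BP A) ^ (M1 + M2) ∈ AnnH D := by
    rw [pow_add]; exact Ideal.mul_mem_left _ _ hM2
  refine ⟨(M1 + M2) + (M1 + M2), fun x hx hc => ?_⟩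
  refine (pd D h).homology g (M1 + M2) ?_ ?_ ?_ x hx hc
  · intro x h1 hP hD
    obtain ⟨k, hk⟩ := exists_bound x
    obtain ⟨y, hy, hy2⟩ := hom_core D g (M1 + M2) (1, 0) (k, 0) hM1' x (by
      intro p z hz
      have := (proj_eq_zero_iff _ _).1 h1 p z hz
      have := (proj_eq_zero_iff _ _).1 hP p z hz
      have := hk p z hz
      simp only at *; omega) hD
    refine ⟨y, (proj_eq_zero_iff _ _).2 ?_, (proj_eq_zero_iff _ _).2 ?_, hy⟩
    all_goals
      intro p z hz
      have := hy2 p z hz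
      simp at this; omega
  · intro x h1 hP hD
    obtain ⟨k, hk⟩ := exists_bound x
    obtain ⟨y, hy, hy2⟩ := hom_core D g (M1 + M2) (0, 1) (0, k) hM2' x (by
      intro p z hz
      have := (proj_eq_zero_iff _ _).1 h1 p z hz
      have := (proj_eq_zero_iff _ _).1 hP p z hz
      have := hk p z hz
      simp only at *; omega) hD
    refine ⟨y, (proj_eq_zero_iff _ _).2 ?_, (proj_eq_zero_iff _ _).2 ?_, hy⟩
    all_goals
      intro p z hz
      have := hy2 p z hz
      simp at this; omega
  · intro x hD
    obtain ⟨k, hk⟩ := exists_bound x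
    obtain ⟨y, hy, hy2⟩ := hom_core D g (M1 + M2) (0, 1) (k, k) hM2' x (by
      intro p z hz
      exact hk p z hz) hD
    exact ⟨y, hy⟩

/-- strand projection -/
def strand (deg : I → ℤ) (a : ℤ) : (I → T2 A) →ₗ[A] (I → T2 A) :=
  proj fun p z => z.1 + z.2 = a - deg p

lemma strand_D (P : ℤ → AddSubgroup A) (D : Matrix I I (BP A)) (deg : I → ℤ) (a : ℤ)
    (hmem : ∀ p q, D p q ∈ PB P (deg q - deg p)) (x : I → T2 A) :
    strand deg a (Dop D x) = Dop D (strand deg a x) := by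
  apply Yext; intro p z
  simp only [strand, coeff_proj, coeff_Dop]
  by_cases hz : z.1 + z.2 = a - deg p
  · rw [if_pos hz]
    refine Finset.sum_congr rfl fun q _ => Finset.sum_congr rfl fun m hm => ?_
    have := (hmem p q m).2 (Finsupp.mem_support_iff.1 hm)
    beta_reduce
    rw [if_pos]
    simp [incl_apply]; omega
  · rw [if_neg hz]; symm
    refine Finset.sum_eq_zero fun q _ => Finset.sum_eq_zero fun m hm => ?_
    have := (hmem p q m).2 (Finsupp.mem_support_iff.1 hm)
    beta_reduce
    rw [if_neg, mul_zero]
    simp [incl_apply]; omega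

lemma proj_comm (s t : I → ℤ × ℤ → Prop) (x : I → T2 A) :
    proj s (proj t x) = proj t (proj s x) := by
  apply Yext; intro p z
  simp only [coeff_proj]; split_ifs <;> rfl

lemma strand_full (P : ℤ → AddSubgroup A) (D : Matrix I I (BP A)) (h : D * D = 0)
    (deg : I → ℤ) (a : ℤ)
    (hmem : ∀ p q, D p q ∈ PB P (deg q - deg p)) (x : I → T2 A) :
    strand deg a ((pd D h).full x) = (pd D h).full (strand deg a x) := by
  have hD := strand_D P D deg a hmem
  have hc : ∀ t (y : I → T2 A), strand deg a (proj t y) = proj t (strand deg a y) :=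
    fun t y => proj_comm _ _ _
  simp only [PushData.full_apply, map_add, map_sub]
  simp only [pd, hc, hD]

/-- index type of the push-forward -/
abbrev PI (deg : I → ℤ) (a : ℤ) : Type := Σ p : I, Fin (a + 1 - deg p).natAbs

def zc (deg : I → ℤ) (a : ℤ) (c : PI deg a) : ℤ × ℤ :=
  if deg c.1 ≤ a then ((c.2 : ℤ), a - deg c.1 - c.2) else (-1 - (c.2 : ℤ), a - deg c.1 + 1 + c.2)

lemma zc_prop (deg : I → ℤ) (a : ℤ) (c : PI deg a) :
    (zc deg a c).1 + (zc deg a c).2 = a - deg c.1 ∧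
    ((deg c.1 ≤ a ∧ 0 ≤ (zc deg a c).1 ∧ 0 ≤ (zc deg a c).2) ∨
      (a + 1 < deg c.1 ∧ (zc deg a c).1 < 0 ∧ (zc deg a c).2 < 0)) := by
  have := c.2.2
  unfold zc
  split_ifs with h <;> simp only <;> omega

lemma zc_inj (deg : I → ℤ) (a : ℤ) (c c' : PI deg a) (h : c.1 = c'.1)
    (hz : zc deg a c = zc deg a c') : c = c' := by
  obtain ⟨p, k⟩ := c
  obtain ⟨p', k'⟩ := c'
  simp only at h; subst h
  congr 1
  unfold zc at hz
  split_ifs at hz with h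
  · ext; have := congrArg Prod.fst hz; simp at this; exact this
  · ext; have := congrArg Prod.fst hz; simp at this; exact this

lemma zc_surj (deg : I → ℤ) (a : ℤ) (p : I) (z : ℤ × ℤ) (h : z.1 + z.2 = a - deg p)
    (h2 : (0 ≤ z.1 ∧ 0 ≤ z.2) ∨ (z.1 < 0 ∧ z.2 < 0)) : ∃ c : PI deg a, c.1 = p ∧ zc deg a c = z := by
  rcases h2 with h2 | h2
  · refine ⟨⟨p, ⟨z.1.toNat, by omega⟩⟩, rfl, ?_⟩
    unfold zc
    rw [if_pos (by simp only; omega)]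
    ext <;> simp <;> omega
  · refine ⟨⟨p, ⟨(-1 - z.1).toNat, by omega⟩⟩, rfl, ?_⟩
    unfold zc
    rw [if_neg (by simp only; omega)]
    ext <;> simp <;> omega

def rho (deg : I → ℤ) (a : ℤ) : (I → T2 A) →ₗ[A] (PI deg a → A) where
  toFun y := fun c => (y c.1).coeff (zc deg a c)
  map_add' _ _ := rfl
  map_smul' _ _ := rfl

def iot (deg : I → ℤ) (a : ℤ) : (PI deg a → A) →ₗ[A] (I → T2 A) where
  toFun h := ∑ c, h c • (Pi.single c.1 (AddMonoidAlgebra.single (zc deg a c) 1) : I → T2 A)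
  map_add' _ _ := by simp [add_smul, Finset.sum_add_distrib]
  map_smul' _ _ := by
    simp only [Finset.smul_sum, Pi.smul_apply, smul_smul, RingHom.id_apply, smul_eq_mul]

lemma coeff_bas (q : I) (y z : ℤ × ℤ) (p : I) :
    ((Pi.single q (AddMonoidAlgebra.single y 1) : I → T2 A) p).coeff z =
      if q = p ∧ y = z then 1 else 0 := by
  by_cases hq : q = p
  · subst hq; simp [Finsupp.single_apply]
  · rw [Pi.single_eq_of_ne (Ne.symm hq)]; simp [hq]

lemma coeff_iot (deg : I → ℤ) (a : ℤ) (h : PI deg a → A) (p : I) (z : ℤ × ℤ) :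
    (iot deg a h p).coeff z = ∑ c, if c.1 = p ∧ zc deg a c = z then h c else 0 := by
  simp only [iot, LinearMap.coe_mk, AddHom.coe_mk, Finset.sum_apply, AddMonoidAlgebra.coeff_sum,
    Finsupp.finsetSum_apply, Pi.smul_apply, AddMonoidAlgebra.coeff_smul, Finsupp.smul_apply,
    coeff_bas, smul_eq_mul, mul_ite, mul_one, mul_zero]

lemma rho_iot (deg : I → ℤ) (a : ℤ) (h : PI deg a → A) : rho deg a (iot deg a h) = h := by
  funext c
  show (iot deg a h c.1).coeff (zc deg a c) = _
  rw [coeff_iot, Finset.sum_eq_single c]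
  · simp
  · intro b _ hb
    rw [if_neg]
    rintro ⟨h1, h2⟩; exact hb (zc_inj _ _ _ _ h1 h2)
  · simp

lemma iot_rho (D : Matrix I I (BP A)) (h : D * D = 0) (deg : I → ℤ) (a : ℤ) (y : I → T2 A)
    (h1 : strand deg a y = y) (h2 : (pd D h).e0 y + (pd D h).e1 y = y) :
    iot deg a (rho deg a y) = y := by
  apply Yext; intro p z
  rw [coeff_iot]
  by_cases hz : z.1 + z.2 = a - deg p ∧ ((0 ≤ z.1 ∧ 0 ≤ z.2) ∨ (z.1 < 0 ∧ z.2 < 0))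
  · obtain ⟨c, rfl, rfl⟩ := zc_surj deg a p z hz.1 hz.2
    rw [Finset.sum_eq_single c]
    · simp; rfl
    · intro b _ hb
      rw [if_neg]
      rintro ⟨h1, h2⟩; exact hb (zc_inj _ _ _ _ h1 h2)
    · simp
  · rw [Finset.sum_eq_zero]
    · by_cases hz1 : z.1 + z.2 = a - deg p
      · rw [← h2]
        simp only [pd, Pi.add_apply, AddMonoidAlgebra.coeff_add, Finsupp.add_apply, coeff_proj]
        rw [if_neg (by omega), if_neg (by omega)]; simp
      · rw [← h1]
        simp only [strand, coeff_proj, if_neg hz1]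
    · rintro c -
      rw [if_neg]
      rintro ⟨rfl, rfl⟩
      have := zc_prop deg a c
      omega

lemma iot_strand (deg : I → ℤ) (a : ℤ) (h : PI deg a → A) :
    strand deg a (iot deg a h) = iot deg a h := by
  apply Yext; intro p z
  rw [strand, coeff_proj]
  split_ifs with hz
  · rfl
  · rw [coeff_iot, Finset.sum_eq_zero]
    rintro c -
    rw [if_neg]
    rintro ⟨rfl, rfl⟩
    have := zc_prop deg a c
    omega

lemma iot_e (D : Matrix I I (BP A)) (hD : D * D = 0) (deg : I → ℤ) (a : ℤ) (h : PI deg a → A) :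
    (pd D hD).e0 (iot deg a h) + (pd D hD).e1 (iot deg a h) = iot deg a h := by
  have h2 := (pd D hD).hsum (iot deg a h)
  have e1 : (pd D hD).eP (iot deg a h) = 0 := by
    refine (proj_eq_zero_iff _ _).2 fun p z hz => ?_
    rw [coeff_iot] at hz
    obtain ⟨c, _, hc⟩ := Finset.exists_ne_zero_of_sum_ne_zero hz
    by_contra hcon
    apply hc
    rw [if_neg]
    rintro ⟨rfl, rfl⟩
    have := zc_prop deg a c
    omega
  have e2 : (pd D hD).eN (iot deg a h) = 0 := by
    refine (proj_eq_zero_iff _ _).2 fun p z hz => ?_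
    rw [coeff_iot] at hz
    obtain ⟨c, _, hc⟩ := Finset.exists_ne_zero_of_sum_ne_zero hz
    by_contra hcon
    apply hc
    rw [if_neg]
    rintro ⟨rfl, rfl⟩
    have := zc_prop deg a c
    omega
  rw [e1, e2] at h2
  simpa using h2

lemma full_e (D : Matrix I I (BP A)) (hD : D * D = 0) (x : I → T2 A) :
    (pd D hD).e0 ((pd D hD).full x) + (pd D hD).e1 ((pd D hD).full x) = (pd D hD).full x := by
  simp only [PushData.full_apply, map_add, map_sub, PushData.h00, PushData.h01, PushData.h10,
    PushData.h11]
  abel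

/-- matrix of the push-forward -/
def pushD (D : Matrix I I (BP A)) (hD : D * D = 0) (deg : I → ℤ) (a : ℤ) :
    Matrix (PI deg a) (PI deg a) A :=
  LinearMap.toMatrix' (rho deg a ∘ₗ (pd D hD).full ∘ₗ iot deg a)

lemma pushD_mulVec (D : Matrix I I (BP A)) (hD : D * D = 0) (deg : I → ℤ) (a : ℤ)
    (h : PI deg a → A) :
    (pushD D hD deg a).mulVec h = rho deg a ((pd D hD).full (iot deg a h)) := by
  rw [pushD, LinearMap.toMatrix'_mulVec]; rfl

lemma iot_pushD (P : ℤ → AddSubgroup A) (D : Matrix I I (BP A)) (hD : D * D = 0) (deg : I → ℤ)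
    (a : ℤ) (hmem : ∀ p q, D p q ∈ PB P (deg q - deg p)) (h : PI deg a → A) :
    iot deg a ((pushD D hD deg a).mulVec h) = (pd D hD).full (iot deg a h) := by
  rw [pushD_mulVec, iot_rho D hD]
  · rw [strand_full P D hD deg a hmem, iot_strand]
  · exact full_e _ _ _

lemma pushD_sq (P : ℤ → AddSubgroup A) (D : Matrix I I (BP A)) (hD : D * D = 0) (deg : I → ℤ)
    (a : ℤ) (hmem : ∀ p q, D p q ∈ PB P (deg q - deg p)) :
    pushD D hD deg a * pushD D hD deg a = 0 := by
  apply Matrix.toLin'.injective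
  rw [Matrix.toLin'_mul]
  apply LinearMap.ext; intro h
  simp only [LinearMap.comp_apply, Matrix.toLin'_apply, map_zero, LinearMap.zero_apply]
  rw [pushD_mulVec, iot_pushD P D hD deg a hmem, PushData.full_full, map_zero]

lemma pushD_ann (P : ℤ → AddSubgroup A) (D : Matrix I I (BP A)) (hD : D * D = 0) (deg : I → ℤ)
    (a : ℤ) (hmem : ∀ p q, D p q ∈ PB P (deg q - deg p)) (g : A)
    (hs : (AddMonoidAlgebra.single (1, 0) g : BP A) ∈ (AnnH D).radical)
    (ht : (AddMonoidAlgebra.single (0, 1) g : BP A) ∈ (AnnH D).radical) :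
    g ∈ (AnnH (pushD D hD deg a)).radical := by
  obtain ⟨M, hM⟩ := pd_homology D hD g hs ht
  refine ⟨M, fun w hw => ?_⟩
  obtain ⟨b, hb1, hb2⟩ := hM (iot deg a w) (iot_e D hD deg a w) (by
    rw [← iot_pushD P D hD deg a hmem, hw, map_zero])
  refine ⟨rho deg a (strand deg a b), ?_⟩
  rw [pushD_mulVec, iot_rho D hD, ← strand_full P D hD deg a hmem, hb2, map_smul, iot_strand,
    map_smul, rho_iot]
  · exact proj_self _ _
  · have hc : ∀ t (y : I → T2 A), strand deg a (proj t y) = proj t (strand deg a y) :=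
      fun t y => proj_comm _ _ _
    have := congrArg (strand deg a) hb1
    rw [map_add] at this
    simp only [pd, hc] at this ⊢
    exact this

/-- coefficients of a vector lie in a family of subgroups -/
def Wt (V : I → AddSubgroup A) (y : I → T2 A) : Prop := ∀ p z, (y p).coeff z ∈ V p

lemma Wt_proj (V : I → AddSubgroup A) (y : I → T2 A) (h : Wt V y) (s : I → ℤ × ℤ → Prop) :
    Wt V (proj s y) := by
  intro p z
  rw [coeff_proj]
  split_ifs
  · exact h p z
  · exact (V p).zero_mem

lemma Wt_D (D : Matrix I I (BP A)) (V V' : I → AddSubgroup A) (y : I → T2 A) (h : Wt V y)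
    (hV : ∀ p q m, ∀ x ∈ V q, (D p q).coeff m * x ∈ V' p) : Wt V' (Dop D y) := by
  intro p z
  rw [coeff_Dop]
  exact (V' p).sum_mem fun q _ => (V' p).sum_mem fun m _ => hV p q m _ (h q _)

lemma Wt_bas (D : Matrix I I (BP A)) (V : I → AddSubgroup A) (q : I) (z : ℤ × ℤ)
    (hV : ∀ p m, (D p q).coeff m ∈ V p) :
    Wt V (Dop D (Pi.single q (AddMonoidAlgebra.single z 1))) := by
  intro p z'
  rw [coeff_Dop]
  refine (V p).sum_mem fun q' _ => (V p).sum_mem fun m _ => ?_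
  beta_reduce
  rw [coeff_bas]
  split_ifs with h
  · obtain ⟨rfl, -⟩ := h
    rw [mul_one]; exact hV p m
  · rw [mul_zero]; exact (V p).zero_mem

lemma iot_single (deg : I → ℤ) (a : ℤ) (c : PI deg a) :
    iot deg a (Pi.single c (1 : A)) = Pi.single c.1 (AddMonoidAlgebra.single (zc deg a c) 1) := by
  simp only [iot, LinearMap.coe_mk, AddHom.coe_mk]
  rw [Finset.sum_eq_single c]
  · simp
  · intro b _ hb
    rw [Pi.single_eq_of_ne hb, zero_smul]
  · simp

lemma pushD_entry (D : Matrix I I (BP A)) (hD : D * D = 0) (deg : I → ℤ) (a : ℤ)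
    (r c : PI deg a) : pushD D hD deg a r c =
      ((pd D hD).full (Pi.single c.1 (AddMonoidAlgebra.single (zc deg a c) 1)) r.1).coeff
        (zc deg a r) := by
  rw [pushD, LinearMap.toMatrix'_apply]
  have : (fun j' => if j' = c then (1 : A) else 0) = Pi.single c 1 := by
    funext j; simp [Pi.single_apply]
  simp only [this, LinearMap.comp_apply, iot_single]
  rfl

/-- Entry control: the entries either come from `D`, or from `D` composed twice. -/
lemma pushD_entry_mem (D : Matrix I I (BP A)) (hD : D * D = 0) (deg : I → ℤ) (a : ℤ)
    (r c : PI deg a) (V V2 : I → AddSubgroup A)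
    (h1 : ∀ p m, (D p c.1).coeff m ∈ V p)
    (h2 : ∀ p q m, ∀ x ∈ V q, (D p q).coeff m * x ∈ V2 p) :
    (deg r.1 ≤ a → a + 1 < deg c.1 → pushD D hD deg a r c ∈ V2 r.1) ∧
    (deg r.1 ≤ a → deg c.1 ≤ a → pushD D hD deg a r c ∈ V r.1) ∧
    (a + 1 < deg r.1 → a + 1 < deg c.1 → pushD D hD deg a r c ∈ V r.1) ∧
    (a + 1 < deg r.1 → deg c.1 ≤ a → pushD D hD deg a r c = 0) := by
  set b : I → T2 A := Pi.single c.1 (AddMonoidAlgebra.single (zc deg a c) 1) with hb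
  have hW := Wt_bas D V c.1 (zc deg a c) h1
  rw [← hb] at hW
  have hpb : ∀ s : I → ℤ × ℤ → Prop, s c.1 (zc deg a c) → proj s b = b := by
    intro s hs
    apply Yext; intro p z
    rw [coeff_proj, hb, coeff_bas]
    split_ifs with h3 h4 h4 <;> try rfl
    obtain ⟨rfl, rfl⟩ := h4; exact absurd hs h3
  have hpb' : ∀ s : I → ℤ × ℤ → Prop, ¬ s c.1 (zc deg a c) → proj s b = 0 := by
    intro s hs
    refine (proj_eq_zero_iff _ _).2 fun p z hz hsz => ?_
    rw [hb, coeff_bas] at hz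
    have : c.1 = p ∧ zc deg a c = z := by by_contra h; exact hz (if_neg h)
    obtain ⟨rfl, rfl⟩ := this
    exact hs hsz
  have pr := zc_prop deg a r
  have pc := zc_prop deg a c
  rw [pushD_entry, ← hb, PushData.full_apply]
  simp only [pd]
  refine ⟨fun hr hc => ?_, fun hr hc => ?_, fun hr hc => ?_, fun hr hc => ?_⟩
  · rw [hpb' _ (by omega), hpb (fun _ z => z.1 < 0 ∧ z.2 < 0) (by omega)]
    simp only [map_zero, zero_sub, Pi.add_apply, Pi.neg_apply, AddMonoidAlgebra.coeff_add,
      AddMonoidAlgebra.coeff_neg, Finsupp.add_apply, Finsupp.neg_apply]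
    rw [coeff_proj, if_neg (by omega), neg_zero, zero_add]
    exact Wt_proj _ _ (Wt_D D V V2 _ (Wt_proj _ _ hW _) h2) _ _ _
  · rw [hpb _ (by omega), hpb' (fun _ z => z.1 < 0 ∧ z.2 < 0) (by omega)]
    simp only [map_zero, sub_zero, add_zero]
    exact Wt_proj _ _ hW _ _ _
  · rw [hpb' _ (by omega), hpb (fun _ z => z.1 < 0 ∧ z.2 < 0) (by omega)]
    simp only [map_zero, zero_sub, Pi.add_apply, Pi.neg_apply, AddMonoidAlgebra.coeff_add,
      AddMonoidAlgebra.coeff_neg, Finsupp.add_apply, Finsupp.neg_apply]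
    rw [coeff_proj (s := fun _ z => 0 ≤ z.1 ∧ 0 ≤ z.2), if_neg (by omega), add_zero]
    exact (V r.1).neg_mem (Wt_proj _ _ hW _ _ _)
  · rw [hpb _ (by omega), hpb' (fun _ z => z.1 < 0 ∧ z.2 < 0) (by omega)]
    simp only [map_zero, sub_zero, add_zero]
    rw [coeff_proj (s := fun _ z => 0 ≤ z.1 ∧ 0 ≤ z.2), if_neg (by omega)]

end conc2
end BS

namespace BS

/-- multiplicative filtration condition -/
def MulP {A : Type} [CommRing A] (P : ℤ → AddSubgroup A) : Prop :=
  ∀ k l x y, x ∈ P k → y ∈ P l → x * y ∈ P (k + l)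

section step
variable {A : Type} [CommRing A]

lemma PB_mul (P : ℤ → AddSubgroup A) (hP : MulP P) : MulP (PB P) := by
  intro k l f g hf hg
  have hcoef : ∀ m, (f * g).coeff m =
      ∑ m1 ∈ f.coeff.support, ∑ m2 ∈ g.coeff.support,
        if m1 + m2 = m then f.coeff m1 * g.coeff m2 else 0 := by
    intro m
    classical
    rw [AddMonoidAlgebra.coeff_mul]
    rfl
  intro m
  rw [hcoef]
  refine ⟨?_, fun hne => ?_⟩
  · refine (P (k+l)).sum_mem fun m1 _ => (P (k+l)).sum_mem fun m2 _ => ?_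
    split_ifs
    · exact hP _ _ _ _ (hf m1).1 (hg m2).1
    · exact (P (k+l)).zero_mem
  · obtain ⟨m1, h1, hne⟩ := Finset.exists_ne_zero_of_sum_ne_zero hne
    obtain ⟨m2, h2, hne⟩ := Finset.exists_ne_zero_of_sum_ne_zero hne
    split_ifs at hne with hm
    · have := (hf m1).2 (by simpa using h1)
      have := (hg m2).2 (by simpa using h2)
      rw [← hm]; simp; omega
    · exact absurd rfl hne

theorem push_step (P : ℤ → AddSubgroup A) (hP : MulP P) {I : Type} [Fintype I] [DecidableEq I]
    (D : Matrix I I (BP A)) (deg pos ord : I → ℤ) (h : IsDM (PB P) D deg pos ord) (r : ℤ) :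
    ∃ (I' : Type) (_ : Fintype I') (_ : DecidableEq I') (o : I' → I) (D' : Matrix I' I' A),
      IsDM P D' (deg ∘ o) (fun x => pos (o x) - if deg (o x) > r then 1 else 0) (ord ∘ o) ∧
      (∀ p, (Finset.univ.filter fun x => o x = p).card = (r - deg p).natAbs) ∧
      ∀ g : A, (AddMonoidAlgebra.single (1, 0) g : BP A) ∈ (AnnH D).radical →
        (AddMonoidAlgebra.single (0, 1) g : BP A) ∈ (AnnH D).radical →
        g ∈ (AnnH D').radical := by
  obtain ⟨a, rfl⟩ : ∃ a, r = a + 1 := ⟨r - 1, by ring⟩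
  refine ⟨PI deg a, inferInstance, inferInstance, Sigma.fst, pushD D h.sq deg a, ⟨?_, ?_, ?_, ?_⟩,
    ?_, ?_⟩
  · exact pushD_sq P D h.sq deg a h.mem
  · intro r c
    have := pushD_entry_mem D h.sq deg a r c (fun p => P (deg c.1 - deg p))
      (fun p => P (deg c.1 - deg p)) (fun p m => (h.mem p c.1 m).1)
      (fun p q m x hx => by
        have := hP _ _ _ _ (h.mem p q m).1 hx
        convert this using 2; ring)
    have hr := zc_prop deg a r
    have hc := zc_prop deg a c
    obtain ⟨h1, h2, h3, h4⟩ := this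
    simp only [Function.comp]
    rcases hr.2 with hr | hr <;> rcases hc.2 with hc | hc
    · exact h2 hr.1 hc.1
    · exact h1 hr.1 hc.1
    · rw [h4 hr.1 hc.1]; exact AddSubgroup.zero_mem _
    · exact h3 hr.1 hc.1
  · intro r c hne
    classical
    have := pushD_entry_mem D h.sq deg a r c (fun p => if pos p + 1 = pos c.1 then ⊤ else ⊥)
      (fun p => if pos p + 2 = pos c.1 then ⊤ else ⊥) (fun p m => by
        split_ifs with hh
        · trivial
        · have : D p c.1 = 0 := by by_contra h0; exact hh (h.hpos _ _ h0)
          simp [this])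
      (fun p q m x hx => by
        beta_reduce at hx ⊢
        by_cases h0 : D p q = 0
        · simp [h0, AddSubgroup.zero_mem]
        · have h0 := h.hpos _ _ h0
          split_ifs at hx with hh
          · rw [if_pos (by omega)]; trivial
          · rw [AddSubgroup.mem_bot] at hx; rw [hx, mul_zero]; exact AddSubgroup.zero_mem _)
    have hr := zc_prop deg a r
    have hc := zc_prop deg a c
    obtain ⟨h1, h2, h3, h4⟩ := this
    rcases hr.2 with hr | hr <;> rcases hc.2 with hc | hc
    · have h2 := h2 hr.1 hc.1
      beta_reduce at h2
      rw [if_neg (by omega), if_neg (by omega)]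
      by_contra hcon
      rw [if_neg (by omega)] at h2; exact hne h2
    · have h2 := h1 hr.1 hc.1
      beta_reduce at h2
      rw [if_neg (by omega), if_pos (by omega)]
      by_contra hcon
      rw [if_neg (by omega)] at h2; exact hne h2
    · exact absurd (h4 hr.1 hc.1) hne
    · have h2 := h3 hr.1 hc.1
      beta_reduce at h2
      rw [if_pos (by omega), if_pos (by omega)]
      by_contra hcon
      rw [if_neg (by omega)] at h2; exact hne h2
  · intro r c hne
    classical
    have := pushD_entry_mem D h.sq deg a r c (fun p => if ord p < ord c.1 then ⊤ else ⊥)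
      (fun p => if ord p < ord c.1 then ⊤ else ⊥) (fun p m => by
        split_ifs with hh
        · trivial
        · have : D p c.1 = 0 := by by_contra h0; exact hh (h.hord _ _ h0)
          simp [this])
      (fun p q m x hx => by
        beta_reduce at hx ⊢
        by_cases h0 : D p q = 0
        · simp [h0, AddSubgroup.zero_mem]
        · have h0 := h.hord _ _ h0
          split_ifs at hx with hh
          · rw [if_pos (by omega)]; trivial
          · rw [AddSubgroup.mem_bot] at hx; rw [hx, mul_zero]; exact AddSubgroup.zero_mem _)
    have hr := zc_prop deg a r
    have hc := zc_prop deg a c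
    obtain ⟨h1, h2, h3, h4⟩ := this
    by_contra hcon
    simp only [Function.comp] at hcon
    rw [if_neg hcon] at h1 h2 h3
    apply hne
    rcases hr.2 with hr | hr <;> rcases hc.2 with hc | hc
    · exact h2 hr.1 hc.1
    · exact h1 hr.1 hc.1
    · exact h4 hr.1 hc.1
    · exact h3 hr.1 hc.1
  · intro p
    have : (Finset.univ.filter fun x : PI deg a => x.1 = p) =
        Finset.univ.map ⟨fun k : Fin (a + 1 - deg p).natAbs => (⟨p, k⟩ : PI deg a), by
          intro x y hxy; simpa using hxy⟩ := by
      ext ⟨q, k⟩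
      simp only [Finset.mem_filter, Finset.mem_univ, true_and, Finset.mem_map,
        Function.Embedding.coeFn_mk]
      constructor
      · rintro rfl; exact ⟨k, rfl⟩
      · rintro ⟨k', hk⟩; exact (congrArg Sigma.fst hk).symm
    rw [this, Finset.card_map, Finset.card_univ, Fintype.card_fin]
  · exact fun g => pushD_ann P D h.sq deg a h.mem g

lemma radical_coeff {R : Type} [CommRing R] (J : Ideal R) (p q : Polynomial R)
    (h : ∀ k, (p * q).coeff k ∈ J.radical) (i j : ℕ) : p.coeff i * q.coeff j ∈ J.radical := by
  rw [Ideal.radical_eq_sInf, Ideal.mem_sInf]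
  intro Q hQ
  have hQ1 : Q.IsPrime := hQ.2
  have hJQ : J.radical ≤ Q := hQ1.radical_le_iff.2 hQ.1
  have h0 : (p * q).map (Ideal.Quotient.mk Q) = 0 := by
    ext k
    rw [Polynomial.coeff_map, Polynomial.coeff_zero]
    exact Ideal.Quotient.eq_zero_iff_mem.2 (hJQ (h k))
  rw [Polynomial.map_mul] at h0
  rcases mul_eq_zero.1 h0 with h0 | h0
  · apply Ideal.mul_mem_right
    have := congrArg (fun f => Polynomial.coeff f i) h0
    rw [Polynomial.coeff_map, Polynomial.coeff_zero] at this
    exact Ideal.Quotient.eq_zero_iff_mem.1 this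
  · apply Ideal.mul_mem_left
    have := congrArg (fun f => Polynomial.coeff f j) h0
    rw [Polynomial.coeff_map, Polynomial.coeff_zero] at this
    exact Ideal.Quotient.eq_zero_iff_mem.1 this

/-- constants into `A[s,t]` -/
def cst (A : Type) [CommRing A] : A →+* BP A := AddMonoidAlgebra.singleZeroRingHom

lemma cst_apply (a : A) : cst A a = AddMonoidAlgebra.single 0 a := rfl

theorem tower (N : ℕ) : ∀ (A : Type) [CommRing A] (P : ℤ → AddSubgroup A) (hP : MulP P)
    (p : Polynomial A) (hp : ∀ k, p.coeff k ∈ P 1) (d : ℕ) (hd : ∀ k, d ≤ k → p.coeff k = 0),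
    ∃ (R : Type) (_ : CommRing R) (Q : ℤ → AddSubgroup R) (q : Polynomial R) (ι : A →+* R),
      MulP Q ∧ (∀ k, q.coeff k ∈ Q 1) ∧ (∀ k, d + N ≤ k → q.coeff k = 0) ∧
      (∀ a : A, (∀ k, ∀ x ∈ P k, a * x ∈ P k) → ∀ k, ∀ x ∈ Q k, ι a * x ∈ Q k) ∧
      ∀ {I : Type} [Fintype I] [DecidableEq I] (D : Matrix I I R) (deg pos ord : I → ℤ),
        IsDM Q D deg pos ord → (∀ k, q.coeff k ∈ (AnnH D).radical) → ∀ rt : Fin N → ℤ,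
        ∃ (I' : Type) (_ : Fintype I') (_ : DecidableEq I') (o : I' → I) (D' : Matrix I' I' A),
          IsDM P D' (deg ∘ o)
            (fun x => pos (o x) - (Finset.univ.filter fun l => rt l < deg (o x)).card) (ord ∘ o) ∧
          (∀ p, (Finset.univ.filter fun x => o x = p).card = ∏ l, (rt l - deg p).natAbs) ∧
          ∀ k, p.coeff k ∈ (AnnH D').radical := by
  induction N with
  | zero =>
    intro A _ P hP p hp d hd
    refine ⟨A, inferInstance, P, p, RingHom.id A, hP, hp, hd, fun a h => h, ?_⟩
    intro I _ _ D deg pos ord h hq rt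
    refine ⟨I, inferInstance, inferInstance, id, D, ?_, ?_, hq⟩
    · simpa using h
    · intro p
      simp [Finset.filter_eq']
  | succ N ih =>
    intro A _ P hP p hp d hd
    set p' : Polynomial (BP A) := p.map (cst A) *
      (Polynomial.C (AddMonoidAlgebra.single (1, 0) 1) +
        Polynomial.C (AddMonoidAlgebra.single (0, 1) 1) * Polynomial.X) with hp'
    have hc0 : p'.coeff 0 = AddMonoidAlgebra.single (1, 0) (p.coeff 0) := by
      rw [hp', Polynomial.mul_coeff_zero]
      simp [cst_apply, AddMonoidAlgebra.single_mul_single]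
    have hcs : ∀ k, p'.coeff (k + 1) = AddMonoidAlgebra.single (1, 0) (p.coeff (k + 1)) +
        AddMonoidAlgebra.single (0, 1) (p.coeff k) := by
      intro k
      rw [hp', mul_add, ← mul_assoc, Polynomial.coeff_add, Polynomial.coeff_mul_C,
        Polynomial.coeff_mul_X, Polynomial.coeff_mul_C]
      simp [cst_apply, AddMonoidAlgebra.single_mul_single]
    have hsm : ∀ (m : ℕ × ℕ), m.1 + m.2 = 1 → ∀ a ∈ P 1,
        (AddMonoidAlgebra.single m a : BP A) ∈ PB P 1 := by
      intro m hm a ha m'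
      rw [AddMonoidAlgebra.coeff_single, Finsupp.single_apply]
      split_ifs with h
      · subst h; exact ⟨ha, fun _ => by omega⟩
      · exact ⟨(P 1).zero_mem, fun h => absurd rfl h⟩
    obtain ⟨R, iR, Q, q, ι, hQ, hq1, hqd, hQι, hmain⟩ := ih (BP A) (PB P) (PB_mul P hP) p' (by
      intro k
      cases k with
      | zero => rw [hc0]; exact hsm _ rfl _ (hp 0)
      | succ k => rw [hcs]; exact (PB P 1).add_mem (hsm _ rfl _ (hp _)) (hsm _ rfl _ (hp _)))
      (d + 1) (by
        intro k hk
        cases k with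
        | zero => omega
        | succ k => rw [hcs, hd _ (by omega), hd _ (by omega)]; simp)
    refine ⟨R, iR, Q, q, ι.comp (cst A), hQ, hq1, fun k hk => hqd k (by omega), ?_, ?_⟩
    · intro a ha k x hx
      refine hQι (cst A a) ?_ k x hx
      intro k f hf m
      have : (cst A a * f).coeff m = a * f.coeff m := by
        rw [cst_apply]
        exact AddMonoidAlgebra.coeff_single_zero_mul f a m
      rw [this]
      refine ⟨ha _ _ (hf m).1, fun h => (hf m).2 fun h0 => h ?_⟩
      rw [h0, mul_zero]
    · intro I _ _ D deg pos ord hDM hq rt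
      obtain ⟨I1, _, _, o1, D1, hD1, hcard1, hann1⟩ := hmain D deg pos ord hDM hq
        (fun l => rt l.succ)
      obtain ⟨I2, i2, j2, o2, D2, hD2, hcard2, hann2⟩ := push_step P hP D1 _ _ _ hD1 (rt 0)
      refine ⟨I2, i2, j2, o1 ∘ o2, D2, ?_, ?_, ?_⟩
      · have hfun : (fun x => pos ((o1 ∘ o2) x) - ((Finset.univ.filter
            fun l => rt l < deg ((o1 ∘ o2) x)).card : ℤ)) = (fun x => pos (o1 (o2 x)) -
            ((Finset.univ.filter fun l : Fin N => rt l.succ < deg (o1 (o2 x))).card : ℤ) -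
            if (deg ∘ o1) (o2 x) > rt 0 then 1 else 0) := ?_
        · rw [hfun]; exact hD2
        funext x
        simp only [Function.comp]
        have : (Finset.univ.filter fun l : Fin (N + 1) => rt l < deg (o1 (o2 x))).card =
            (if rt 0 < deg (o1 (o2 x)) then 1 else 0) +
            (Finset.univ.filter fun l : Fin N => rt l.succ < deg (o1 (o2 x))).card := by
          simp only [Finset.card_filter]
          rw [Fin.sum_univ_succ]
        rw [this]
        push_cast
        simp only [gt_iff_lt]
        split_ifs <;> ring
      · intro p
        rw [Fin.prod_univ_succ, ← hcard1 p, Finset.card_eq_sum_ones, mul_comm]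
        have := Finset.card_eq_sum_card_fiberwise (f := o2)
          (s := Finset.univ.filter fun x => (o1 ∘ o2) x = p)
          (t := Finset.univ.filter fun x => o1 x = p) (by
            intro x hx; simpa using hx)
        rw [← Finset.card_eq_sum_ones, this, Finset.card_eq_sum_ones, Finset.sum_mul]
        refine Finset.sum_congr rfl fun x hx => ?_
        simp only [Finset.mem_filter, Finset.mem_univ, true_and] at hx
        have h2 := hcard2 x
        simp only [Function.comp, hx] at h2
        rw [one_mul, ← h2, Finset.filter_filter]
        congr 1
        ext y
        simp only [Finset.mem_filter, Finset.mem_univ, true_and, Function.comp]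
        constructor
        · exact fun h => h.2
        · intro h; exact ⟨by rw [h, hx], h⟩
      · intro k
        have hr := radical_coeff (AnnH D1) _ _ hann1
        apply hann2
        · have := hr k 0
          simpa [cst_apply, AddMonoidAlgebra.single_mul_single] using this
        · have := hr k 1
          simpa [cst_apply, AddMonoidAlgebra.single_mul_single] using this

end step
end BS

namespace BS

lemma ann_of_homotopy {R : Type} [CommRing R] {I : Type} [Fintype I] [DecidableEq I]
    (D H : Matrix I I R) (y : R) (h : D * H + H * D = y • 1) : y ∈ AnnH D := by
  intro w hw
  refine ⟨H.mulVec w, ?_⟩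
  have := congrArg (fun M => M.mulVec w) h
  simp only [Matrix.add_mulVec, ← Matrix.mulVec_mulVec, hw, Matrix.mulVec_zero, add_zero,
    Matrix.smul_mulVec, Matrix.one_mulVec] at this
  exact this

theorem koszul {R : Type} [CommRing R] (Q : ℤ → AddSubgroup R) (L : ℕ) :
    ∀ (ys : Fin L → R) (hys : ∀ k, ys k ∈ Q 1),
    ∃ (I : Type) (_ : Fintype I) (_ : DecidableEq I) (D : Matrix I I R) (deg : I → ℕ),
      IsDM Q D (fun p => (deg p : ℤ)) (fun p => (deg p : ℤ)) (fun p => (deg p : ℤ)) ∧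
      (∀ j, (Finset.univ.filter fun p => deg p = j).card = L.choose j) ∧
      ∀ k, ∃ H : Matrix I I R, D * H + H * D = ys k • 1 := by
  induction L with
  | zero =>
    intro ys hys
    refine ⟨Unit, inferInstance, inferInstance, 0, fun _ => 0, ⟨by simp, ?_, ?_, ?_⟩, ?_, ?_⟩
    · intro p q; exact AddSubgroup.zero_mem _
    · intro p q h; exact absurd rfl h
    · intro p q h; exact absurd rfl h
    · intro j
      cases j with
      | zero => simp
      | succ j => simp
    · intro k; exact k.elim0
  | succ L ih =>
    intro ys hys
    obtain ⟨I, iI, jI, D, deg, hDM, hcount, hH⟩ := ih (fun k => ys k.succ) (fun k => hys _)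
    set y := ys 0 with hy
    refine ⟨I ⊕ I, inferInstance, inferInstance, Matrix.fromBlocks D (y • 1) 0 (-D),
      Sum.elim deg (fun p => deg p + 1), ⟨?_, ?_, ?_, ?_⟩, ?_, ?_⟩
    · rw [Matrix.fromBlocks_multiply]
      simp [hDM.sq]
    · rintro (p | p) (q | q)
      · exact hDM.mem p q
      · simp only [Matrix.fromBlocks_apply₁₂, Matrix.smul_apply, Matrix.one_apply, Sum.elim_inl,
          Sum.elim_inr]
        split_ifs with h
        · subst h
          simp only [smul_eq_mul, mul_one]
          convert hys 0 using 2; push_cast; ring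
        · simp [AddSubgroup.zero_mem]
      · exact AddSubgroup.zero_mem _
      · have := AddSubgroup.neg_mem _ (hDM.mem p q)
        simp only [Matrix.fromBlocks_apply₂₂, Sum.elim_inr]
        rw [Matrix.neg_apply]
        convert this using 2; push_cast; ring
    · rintro (p | p) (q | q) h
      · exact hDM.hpos p q h
      · simp only [Matrix.fromBlocks_apply₁₂, Matrix.smul_apply, Matrix.one_apply] at h
        split_ifs at h with h'
        · subst h'; simp
        · simp at h
      · exact absurd rfl h
      · have := hDM.hpos p q (by intro h0; apply h; simp [h0])
        simp only [Sum.elim_inr]; push_cast; omega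
    · rintro (p | p) (q | q) h
      · exact hDM.hord p q h
      · simp only [Matrix.fromBlocks_apply₁₂, Matrix.smul_apply, Matrix.one_apply] at h
        split_ifs at h with h'
        · subst h'; simp
        · simp at h
      · exact absurd rfl h
      · have := hDM.hord p q (by intro h0; apply h; simp [h0])
        simp only [Sum.elim_inr]; push_cast; omega
    · intro j
      rw [Finset.card_filter, Fintype.sum_sum_type]
      have e1 := hcount j
      rw [Finset.card_filter] at e1
      have e2 : (∑ p, if deg p + 1 = j then 1 else 0) =
          (Finset.univ.filter fun p => deg p + 1 = j).card := by rw [Finset.card_filter]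
      show (∑ p, if deg p = j then 1 else 0) + (∑ p, if deg p + 1 = j then 1 else 0) = _
      rw [e1, e2]
      cases j with
      | zero => simp
      | succ j =>
        rw [Nat.choose_succ_succ, ← hcount j, add_comm]
        simp
    · intro k
      refine Fin.cases ?_ (fun k => ?_) k
      · refine ⟨Matrix.fromBlocks 0 0 1 0, ?_⟩
        rw [Matrix.fromBlocks_multiply, Matrix.fromBlocks_multiply, Matrix.fromBlocks_add,
          ← Matrix.fromBlocks_one, Matrix.fromBlocks_smul]
        simp [hy]
      · obtain ⟨H, hH⟩ := hH k
        refine ⟨Matrix.fromBlocks H 0 0 (-H), ?_⟩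
        rw [Matrix.fromBlocks_multiply, Matrix.fromBlocks_multiply, Matrix.fromBlocks_add,
          ← Matrix.fromBlocks_one, Matrix.fromBlocks_smul]
        simp [hH]

end BS

namespace BS

section acyc

def trunc {R : Type} [CommRing R] {I : Type} (pos : I → ℤ) (b : ℤ) (y : I → R) : I → R :=
  fun p => if b < pos p then y p else 0

/-- supported in positions `> b` -/
def Sup {R : Type} [CommRing R] {I : Type} (pos : I → ℤ) (b : ℤ) (y : I → R) : Prop :=
  ∀ p, pos p ≤ b → y p = 0

lemma sup_trunc {R : Type} [CommRing R] {I : Type} (pos : I → ℤ) (b : ℤ) (y : I → R) :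
    Sup pos b (trunc pos b y) := by
  intro p hp; simp [trunc, not_lt.2 hp]

variable {R : Type} [CommRing R] {I : Type} [Fintype I] [DecidableEq I]

lemma D_trunc (D : Matrix I I R) (pos : I → ℤ) (hpos : ∀ p q, D p q ≠ 0 → pos p + 1 = pos q)
    (b : ℤ) (y : I → R) (h : Sup pos b (D.mulVec y)) :
    D.mulVec (trunc pos (b + 1) y) = D.mulVec y := by
  funext p
  by_cases hp : pos p ≤ b
  · rw [h p hp]
    refine Finset.sum_eq_zero fun q _ => ?_
    by_cases h0 : D p q = 0
    · simp [h0]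
    · have := hpos p q h0
      rw [sup_trunc pos (b + 1) y q (by omega), mul_zero]
  · refine Finset.sum_congr rfl fun q _ => ?_
    by_cases h0 : D p q = 0
    · simp [h0]
    · have := hpos p q h0
      rw [trunc, if_pos (by omega)]

lemma sup_D (D : Matrix I I R) (pos : I → ℤ) (hpos : ∀ p q, D p q ≠ 0 → pos p + 1 = pos q)
    (b : ℤ) (y : I → R) (h : Sup pos (b + 1) y) : Sup pos b (D.mulVec y) := by
  intro p hp
  refine Finset.sum_eq_zero fun q _ => ?_
  by_cases h0 : D p q = 0
  · simp [h0]
  · have := hpos p q h0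
    rw [h q (by omega), mul_zero]

lemma sup_mono (pos : I → ℤ) (b b' : ℤ) (hb : b ≤ b') (y : I → R) (h : Sup pos b' y) :
    Sup pos b y := fun p hp => h p (hp.trans hb)

/-- The map `R → R'` is the quotient by the nonzerodivisor `x`. -/
structure QuotBy {R' : Type} [CommRing R'] (φ : R →+* R') (x : R) : Prop where
  surj : Function.Surjective φ
  ker : ∀ a, φ a = 0 → ∃ b, a = x * b
  zero : φ x = 0
  nzd : ∀ a, x * a = 0 → a = 0

variable {R' : Type} [CommRing R'] {φ : R →+* R'} {x : R}

lemma map_mulVec' (D : Matrix I I R) (w : I → R) :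
    (D.map φ).mulVec (fun p => φ (w p)) = fun p => φ (D.mulVec w p) := by
  funext p
  simp [Matrix.mulVec, dotProduct]

/-- key lifting lemma: annihilation passes to the quotient by `x`. -/
lemma quot_ann (hq : QuotBy φ x) (D : Matrix I I R) (hD : D * D = 0) (pos : I → ℤ)
    (hpos : ∀ p q, D p q ≠ 0 → pos p + 1 = pos q) (b : ℤ) (g : R)
    (h : ∀ w, Sup pos b w → D.mulVec w = 0 → ∃ y, D.mulVec y = g • w) :
    ∀ w, Sup pos (b + 1) w → (D.map φ).mulVec w = 0 →
      ∃ y, (D.map φ).mulVec y = φ (g * g) • w := by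
  intro wb hwb hcb
  choose ψ hψ using hq.surj
  set w : I → R := trunc pos (b + 1) (fun p => ψ (wb p)) with hw
  have hφw : (fun p => φ (w p)) = wb := by
    funext p
    simp only [hw, trunc]
    split_ifs with hp
    · rw [hψ]
    · rw [map_zero, hwb p (by omega)]
  have hs : Sup pos (b + 1) w := sup_trunc _ _ _
  have h1 : ∀ p, φ (D.mulVec w p) = 0 := by
    intro p
    have := map_mulVec' (φ := φ) D w
    rw [hφw, hcb] at this
    exact (congrFun this p).symm
  choose v hv using fun p => hq.ker _ (h1 p)
  have hv' : D.mulVec w = x • v := by funext p; exact hv p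
  have hvs : Sup pos b v := by
    intro p hp
    apply hq.nzd
    rw [← hv p]; exact sup_D D pos hpos b w hs p hp
  have hDv : D.mulVec v = 0 := by
    funext p
    apply hq.nzd
    have : x • D.mulVec v = 0 := by
      rw [← Matrix.mulVec_smul, ← hv', Matrix.mulVec_mulVec, hD, Matrix.zero_mulVec]
    exact congrFun this p
  obtain ⟨u0, hu0⟩ := h v hvs hDv
  have hu : D.mulVec (trunc pos (b + 1) u0) = g • v := by
    rw [D_trunc D pos hpos, hu0]
    rw [hu0]; intro p hp; simp [hvs p hp]
  set u := trunc pos (b + 1) u0 with hu_def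
  have hus : Sup pos (b + 1) u := sup_trunc _ _ _
  obtain ⟨y, hy⟩ := h (g • w - x • u) (by
    intro p hp
    simp [hs p (by omega), hus p (by omega)]) (by
    rw [Matrix.mulVec_sub, Matrix.mulVec_smul, Matrix.mulVec_smul, hu, hv', smul_comm, sub_self])
  refine ⟨fun p => φ (y p), ?_⟩
  rw [map_mulVec', hy]
  funext p
  have := congrFun hφw p
  simp [hq.zero, this, mul_assoc]

/-- cancelling `x` -/
lemma cancel_x (hq : QuotBy φ x) (D : Matrix I I R) (hD : D * D = 0) (pos : I → ℤ)
    (hpos : ∀ p q, D p q ≠ 0 → pos p + 1 = pos q) (b : ℤ)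
    (h : ∀ w, Sup pos (b + 1) w → (D.map φ).mulVec w = 0 → ∃ y, (D.map φ).mulVec y = w)
    (w : I → R) (hw : Sup pos b w) (y : I → R) (hy : D.mulVec y = x • w) :
    ∃ y', D.mulVec y' = w := by
  have hy2 : D.mulVec (trunc pos (b + 1) y) = x • w := by
    rw [D_trunc D pos hpos, hy]
    rw [hy]; intro p hp; simp [hw p hp]
  set t := trunc pos (b + 1) y with ht
  have hts : Sup pos (b + 1) t := sup_trunc _ _ _
  obtain ⟨zb, hzb⟩ := h (fun p => φ (t p)) (by intro p hp; simp [hts p hp]) (by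
    rw [map_mulVec', hy2]; funext p; simp [hq.zero])
  choose ψ hψ using hq.surj
  have hz : ∀ p, φ (t p - D.mulVec (fun p => ψ (zb p)) p) = 0 := by
    intro p
    have := map_mulVec' (φ := φ) D (fun p => ψ (zb p))
    simp only [hψ] at this
    rw [hzb] at this
    have := congrFun this p
    rw [map_sub, this, sub_self]
  choose y' hy' using fun p => hq.ker _ (hz p)
  refine ⟨y', ?_⟩
  have e : t = D.mulVec (fun p => ψ (zb p)) + x • y' := by
    funext p
    have := hy' p
    simp only [Pi.add_apply, Pi.smul_apply, smul_eq_mul, ← this]; ring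
  have : x • D.mulVec y' = x • w := by
    rw [← hy2, e, Matrix.mulVec_add, Matrix.mulVec_mulVec, hD, Matrix.zero_mulVec, zero_add,
      Matrix.mulVec_smul]
  funext p
  have := congrFun this p
  simp only [Pi.smul_apply, smul_eq_mul] at this
  exact sub_eq_zero.1 (hq.nzd _ (by rw [mul_sub, this, sub_self]))

end acyc

/-- regular sequences, via iterated quotients -/
def Reg : (c : ℕ) → (R : Type) → [CommRing R] → (Fin c → R) → Prop
  | 0, _, _, _ => True
  | c + 1, R, _, x => ∃ (R' : Type) (_ : CommRing R') (φ : R →+* R'), QuotBy φ (x 0) ∧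
      Reg c R' (fun k => φ (x k.succ))

theorem acyclic (c : ℕ) : ∀ (R : Type) [CommRing R] (x : Fin c → R) (hx : Reg c R x)
    {I : Type} [Fintype I] [DecidableEq I]
    (D : Matrix I I R) (hD : D * D = 0) (pos : I → ℤ)
    (hpos : ∀ p q, D p q ≠ 0 → pos p + 1 = pos q) (b : ℤ) (hb : ∀ p, pos p ≤ b + c)
    (h : ∀ k, ∃ M : ℕ, ∀ w, Sup pos b w → D.mulVec w = 0 → ∃ y, D.mulVec y = x k ^ M • w),
    ∀ w, Sup pos b w → D.mulVec w = 0 → ∃ y, D.mulVec y = w := by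
  induction c with
  | zero =>
    intro R _ x hx I _ _ D hD pos hpos b hb h w hw _
    refine ⟨0, ?_⟩
    rw [Matrix.mulVec_zero]
    funext p
    exact (hw p (by simpa using hb p)).symm
  | succ c ih =>
    intro R _ x hx I _ _ D hD pos hpos b hb h
    obtain ⟨R', _, φ, hq, hreg⟩ := hx
    have hex : ∀ w, Sup pos (b + 1) w → (D.map φ).mulVec w = 0 →
        ∃ y, (D.map φ).mulVec y = w := by
      refine ih R' _ hreg (D.map φ) ?_ pos ?_ (b + 1) ?_ ?_
      · rw [← Matrix.map_mul, hD]; simp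
      · intro p q hpq
        apply hpos p q; intro h0; apply hpq; simp [h0]
      · intro p; have := hb p; push_cast at this; omega
      · intro k
        obtain ⟨M, hM⟩ := h k.succ
        refine ⟨M + M, fun w hw hc => ?_⟩
        obtain ⟨y, hy⟩ := quot_ann hq D hD pos hpos b _ hM w hw hc
        exact ⟨y, by rw [hy, ← pow_add, map_pow]⟩
    obtain ⟨M, hM⟩ := h 0
    have key : ∀ m : ℕ, ∀ w, Sup pos b w → (∃ y, D.mulVec y = x 0 ^ m • w) →
        ∃ y, D.mulVec y = w := by
      intro m
      induction m with
      | zero => intro w hw ⟨y, hy⟩; exact ⟨y, by simpa using hy⟩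
      | succ m ihm =>
        intro w hw ⟨y, hy⟩
        apply ihm w hw
        refine cancel_x hq D hD pos hpos b hex (x 0 ^ m • w) ?_ y ?_
        · intro p hp; simp [hw p hp]
        · rw [hy, pow_succ', mul_smul]
    intro w hw hc
    exact key M w hw (hM w hw hc)

/-- killing the first variable -/
def killX (K : Type) [Field K] (n : ℕ) : MvPolynomial (Fin (n + 1)) K →+* MvPolynomial (Fin n) K :=
  (Polynomial.constantCoeff).comp (finSuccEquiv K n).toRingHom

lemma killX_apply (K : Type) [Field K] (n : ℕ) (f : MvPolynomial (Fin (n + 1)) K) :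
    killX K n f = (finSuccEquiv K n f).coeff 0 := rfl

lemma killX_quot (K : Type) [Field K] (n : ℕ) : QuotBy (killX K n) (X 0) where
  surj f := by
    refine ⟨(finSuccEquiv K n).symm (Polynomial.C f), ?_⟩
    rw [killX_apply]; simp
  ker a h := by
    rw [killX_apply] at h
    obtain ⟨b, hb⟩ := Polynomial.X_dvd_iff.2 h
    refine ⟨(finSuccEquiv K n).symm b, ?_⟩
    apply (finSuccEquiv K n).injective
    rw [hb, map_mul, finSuccEquiv_X_zero, AlgEquiv.apply_symm_apply]
  zero := by rw [killX_apply, finSuccEquiv_X_zero]; simp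
  nzd a h := by
    rcases mul_eq_zero.1 h with h | h
    · exact absurd h (X_ne_zero 0)
    · exact h

lemma killX_succ (K : Type) [Field K] (n : ℕ) (k : Fin n) : killX K n (X k.succ) = X k := by
  rw [killX_apply, finSuccEquiv_X_succ]; simp

lemma reg_X (K : Type) [Field K] (c : ℕ) : ∀ (n : ℕ) (h : c ≤ n),
    Reg c (MvPolynomial (Fin n) K) (fun k => X (Fin.castLE h k)) := by
  induction c with
  | zero => intro n h; trivial
  | succ c ih =>
    intro n h
    obtain ⟨n, rfl⟩ : ∃ m, n = m + 1 := ⟨n - 1, by omega⟩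
    refine ⟨MvPolynomial (Fin n) K, inferInstance, killX K n, killX_quot K n, ?_⟩
    have := ih n (by omega)
    convert this using 2 with k
    rw [← killX_succ]
    rfl

lemma constantCoeff_killX (K : Type) [Field K] (n : ℕ) (f : MvPolynomial (Fin (n + 1)) K) :
    constantCoeff (killX K n f) = constantCoeff f := by
  have : (constantCoeff).comp (killX K n) =
      (constantCoeff : MvPolynomial (Fin (n + 1)) K →+* K) := by
    apply MvPolynomial.ringHom_ext
    · intro r
      simp [killX_apply, finSuccEquiv_apply]
    · intro i
      refine Fin.cases ?_ (fun k => ?_) i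
      · simp [(killX_quot K n).zero]
      · simp [killX_succ]
  exact congrArg (fun g => g f) this

/-- Hilbert's syzygy bound for minimal complexes -/
theorem syzygy_bound (K : Type) [Field K] (n : ℕ) : ∀ {I : Type} [Fintype I] [DecidableEq I]
    (D : Matrix I I (MvPolynomial (Fin n) K)) (hD : D * D = 0) (pos : I → ℤ)
    (hpos : ∀ p q, D p q ≠ 0 → pos p + 1 = pos q) (b : ℤ)
    (hmin : ∀ p q, constantCoeff (D p q) = 0)
    (h : ∀ w, Sup pos b w → D.mulVec w = 0 → ∃ y, D.mulVec y = w) (p : I), pos p ≤ b + n := by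
  induction n with
  | zero =>
    intro I _ _ D hD pos hpos b hmin h p
    have hD0 : D = 0 := by
      ext p q : 2
      rw [eq_C_of_isEmpty (D p q)]
      have := hmin p q
      rw [constantCoeff_eq] at this
      rw [this]; simp
    by_contra hp
    obtain ⟨y, hy⟩ := h (Pi.single p 1) (by
      intro q hq
      rw [Pi.single_eq_of_ne]
      rintro rfl; simp at hp; omega) (by rw [hD0, Matrix.zero_mulVec])
    rw [hD0, Matrix.zero_mulVec] at hy
    have := congrFun hy p
    simp at this
  | succ n ih =>
    intro I _ _ D hD pos hpos b hmin h p
    have := ih (D.map (killX K n)) (by rw [← Matrix.map_mul, hD]; simp) pos (by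
      intro p q hpq
      apply hpos p q; intro h0; apply hpq; simp [h0]) (b + 1) (by
      intro p q; rw [Matrix.map_apply, constantCoeff_killX]; exact hmin p q) (by
      intro w hw hc
      obtain ⟨y, hy⟩ := quot_ann (killX_quot K n) D hD pos hpos b 1
        (fun w hw hc => by simpa using h w hw hc) w hw hc
      exact ⟨y, by simpa using hy⟩) p
    push_cast; omega

end BS

namespace BS

section comb

/-- signed weighted sum of a table -/
def Phi {c : ℕ} (g : Fin (c+1) → ℤ → ℚ) (γ : Fin (c+1) → ℤ →₀ ℚ) : ℚ :=
  ∑ i : Fin (c+1), (-1:ℚ)^(i:ℕ) * (γ i).sum fun j v => v * g i j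

/-- coefficients of the pure table -/
def piC {c : ℕ} (d : Fin (c+1) → ℤ) (i : Fin (c+1)) : ℚ :=
  ∏ l ∈ univ.erase i, (((d l - d i).natAbs : ℚ))⁻¹

/-- pure table as finitely supported functions -/
def pT {c : ℕ} (d : Fin (c+1) → ℤ) (i : Fin (c+1)) : ℤ →₀ ℚ :=
  Finsupp.single (d i) (piC d i)

/-- weight of the functional -/
def Lw {c : ℕ} (e : Fin (c+1) → ℤ) (τ : Fin c) (i : Fin (c+1)) (j : ℤ) : ℚ :=
  if j ≤ e i then ∏ l ∈ (univ.erase τ.castSucc).erase τ.succ, ((e l - j : ℤ) : ℚ) else 0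

/-- Herzog-Kuehl equations -/
def HK {c : ℕ} (γ : Fin (c+1) → ℤ →₀ ℚ) : Prop :=
  ∀ f : Polynomial ℚ, f.degree < c → Phi (fun _ j => f.eval (j:ℚ)) γ = 0

lemma Phi_sub_smul {c : ℕ} (g : Fin (c+1) → ℤ → ℚ) (γ δ : Fin (c+1) → ℤ →₀ ℚ) (s : ℚ) :
    Phi g (fun i => γ i - s • δ i) = Phi g γ - s * Phi g δ := by
  unfold Phi
  rw [Finset.mul_sum, ← Finset.sum_sub_distrib]
  refine Finset.sum_congr rfl fun i _ => ?_
  rw [Finsupp.sum_sub_index (by intros; ring), Finsupp.sum_smul_index (by intros; ring)]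
  have : ((δ i).sum fun j v => s * v * g i j) = s * (δ i).sum fun j v => v * g i j := by
    rw [Finsupp.sum, Finsupp.sum, Finset.mul_sum]
    exact Finset.sum_congr rfl fun _ _ => by ring
  rw [this]; ring

lemma Phi_pT {c : ℕ} (g : Fin (c+1) → ℤ → ℚ) (d : Fin (c+1) → ℤ) :
    Phi g (pT d) = ∑ i : Fin (c+1), (-1:ℚ)^(i:ℕ) * (piC d i * g i (d i)) := by
  unfold Phi pT
  refine Finset.sum_congr rfl fun i _ => ?_
  rw [Finsupp.sum_single_index (by ring)]

lemma piC_pos {c : ℕ} {d : Fin (c+1) → ℤ} (hd : StrictMono d) (i : Fin (c+1)) : 0 < piC d i := by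
  unfold piC
  refine Finset.prod_pos fun l hl => ?_
  have : d l ≠ d i := fun h => (Finset.ne_of_mem_erase hl) (hd.injective h)
  have : 0 < (d l - d i).natAbs := Int.natAbs_pos.2 (sub_ne_zero.2 this)
  positivity

lemma sign_piC {c : ℕ} {d : Fin (c+1) → ℤ} (hd : StrictMono d) (i : Fin (c+1)) :
    (-1:ℚ)^(i:ℕ) * piC d i = (-1)^c * ∏ l ∈ univ.erase i, ((d i : ℚ) - d l)⁻¹ := by
  have h1 : ∀ l ∈ univ.erase i, ((d i : ℚ) - d l)⁻¹ =
      (if i < l then (-1:ℚ) else 1) * (((d l - d i).natAbs : ℚ))⁻¹ := by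
    intro l hl
    have hne := Finset.ne_of_mem_erase hl
    rw [Nat.cast_natAbs]
    split_ifs with h
    · have := hd h
      rw [abs_of_pos (by omega)]; push_cast
      rw [neg_one_mul, ← inv_neg]; ring
    · have := hd (lt_of_le_of_ne (not_lt.1 h) hne)
      rw [abs_of_neg (by omega)]; push_cast
      rw [one_mul]; ring
  rw [Finset.prod_congr rfl h1, Finset.prod_mul_distrib, Finset.prod_ite, Finset.prod_const,
    Finset.prod_const_one, mul_one]
  have h2 : (Finset.filter (fun l => i < l) (univ.erase i)) = Finset.Ioi i := by
    ext l; simp; intro h; exact h.ne'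
  rw [h2, Fin.card_Ioi]
  unfold piC
  rw [← mul_assoc, ← pow_add]
  congr 1
  have : c + (c + 1 - 1 - (i:ℕ)) = (i:ℕ) + 2 * (c - i) := by omega
  rw [this, pow_add, pow_mul]; simp

lemma pT_top {c : ℕ} {d : Fin (c+1) → ℤ} (hd : StrictMono d) (f : Polynomial ℚ)
    (hf : f.degree ≤ c) : Phi (fun _ j => f.eval (j:ℚ)) (pT d) = (-1)^c * f.coeff c := by
  rw [Phi_pT]
  have inj : Set.InjOn (fun i => (d i : ℚ)) ((univ : Finset (Fin (c+1))) : Set (Fin (c+1))) := by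
    intro a _ b _ h
    simp only [Int.cast_inj] at h
    exact hd.injective h
  have := Lagrange.coeff_eq_sum (v := fun i => (d i : ℚ)) (P := f) inj (by
      rw [card_univ, Fintype.card_fin]
      exact lt_of_le_of_lt hf (by exact_mod_cast Nat.lt_succ_self c))
  simp only [card_univ, Fintype.card_fin, Nat.add_sub_cancel] at this
  rw [this, Finset.mul_sum]
  refine Finset.sum_congr rfl fun i _ => ?_
  rw [← mul_assoc, sign_piC hd, Finset.prod_inv_distrib]
  field_simp

lemma HK_pT {c : ℕ} {d : Fin (c+1) → ℤ} (hd : StrictMono d) : HK (pT d) := by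
  intro f hf
  rw [pT_top hd f hf.le, Polynomial.coeff_eq_zero_of_degree_lt hf, mul_zero]

/-- the polynomial behind `Lw` -/
def Lp {c : ℕ} (e : Fin (c+1) → ℤ) (s : Finset (Fin (c+1))) : Polynomial ℚ :=
  ∏ l ∈ s, (Polynomial.C (e l : ℚ) - Polynomial.X)

lemma Lp_eval {c : ℕ} (e : Fin (c+1) → ℤ) (s) (j : ℤ) :
    (Lp e s).eval (j:ℚ) = ∏ l ∈ s, ((e l - j : ℤ) : ℚ) := by
  simp [Lp, Polynomial.eval_prod]

lemma Lp_deg {c : ℕ} (e : Fin (c+1) → ℤ) (a b : Fin (c+1)) (h : a ≠ b) :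
    (Lp e ((univ.erase a).erase b)).degree < c := by
  have h1 : (Lp e ((univ.erase a).erase b)).degree ≤ ((univ.erase a).erase b).card := by
    unfold Lp
    refine (Polynomial.degree_prod_le _ _).trans ?_
    refine (Finset.sum_le_card_nsmul _ _ 1 fun l _ => ?_).trans (by simp)
    refine (Polynomial.degree_sub_le _ _).trans ?_
    refine max_le (Polynomial.degree_C_le.trans (by norm_num)) (by simp)
  refine lt_of_le_of_lt h1 ?_
  rw [Finset.card_erase_of_mem (by simp [h.symm]), Finset.card_erase_of_mem (by simp)]
  simp only [card_univ, Fintype.card_fin]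
  have ha := a.2; have hb := b.2
  have : (a:ℕ) ≠ b := fun hh => h (Fin.ext hh)
  exact_mod_cast (by omega : c + 1 - 1 - 1 < c)

lemma L_pT {c : ℕ} {d e : Fin (c+1) → ℤ} (hd : StrictMono d) (hde : d ≤ e) (τ : Fin c) :
    Phi (Lw e τ) (pT d) = 0 := by
  rw [← HK_pT hd _ (Lp_deg e τ.castSucc τ.succ (Fin.castSucc_lt_succ.ne)), Phi_pT, Phi_pT]
  refine Finset.sum_congr rfl fun i _ => ?_
  rw [Lp_eval, Lw, if_pos (hde i)]

/-- two-point consequence of HK -/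
lemma HK_unique {c : ℕ} {d : Fin (c+1) → ℤ} (hd : StrictMono d) (γ : Fin (c+1) → ℤ →₀ ℚ)
    (h : HK γ) (hs : ∀ i j, j ≠ d i → γ i j = 0) : ∃ t : ℚ, ∀ i, γ i = t • pT d i := by
  refine ⟨γ 0 (d 0) / piC d 0, ?_⟩
  set t := γ 0 (d 0) / piC d 0 with ht
  have hδ0 : ∀ i, γ i = Finsupp.single (d i) (γ i (d i)) := by
    intro i; ext j
    by_cases hj : j = d i
    · subst hj; simp
    · rw [hs i j hj, Finsupp.single_eq_of_ne hj]
  have h0 := piC_pos hd 0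
  intro i
  rcases eq_or_ne i 0 with rfl | hi
  · rw [hδ0 0]; simp only [pT, Finsupp.smul_single, smul_eq_mul, ht]
    congr 1; field_simp
  have h1 := h _ (Lp_deg d 0 i hi.symm)
  have h2 := HK_pT hd _ (Lp_deg d 0 i hi.symm)
  have h3 : Phi (fun _ j => (Lp d ((univ.erase 0).erase i)).eval (j:ℚ)) (fun k => γ k - t • pT d k) = 0 := by
    rw [Phi_sub_smul, h1, h2]; ring
  have hδ : ∀ k, γ k - t • pT d k = Finsupp.single (d k) (γ k (d k) - t * piC d k) := by
    intro k; rw [hδ0 k]; simp [pT]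
  unfold Phi at h3
  rw [Finset.sum_eq_single i] at h3
  · beta_reduce at h3
    rw [hδ i, Finsupp.sum_single_index (by ring), Lp_eval] at h3
    have h4 : ∏ l ∈ (univ.erase 0).erase i, ((d l - d i : ℤ) : ℚ) ≠ 0 := by
      refine Finset.prod_ne_zero_iff.2 fun l hl => ?_
      have : d l ≠ d i := fun h => (Finset.ne_of_mem_erase hl) (hd.injective h)
      exact_mod_cast sub_ne_zero.2 this
    have h5 : γ i (d i) - t * piC d i = 0 := by
      rcases mul_eq_zero.1 h3 with h | h
      · exact absurd h (by simp)
      · exact (mul_eq_zero.1 h).resolve_right h4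
    have := hδ i
    rw [h5, Finsupp.single_zero] at this
    exact sub_eq_zero.1 this
  · intro k _ hk
    beta_reduce
    rw [hδ k, Finsupp.sum_single_index (by ring), Lp_eval]
    rcases eq_or_ne k 0 with rfl | hk0
    · have : γ 0 (d 0) - t * piC d 0 = 0 := by rw [ht]; field_simp; ring
      rw [this]; ring
    · rw [Finset.prod_eq_zero (i := k) (by simp [hk, hk0]) (by simp)]; ring
  · simp

end comb
end BS

namespace BS

section comb2

/-- the running invariant of the greedy decomposition -/
structure Inv {c : ℕ} (B : ℤ) (b : Fin (c+1) → ℤ) (γ : Fin (c+1) → ℤ →₀ ℚ) : Prop where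
  mono : StrictMono b
  le : ∀ i, b i ≤ B + (i:ℕ)
  low : ∀ i j, j < b i → γ i j = 0
  nonneg : ∀ i j, j < B → 0 ≤ γ i j
  high : ∀ (i : Fin (c+1)) j, B ≤ j → j ≠ B + (i:ℕ) → γ i j = 0
  hk : HK γ
  ineq : ∀ e : Fin (c+1) → ℤ, StrictMono e → b ≤ e → ∀ τ : Fin c,
    e τ.succ = e τ.castSucc + 1 → 0 ≤ Phi (Lw e τ) γ

open Classical in
/-- lowest degree, or the default -/
def lowD {c : ℕ} (B : ℤ) (γ : Fin (c+1) → ℤ →₀ ℚ) (i : Fin (c+1)) : ℤ :=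
  if h : ((γ i).support.filter (· < B)).Nonempty then ((γ i).support.filter (· < B)).min' h
  else B + (i:ℕ)

lemma lowD_cases {c : ℕ} (B : ℤ) (γ : Fin (c+1) → ℤ →₀ ℚ) (i : Fin (c+1)) :
    (lowD B γ i < B ∧ γ i (lowD B γ i) ≠ 0 ∧ ∀ j, j < lowD B γ i → γ i j = 0) ∨
    (lowD B γ i = B + (i:ℕ) ∧ ∀ j, j < B → γ i j = 0) := by
  unfold lowD
  split_ifs with h
  · left
    have h1 := Finset.min'_mem _ h
    set m := ((γ i).support.filter (· < B)).min' h with hm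
    simp only [Finset.mem_filter, Finsupp.mem_support_iff] at h1
    refine ⟨h1.2, h1.1, fun j hj => ?_⟩
    by_contra h0
    have : m ≤ j := Finset.min'_le _ _ (by
      simp only [Finset.mem_filter, Finsupp.mem_support_iff]; exact ⟨h0, hj.trans h1.2⟩)
    omega
  · right
    refine ⟨rfl, fun j hj => ?_⟩
    by_contra h0
    exact h ⟨j, by simp only [Finset.mem_filter, Finsupp.mem_support_iff]; exact ⟨h0, hj⟩⟩

lemma lowD_low {c : ℕ} {B : ℤ} {b : Fin (c+1) → ℤ} {γ : Fin (c+1) → ℤ →₀ ℚ} (H : Inv B b γ)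
    (i : Fin (c+1)) (j : ℤ) (hj : j < lowD B γ i) : γ i j = 0 := by
  rcases lowD_cases B γ i with ⟨_, _, h⟩ | ⟨h1, h2⟩
  · exact h j hj
  · by_cases hB : j < B
    · exact h2 j hB
    · exact H.high i j (not_lt.1 hB) (by omega)

lemma le_lowD {c : ℕ} {B : ℤ} {b : Fin (c+1) → ℤ} {γ : Fin (c+1) → ℤ →₀ ℚ} (H : Inv B b γ)
    (i : Fin (c+1)) : b i ≤ lowD B γ i := by
  rcases lowD_cases B γ i with ⟨_, h0, h⟩ | ⟨h1, h2⟩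
  · by_contra hh
    exact h0 (H.low i _ (not_le.1 hh))
  · rw [h1]; exact H.le i

lemma prod_sign {ι : Type*} [DecidableEq ι] (s : Finset ι) (f : ι → ℤ) (p : ι → Prop) [DecidablePred p]
    (h1 : ∀ i ∈ s, p i → f i < 0) (h2 : ∀ i ∈ s, ¬ p i → 0 < f i) :
    0 < (-1:ℚ)^(s.filter p).card * ∏ i ∈ s, ((f i : ℤ) : ℚ) := by
  induction s using Finset.induction_on with
  | empty => simp
  | insert a s ha ih =>
    have ih' := ih (fun i hi => h1 i (by simp [hi])) (fun i hi => h2 i (by simp [hi]))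
    rw [Finset.prod_insert ha, Finset.filter_insert]
    split_ifs with hp
    · rw [Finset.card_insert_of_notMem (by simp [ha]), pow_succ]
      have : ((f a : ℤ):ℚ) < 0 := by exact_mod_cast h1 a (by simp) hp
      nlinarith
    · have : 0 < ((f a : ℤ):ℚ) := by exact_mod_cast h2 a (by simp) hp
      have := mul_pos this ih'
      linarith

lemma lowD_step {c : ℕ} {B : ℤ} {b : Fin (c+1) → ℤ} {γ : Fin (c+1) → ℤ →₀ ℚ} (H : Inv B b γ)
    (τ : Fin c) (hup : ∀ σ : Fin c, τ < σ → lowD B γ σ.castSucc < lowD B γ σ.succ) :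
    lowD B γ τ.castSucc < lowD B γ τ.succ := by
  by_contra hbad
  rw [not_lt] at hbad
  set d := lowD B γ with hd
  obtain ⟨hD, hD0⟩ : d τ.succ < B ∧ γ τ.succ (d τ.succ) ≠ 0 := by
    rcases lowD_cases B γ τ.succ with ⟨h, h', _⟩ | ⟨h, _⟩
    · exact ⟨h, h'⟩
    · exfalso
      rw [← hd] at h
      rcases lowD_cases B γ τ.castSucc with ⟨h', _⟩ | ⟨h', _⟩ <;> rw [← hd] at h' <;>
        simp only [Fin.val_succ, Fin.val_castSucc] at h h' <;> omega
  set D := d τ.succ with hDdef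
  have hDpos : 0 < γ τ.succ D := lt_of_le_of_ne (H.nonneg _ _ hD) (Ne.symm hD0)
  have hb1 : b τ.castSucc < b τ.succ := H.mono Fin.castSucc_lt_succ
  have hb2 : b τ.succ ≤ D := le_lowD H _
  set e : Fin (c+1) → ℤ := fun i => if (i:ℕ) < τ then b i else if (i:ℕ) = τ then D - 1 else d i with he
  have e_lt : ∀ i : Fin (c+1), (i:ℕ) < τ → e i = b i := fun i hi => by simp [he, hi]
  have e_eq : e τ.castSucc = D - 1 := by simp [he]
  have e_gt : ∀ i : Fin (c+1), (τ:ℕ) < i → e i = d i := fun i hi => by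
    simp only [he]; rw [if_neg (by omega), if_neg (by omega)]
  have e_succ : e τ.succ = D := e_gt _ (by simp)
  have hmono : StrictMono e := by
    rw [Fin.strictMono_iff_lt_succ]
    intro i
    rcases lt_trichotomy (i:ℕ) τ with h | h | h
    · rw [e_lt _ (by simpa using h)]
      rcases Nat.lt_or_ge ((i:ℕ)+1) τ with h' | h'
      · rw [e_lt _ (by simpa using h')]; exact H.mono Fin.castSucc_lt_succ
      · have : i.succ = τ.castSucc := Fin.ext (by simp; omega)
        rw [this, e_eq]
        have : b i.castSucc < b τ.castSucc := H.mono (by rw [Fin.lt_def]; simpa using h)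
        omega
    · have : i = τ := Fin.ext h
      subst this
      rw [e_eq, e_succ]; omega
    · rw [e_gt _ (by simpa using h), e_gt _ (by simp; omega)]
      exact hup i h
  have hbe : b ≤ e := by
    intro i
    rcases lt_trichotomy (i:ℕ) τ with h | h | h
    · rw [e_lt _ h]
    · have : i = τ.castSucc := Fin.ext (by simpa using h)
      rw [this, e_eq]; show b _ ≤ D - 1; omega
    · rw [e_gt _ h]; exact le_lowD H i
  have hL := H.ineq e hmono hbe τ (by rw [e_eq, e_succ]; ring)
  have hzero : ∀ i : Fin (c+1), i ≠ τ.succ → ∀ j, γ i j * Lw e τ i j = 0 := by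
    intro i hi j
    unfold Lw
    split_ifs with hj
    swap
    · ring
    rcases lt_trichotomy (i:ℕ) τ with h | h | h
    · rw [e_lt _ h] at hj
      rcases hj.lt_or_eq with hj | hj
      · rw [H.low _ _ hj]; ring
      · rw [Finset.prod_eq_zero (i := i), mul_zero]
        · simp only [Finset.mem_erase, Finset.mem_univ, and_true]
          exact ⟨hi, fun h' => by rw [h'] at h; simp at h⟩
        · rw [e_lt _ h, hj]; simp
    · have h' : i = τ.castSucc := Fin.ext (by simpa using h)
      rw [h', e_eq] at hj
      rw [h', lowD_low H _ _ (by rw [← hd]; omega)]; ring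
    · rw [e_gt _ h] at hj
      rcases hj.lt_or_eq with hj | hj
      · rw [lowD_low H _ _ hj]; ring
      · rw [Finset.prod_eq_zero (i := i), mul_zero]
        · simp only [Finset.mem_erase, Finset.mem_univ, and_true]
          exact ⟨hi, fun h' => by rw [h'] at h; simp at h⟩
        · rw [e_gt _ h, hj]; simp
  unfold Phi at hL
  rw [Finset.sum_eq_single τ.succ] at hL
  rotate_left
  · intro i _ hi
    rw [Finsupp.sum, Finset.sum_eq_zero fun j _ => hzero i hi j, mul_zero]
  · simp
  rw [Finsupp.sum, Finset.sum_eq_single D] at hL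
  rotate_left
  · intro j _ hj
    unfold Lw
    split_ifs with h
    · rw [e_succ] at h
      rw [lowD_low H _ _ (lt_of_le_of_ne h hj)]; ring
    · ring
  · intro h; simp at h; exact absurd h hD0
  rw [Lw, if_pos e_succ.ge] at hL
  have hs := prod_sign ((univ.erase τ.castSucc).erase τ.succ) (fun l => e l - D) (fun l => (l:ℕ) < τ)
    (by
      intro i _ hi
      have : e i < e τ.succ := hmono (by rw [Fin.lt_def]; simp; omega)
      omega)
    (by
      intro i hi hi'
      simp only [Finset.mem_erase, Finset.mem_univ, and_true] at hi
      have h1 : (i:ℕ) ≠ τ := fun h => hi.2 (Fin.ext (by simpa using h))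
      have h2 : (i:ℕ) ≠ τ + 1 := fun h => hi.1 (Fin.ext (by simpa using h))
      have : e τ.succ < e i := hmono (by rw [Fin.lt_def]; simp; omega)
      omega)
  have hcard : (((univ.erase τ.castSucc).erase τ.succ).filter (fun l : Fin (c+1) => (l:ℕ) < τ)).card = τ := by
    have : (((univ.erase τ.castSucc).erase τ.succ).filter (fun l : Fin (c+1) => (l:ℕ) < τ)) =
        Finset.Iio τ.castSucc := by
      ext l
      simp only [Finset.mem_filter, Finset.mem_erase, Finset.mem_univ, and_true, Finset.mem_Iio, Fin.lt_def,
        Fin.val_castSucc]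
      constructor
      · exact fun h => h.2
      · intro h
        refine ⟨⟨?_, ?_⟩, h⟩ <;> (intro h'; rw [h'] at h; simp at h)
    rw [this, Fin.card_Iio]; simp
  rw [hcard] at hs
  rw [Fin.val_succ, pow_succ] at hL
  have := mul_pos hDpos hs
  nlinarith

lemma lowD_mono {c : ℕ} {B : ℤ} {b : Fin (c+1) → ℤ} {γ : Fin (c+1) → ℤ →₀ ℚ} (H : Inv B b γ) :
    StrictMono (lowD B γ) := by
  rw [Fin.strictMono_iff_lt_succ]
  have : ∀ m : ℕ, ∀ τ : Fin c, c - τ ≤ m → lowD B γ τ.castSucc < lowD B γ τ.succ := by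
    intro m
    induction m with
    | zero => intro τ h; have := τ.2; omega
    | succ m ih =>
      intro τ h
      refine lowD_step H τ fun σ hσ => ih σ ?_
      have := Fin.lt_def.1 hσ
      have := σ.2
      omega
  exact fun i => this _ i le_rfl

end comb2
end BS

namespace BS

section comb3

lemma decomp {c : ℕ} (B : ℤ) : ∀ (N : ℕ) (b : Fin (c+1) → ℤ) (γ : Fin (c+1) → ℤ →₀ ℚ), Inv B b γ →
    (∑ i, ((γ i).support.filter (· < B)).card) ≤ N →
    ∃ (w : (Fin (c+1) → ℤ) →₀ ℚ) (t : ℚ),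
      (∀ d ∈ w.support, StrictMono d ∧ 0 < w d ∧ b ≤ d ∧ ∃ i, d i < B) ∧
      (∀ d₁ ∈ w.support, ∀ d₂ ∈ w.support, (∀ i, d₁ i ≤ d₂ i) ∨ (∀ i, d₂ i ≤ d₁ i)) ∧
      ∀ i j, γ i j = (w.sum fun d v => v * pT d i j) + t * pT (fun i : Fin (c+1) => B + (i:ℕ)) i j := by
  classical
  have hdinf : StrictMono (fun i : Fin (c+1) => B + ((i:ℕ):ℤ)) := by
    intro i j h
    have := Fin.lt_def.1 h
    show B + ((i:ℕ):ℤ) < B + ((j:ℕ):ℤ)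
    omega
  intro N
  induction N with
  | zero =>
    intro b γ H hN
    obtain ⟨t, ht⟩ := HK_unique hdinf γ H.hk (by
      intro i j hj
      by_cases hB : j < B
      · by_contra h0
        have h1 : ((γ i).support.filter (· < B)).card = 0 := by
          have := Finset.sum_eq_zero_iff.1 (Nat.le_zero.1 hN) i (by simp)
          exact this
        rw [Finset.card_eq_zero] at h1
        have : j ∈ ((γ i).support.filter (· < B)) := by simp [h0, hB]
        rw [h1] at this; simp at this
      · exact H.high i j (not_lt.1 hB) hj)
    exact ⟨0, t, by simp, by simp, fun i j => by rw [ht]; simp⟩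
  | succ N ih =>
    intro b γ H hN
    set d := lowD B γ with hd
    have hdm : StrictMono d := lowD_mono H
    by_cases hall : ∀ i, ¬ d i < B
    · refine ih b γ H ?_
      rw [Finset.sum_eq_zero]
      · omega
      · intro i _
        rw [Finset.card_eq_zero, Finset.filter_eq_empty_iff]
        intro j hj hjB
        rcases lowD_cases B γ i with ⟨h, _⟩ | ⟨_, h⟩
        · exact hall i h
        · exact (Finsupp.mem_support_iff.1 hj) (h j hjB)
    push Not at hall
    obtain ⟨i0, hi0⟩ := hall
    obtain ⟨m, hm, hmin⟩ := Finset.exists_min_image (univ.filter fun i => d i < B)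
      (fun i => γ i (d i) / piC d i) ⟨i0, by simpa using hi0⟩
    simp only [Finset.mem_filter, Finset.mem_univ, true_and] at hm hmin
    have hpos : ∀ i, d i < B → 0 < γ i (d i) := by
      intro i hi
      rcases lowD_cases B γ i with ⟨h, h', _⟩ | ⟨h, _⟩
      · exact lt_of_le_of_ne (H.nonneg _ _ h) (Ne.symm h')
      · rw [← hd] at h; omega
    set s := γ m (d m) / piC d m with hs
    have hspos : 0 < s := div_pos (hpos m hm) (piC_pos hdm m)
    have happ : ∀ i j, (γ i - s • pT d i) j = γ i j - if j = d i then s * piC d i else 0 := by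
      intro i j
      simp only [pT, Finsupp.coe_sub, Finsupp.coe_smul, Pi.sub_apply, Pi.smul_apply, smul_eq_mul,
        Finsupp.single_apply]
      by_cases h : j = d i
      · simp [h]
      · rw [if_neg h, if_neg (Ne.symm h)]; ring
    have H' : Inv B d (fun i => γ i - s • pT d i) := by
      refine ⟨hdm, ?_, ?_, ?_, ?_, ?_, ?_⟩
      · intro i
        rcases lowD_cases B γ i with ⟨h, _⟩ | ⟨h, _⟩ <;> rw [← hd] at h <;> omega
      · intro i j hj
        rw [happ, if_neg hj.ne, lowD_low H i j hj, sub_zero]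
      · intro i j hj
        rw [happ]
        split_ifs with h
        · subst h
          have h1 := hmin i hj
          rw [le_div_iff₀ (piC_pos hdm i)] at h1
          linarith
        · rw [sub_zero]; exact H.nonneg i j hj
      · intro i j hj hne
        have : j ≠ d i := by
          intro h
          rcases lowD_cases B γ i with ⟨h', _⟩ | ⟨h', _⟩ <;> rw [← hd] at h' <;> omega
        rw [happ, if_neg this, H.high i j hj hne, sub_zero]
      · intro f hf
        rw [Phi_sub_smul, H.hk f hf, HK_pT hdm f hf]; ring
      · intro e he hde τ hτ
        rw [Phi_sub_smul, L_pT hdm hde, mul_zero, sub_zero]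
        exact H.ineq e he (fun i => (le_lowD H i).trans (hde i)) τ hτ
    have hsub : ∀ i, ((γ i - s • pT d i).support.filter (· < B)) ⊆ ((γ i).support.filter (· < B)) := by
      intro i j
      simp only [Finset.mem_filter, Finsupp.mem_support_iff]
      rintro ⟨h1, h2⟩
      refine ⟨fun h0 => ?_, h2⟩
      rw [happ] at h1
      split_ifs at h1 with h
      · subst h
        exact (hpos i h2).ne' h0
      · exact h1 (by rw [h0, sub_zero])
    have hlt : (∑ i, (((fun i => γ i - s • pT d i) i).support.filter (· < B)).card) <
        (∑ i, ((γ i).support.filter (· < B)).card) := by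
      refine Finset.sum_lt_sum (fun i _ => Finset.card_le_card (hsub i)) ⟨m, by simp, ?_⟩
      refine Finset.card_lt_card (Finset.ssubset_iff_subset_ne.2 ⟨hsub m, fun h => ?_⟩)
      have h1 : d m ∈ ((γ m).support.filter (· < B)) := by
        simp only [Finset.mem_filter, Finsupp.mem_support_iff]
        exact ⟨(hpos m hm).ne', hm⟩
      rw [← h] at h1
      simp only [Finset.mem_filter, Finsupp.mem_support_iff] at h1
      apply h1.1
      rw [happ, if_pos rfl, hs, div_mul_cancel₀ _ (piC_pos hdm m).ne', sub_self]
    obtain ⟨w, t, hw, hch, heq⟩ := ih d _ H' (Nat.lt_succ_iff.1 (lt_of_lt_of_le hlt hN))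
    have hbd : b ≤ d := fun i => le_lowD H i
    have hsupp : ∀ x ∈ (w + Finsupp.single d s).support, x = d ∨ x ∈ w.support := by
      intro x hx
      rcases Finset.mem_union.1 (Finsupp.support_add hx) with h | h
      · exact Or.inr h
      · left; simpa using Finsupp.support_single_subset h
    have hwnn : ∀ x, 0 ≤ w x := fun x => by
      by_cases h : x ∈ w.support
      · exact (hw x h).2.1.le
      · rw [Finsupp.notMem_support_iff.1 h]
    refine ⟨w + Finsupp.single d s, t, ?_, ?_, ?_⟩
    · intro x hx
      rcases hsupp x hx with rfl | h
      · refine ⟨hdm, ?_, hbd, m, hm⟩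
        have := hwnn d
        simp only [Finsupp.coe_add, Pi.add_apply, Finsupp.single_eq_same]; linarith
      · obtain ⟨h1, h2, h3, h4⟩ := hw x h
        refine ⟨h1, ?_, hbd.trans h3, h4⟩
        simp only [Finsupp.coe_add, Pi.add_apply, Finsupp.single_apply]
        split_ifs <;> linarith
    · intro x hx y hy
      rcases hsupp x hx with rfl | h <;> rcases hsupp y hy with rfl | h'
      · exact Or.inl fun i => le_rfl
      · exact Or.inl fun i => (hw y h').2.2.1 i
      · exact Or.inr fun i => (hw x h).2.2.1 i
      · exact hch x h y h'
    · intro i j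
      have h1 := heq i j
      rw [Finsupp.sum_add_index' (by intros; ring) (by intros; ring), Finsupp.sum_single_index (by ring)]
      simp only [Finsupp.coe_sub, Finsupp.coe_smul, Pi.sub_apply, Pi.smul_apply, smul_eq_mul] at h1
      linarith

/-- every table satisfying the Herzog-Kuehl equations and the inequalities decomposes -/
theorem decomp_main {c : ℕ} (γ : Fin (c+1) → ℤ →₀ ℚ) (hnn : ∀ i j, 0 ≤ γ i j) (hk : HK γ)
    (ineq : ∀ e : Fin (c+1) → ℤ, StrictMono e → ∀ τ : Fin c,
      e τ.succ = e τ.castSucc + 1 → 0 ≤ Phi (Lw e τ) γ) :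
    ∃ (w : (Fin (c+1) → ℤ) →₀ ℚ),
      (∀ d ∈ w.support, StrictMono d ∧ 0 < w d) ∧
      (∀ d₁ ∈ w.support, ∀ d₂ ∈ w.support, (∀ i, d₁ i ≤ d₂ i) ∨ (∀ i, d₂ i ≤ d₁ i)) ∧
      ∀ i j, γ i j = (w.sum fun d v => v * pT d i j) := by
  classical
  set J : Finset ℤ := univ.biUnion fun i => (γ i).support with hJ
  have hJm : ∀ i j, γ i j ≠ 0 → j ∈ J := fun i j h => by
    rw [hJ, Finset.mem_biUnion]; exact ⟨i, by simp, by simpa using h⟩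
  obtain ⟨M, hM⟩ := J.bddAbove
  obtain ⟨m, hm⟩ := J.bddBelow
  set B := max M m + 1 with hB
  have hMB : M < B := by have := le_max_left M m; omega
  have hmB : m < B := by have := le_max_right M m; omega
  have H : Inv B (fun i : Fin (c+1) => m - c + (i:ℕ)) γ := by
    refine ⟨?_, ?_, ?_, fun i j _ => hnn i j, ?_, hk, fun e he _ τ h => ineq e he τ h⟩
    · intro i j h
      have := Fin.lt_def.1 h
      show m - c + ((i:ℕ):ℤ) < m - c + ((j:ℕ):ℤ)
      omega
    · intro i; show m - c + ((i:ℕ):ℤ) ≤ _; omega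
    · intro i j hj
      by_contra h0
      have h1 := hm (hJm i j h0)
      have h2 : j < m - c + ((i:ℕ):ℤ) := hj
      have := i.2
      omega
    · intro i j hj _
      by_contra h0
      have h1 := hM (hJm i j h0)
      omega
  obtain ⟨w, t, h1, h2, h3⟩ := decomp B _ _ γ H le_rfl
  have ht : t = 0 := by
    have h4 := h3 0 B
    have h5 : γ 0 B = 0 := by
      by_contra h0
      have h1 := hM (hJm 0 B h0)
      omega
    rw [h5, Finsupp.sum, Finset.sum_eq_zero] at h4
    · simp only [pT, Fin.val_zero, Nat.cast_zero, add_zero, Finsupp.single_eq_same, zero_add] at h4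
      have := piC_pos (c := c) (d := fun i : Fin (c+1) => B + ((i:ℕ):ℤ)) (by
        intro i j h
        have := Fin.lt_def.1 h
        show B + ((i:ℕ):ℤ) < B + ((j:ℕ):ℤ)
        omega) 0
      rcases mul_eq_zero.1 h4.symm with h | h
      · exact h
      · exact absurd h this.ne'
    · intro d hd
      obtain ⟨hdm, _, _, i, hi⟩ := h1 d hd
      have : d 0 < B := lt_of_le_of_lt (hdm.monotone (Fin.zero_le i)) hi
      simp only [pT]
      rw [Finsupp.single_eq_of_ne (by omega), mul_zero]
  refine ⟨w, fun d hd => ⟨(h1 d hd).1, (h1 d hd).2.1⟩, h2, fun i j => ?_⟩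
  rw [h3, ht, zero_mul, add_zero]

/-- chains of strictly increasing sequences with positive weights -/
structure Good {c : ℕ} (w : (Fin (c+1) → ℤ) →₀ ℚ) : Prop where
  mono : ∀ d ∈ w.support, StrictMono d
  pos : ∀ d ∈ w.support, 0 < w d
  chain : ∀ d₁ ∈ w.support, ∀ d₂ ∈ w.support, (∀ i, d₁ i ≤ d₂ i) ∨ (∀ i, d₂ i ≤ d₁ i)

/-- the table of a combination -/
def tab {c : ℕ} (w : (Fin (c+1) → ℤ) →₀ ℚ) (i : Fin (c+1)) (j : ℤ) : ℚ :=
  w.sum fun d v => v * pT d i j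

lemma tab_nonneg_term {c : ℕ} {w : (Fin (c+1) → ℤ) →₀ ℚ} (h : Good w) (i : Fin (c+1)) (j : ℤ)
    (d) (hd : d ∈ w.support) : 0 ≤ w d * pT d i j := by
  refine mul_nonneg (h.pos d hd).le ?_
  unfold pT
  rw [Finsupp.single_apply]
  split_ifs
  · exact (piC_pos (h.mono d hd) i).le
  · exact le_rfl

lemma tab_pos {c : ℕ} {w : (Fin (c+1) → ℤ) →₀ ℚ} (h : Good w) (i : Fin (c+1))
    (d) (hd : d ∈ w.support) : 0 < tab w i (d i) := by
  unfold tab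
  refine Finset.sum_pos' (fun x hx => tab_nonneg_term h i _ x hx) ⟨d, hd, ?_⟩
  refine mul_pos (h.pos d hd) ?_
  simp [pT, piC_pos (h.mono d hd) i]

lemma tab_zero {c : ℕ} {w : (Fin (c+1) → ℤ) →₀ ℚ} (i : Fin (c+1)) (j : ℤ)
    (h : ∀ x ∈ w.support, j < x i) : tab w i j = 0 := by
  unfold tab
  refine Finset.sum_eq_zero fun x hx => ?_
  beta_reduce
  rw [pT, Finsupp.single_eq_of_ne (h x hx).ne, mul_zero]

lemma good_min {c : ℕ} {w : (Fin (c+1) → ℤ) →₀ ℚ} (h : Good w) (hne : w.support.Nonempty) :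
    ∃ d ∈ w.support, ∀ x ∈ w.support, ∀ i, d i ≤ x i := by
  obtain ⟨d, hd⟩ := w.support.exists_minimal hne
  refine ⟨d, hd.1, fun x hx => ?_⟩
  rcases h.chain d hd.1 x hx with h1 | h1
  · exact h1
  · exact hd.2 hx h1

lemma min_mem {c : ℕ} {w w' : (Fin (c+1) → ℤ) →₀ ℚ} (h : Good w) (h' : Good w')
    (ht : tab w = tab w') (d) (hd : d ∈ w.support) (hmin : ∀ x ∈ w.support, ∀ i, d i ≤ x i) :
    d ∈ w'.support := by
  have hne : w'.support.Nonempty := by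
    by_contra hn
    rw [Finset.not_nonempty_iff_eq_empty, Finsupp.support_eq_empty] at hn
    have := tab_pos h 0 d hd
    rw [ht, hn] at this
    simp [tab] at this
  obtain ⟨d', hd', hmin'⟩ := good_min h' hne
  have : d = d' := by
    funext i
    rcases lt_trichotomy (d i) (d' i) with hlt | heq | hlt
    · have h1 := tab_pos h i d hd
      rw [ht, tab_zero i _ fun x hx => lt_of_lt_of_le hlt (hmin' x hx i)] at h1
      exact absurd h1 (lt_irrefl _)
    · exact heq
    · have h1 := tab_pos h' i d' hd'
      rw [← ht, tab_zero i _ fun x hx => lt_of_lt_of_le hlt (hmin x hx i)] at h1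
      exact absurd h1 (lt_irrefl _)
  rw [this]; exact hd'

lemma good_sub {c : ℕ} {w : (Fin (c+1) → ℤ) →₀ ℚ} (h : Good w) (d) (s : ℚ) (hd : d ∈ w.support)
    (hs : s ≤ w d) : Good (w - Finsupp.single d s) ∧
      (w - Finsupp.single d s).support ⊆ w.support := by
  have hsub : (w - Finsupp.single d s).support ⊆ w.support := by
    intro x hx
    by_cases hxd : x = d
    · rw [hxd]; exact hd
    · rw [Finsupp.mem_support_iff] at hx ⊢
      simpa [Finsupp.single_eq_of_ne hxd] using hx
  refine ⟨⟨fun x hx => h.mono x (hsub hx), fun x hx => ?_, fun x hx y hy => h.chain x (hsub hx) y (hsub hy)⟩, hsub⟩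
  have h1 := Finsupp.mem_support_iff.1 hx
  refine lt_of_le_of_ne ?_ (Ne.symm h1)
  by_cases hxd : x = d
  · subst hxd; simpa using hs
  · simpa [Finsupp.single_eq_of_ne hxd] using (h.pos x (hsub hx)).le

lemma tab_sub {c : ℕ} (w : (Fin (c+1) → ℤ) →₀ ℚ) (d) (s : ℚ) :
    tab (w - Finsupp.single d s) = fun i j => tab w i j - s * pT d i j := by
  funext i j
  unfold tab
  rw [Finsupp.sum_sub_index (by intros; ring), Finsupp.sum_single_index (by ring)]

theorem good_unique {c : ℕ} : ∀ (N : ℕ) (w w' : (Fin (c+1) → ℤ) →₀ ℚ), Good w → Good w' →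
    tab w = tab w' → w.support.card ≤ N → w = w' := by
  intro N
  induction N with
  | zero =>
    intro w w' h h' ht hN
    have hw : w = 0 := by
      rw [← Finsupp.support_eq_empty, ← Finset.card_eq_zero]; omega
    by_contra hne
    have hne' : w'.support.Nonempty := by
      rw [Finset.nonempty_iff_ne_empty, Ne, Finsupp.support_eq_empty]
      intro h0; exact hne (hw.trans h0.symm)
    obtain ⟨d, hd, hm⟩ := good_min h' hne'
    have := min_mem h' h ht.symm d hd hm
    rw [hw] at this; simp at this
  | succ N ih =>
    intro w w' h h' ht hN
    by_cases hne : w.support.Nonempty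
    swap
    · refine ih w w' h h' ht ?_
      rw [Finset.not_nonempty_iff_eq_empty.1 hne]; simp
    obtain ⟨d, hd, hm⟩ := good_min h hne
    have hd' := min_mem h h' ht d hd hm
    set s := min (w d) (w' d) with hs
    obtain ⟨g, hg⟩ := good_sub h d s hd (min_le_left _ _)
    obtain ⟨g', hg'⟩ := good_sub h' d s hd' (min_le_right _ _)
    have hm' : ∀ x ∈ w'.support, ∀ i, d i ≤ x i := by
      have hne' : w'.support.Nonempty := ⟨d, hd'⟩
      obtain ⟨d2, hd2, hm2⟩ := good_min h' hne'
      have h3 := min_mem h' h ht.symm d2 hd2 hm2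
      intro x hx i
      exact (hm d2 h3 i).trans (hm2 x hx i)
    have ht' : tab (w - Finsupp.single d s) = tab (w' - Finsupp.single d s) := by
      rw [tab_sub, tab_sub, ht]
    have e1 : (w - Finsupp.single d s) d = w d - s := by simp
    have e2 : (w' - Finsupp.single d s) d = w' d - s := by simp
    have key : d ∉ (w - Finsupp.single d s).support ∧ d ∉ (w' - Finsupp.single d s).support := by
      have a1 : d ∈ (w - Finsupp.single d s).support → d ∈ (w' - Finsupp.single d s).support :=
        fun hh => min_mem g g' ht' d hh fun x hx => hm x (hg hx)
      have a2 : d ∈ (w' - Finsupp.single d s).support → d ∈ (w - Finsupp.single d s).support :=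
        fun hh => min_mem g' g ht'.symm d hh fun x hx => hm' x (hg' hx)
      rw [Finsupp.mem_support_iff, Finsupp.mem_support_iff, e1, e2] at *
      rcases min_choice (w d) (w' d) with h1 | h1
      · have : w d - s = 0 := by rw [hs, h1]; ring
        exact ⟨not_not.2 this, fun hh => a2 hh this⟩
      · have : w' d - s = 0 := by rw [hs, h1]; ring
        exact ⟨fun hh => a1 hh this, not_not.2 this⟩
    have := ih _ _ g g' ht' (by
      have : (w - Finsupp.single d s).support.card < w.support.card :=
        Finset.card_lt_card ⟨hg, fun hh => key.1 (hh hd)⟩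
      omega)
    exact sub_left_injective this

end comb3
end BS

namespace BS

section numer
open Polynomial in
/-- the dual polynomial -/
def hT (g : ℚ[X]) (t : ℕ) : ℚ[X] := (hasseDeriv t g).comp (-Polynomial.X)

open Polynomial in
lemma hT_natDegree (g : ℚ[X]) (t : ℕ) : (hT g t).natDegree = g.natDegree - t := by
  unfold hT
  rw [natDegree_comp, natDegree_neg, natDegree_X, mul_one]
  exact natDegree_hasseDeriv g t

open Polynomial in
lemma hT_ne (g : ℚ[X]) (hg : g ≠ 0) (t : ℕ) (ht : t ≤ g.natDegree) : hT g t ≠ 0 := by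
  intro h
  unfold hT at h
  have h1 : (hasseDeriv t g).comp (-Polynomial.X) = 0 := h
  have h2 : hasseDeriv t g = 0 := by
    have := congrArg (fun q => q.comp (-Polynomial.X)) h1
    simpa [comp_assoc] using this
  have h3 : (hasseDeriv t g).coeff (g.natDegree - t) = 0 := by rw [h2]; simp
  rw [hasseDeriv_coeff, Nat.sub_add_cancel ht] at h3
  rcases mul_eq_zero.1 h3 with h | h
  · exact (Nat.choose_pos ht).ne' (by exact_mod_cast h)
  · exact hg (leadingCoeff_eq_zero.1 h)

open Polynomial in
lemma kill_of_dual (Λ : ℚ[X] →ₗ[ℚ] ℚ) (c : ℕ) (h : ℕ → ℚ[X]) (hdeg : ∀ k < c, (h k).natDegree = k)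
    (hne : ∀ k < c, h k ≠ 0) (h0 : ∀ k < c, Λ (h k) = 0) : ∀ k ≤ c, ∀ f : ℚ[X], f.degree < k → Λ f = 0 := by
  intro k
  induction k with
  | zero => intro _ f hf; have : f = 0 := by simpa using hf
            rw [this, map_zero]
  | succ k ih =>
    intro hk f hf
    set a := f.coeff k / (h k).coeff k with ha
    have hl : (h k).coeff k ≠ 0 := by
      have := leadingCoeff_ne_zero.2 (hne k hk)
      rwa [leadingCoeff, hdeg k hk] at this
    have h1 : (f - a • h k).degree < k := by
      rw [degree_lt_iff_coeff_zero]
      intro m hm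
      rcases hm.lt_or_eq with hm | hm
      · have e1 : f.coeff m = 0 := coeff_eq_zero_of_degree_lt (lt_of_lt_of_le hf (by exact_mod_cast hm))
        have e2 : (h k).coeff m = 0 := coeff_eq_zero_of_natDegree_lt (by rw [hdeg k hk]; exact hm)
        simp [e1, e2]
      · subst hm
        simp [ha]; field_simp; ring
    have h2 := ih (by omega) _ h1
    rw [map_sub, map_smul, h0 k hk, smul_zero, sub_zero] at h2
    exact h2

open Polynomial in
theorem num_forward (Λ : ℚ[X] →ₗ[ℚ] ℚ) (n c : ℕ) (hc : c ≤ n) (g P : ℚ[X]) (hg : g ≠ 0) (hn : g.natDegree + 1 = n)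
    (hP : ∀ t, P.coeff t = Λ (hT g t)) (hdim : polyDim P = n - c) (f : ℚ[X]) (hf : f.degree < c) : Λ f = 0 := by
  refine kill_of_dual Λ c (fun k => hT g (n - 1 - k)) ?_ ?_ ?_ c le_rfl f hf
  · intro k hk
    rw [hT_natDegree]; omega
  · intro k hk
    exact hT_ne g hg _ (by omega)
  · intro k hk
    rw [← hP]
    unfold polyDim at hdim
    split_ifs at hdim with h
    · rw [h]; simp
    · exact coeff_eq_zero_of_natDegree_lt (by omega)

open Polynomial in
theorem num_backward (Λ : ℚ[X] →ₗ[ℚ] ℚ) (n c : ℕ) (hc : c ≤ n) (g P : ℚ[X]) (hg : g ≠ 0) (hn : g.natDegree + 1 = n)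
    (hP : ∀ t, P.coeff t = Λ (hT g t)) (hk : ∀ f : ℚ[X], f.degree < c → Λ f = 0)
    (hne : ∀ f : ℚ[X], f ≠ 0 → f.natDegree = c → Λ f ≠ 0) : polyDim P = n - c := by
  have h1 : ∀ t, n - c ≤ t → P.coeff t = 0 := by
    intro t ht
    rw [hP]
    by_cases htn : t < n
    · refine hk _ ?_
      rw [degree_eq_natDegree (hT_ne g hg t (by omega)), hT_natDegree]
      exact_mod_cast (by omega : g.natDegree - t < c)
    · have : hT g t = 0 := by
        unfold hT
        rw [hasseDeriv_eq_zero_of_lt_natDegree _ _ (by omega)]; simp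
      rw [this, map_zero]
  unfold polyDim
  rcases hc.lt_or_eq with hlt | heq
  · have h2 : P.coeff (n - c - 1) ≠ 0 := by
      rw [hP]
      exact hne _ (hT_ne g hg _ (by omega)) (by rw [hT_natDegree]; omega)
    have h3 : P ≠ 0 := fun h => h2 (by rw [h]; simp)
    rw [if_neg h3]
    have h4 : P.natDegree ≤ n - c - 1 := natDegree_le_iff_coeff_eq_zero.2 fun N hN => h1 N (by omega)
    have h5 := le_natDegree_of_ne_zero h2
    omega
  · have : P = 0 := by
      ext t; rw [h1 t (by omega)]; simp
    rw [if_pos this]; omega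

lemma genHilb_comp (m : ℕ) (a : ℤ) :
    genHilb (m+1) a = (genHilb (m+1) 0).comp (Polynomial.X + Polynomial.C (-(a:ℚ))) := by
  unfold genHilb
  simp only [Nat.succ_ne_zero, if_false, Polynomial.mul_comp, Polynomial.C_comp, Polynomial.prod_comp]
  congr 1
  refine Finset.prod_congr rfl fun k _ => ?_
  simp
  ring

lemma genHilb_zero (m : ℕ) : genHilb (m+1) 0 ≠ 0 ∧ (genHilb (m+1) 0).natDegree + 1 = m + 1 := by
  have e : genHilb (m+1) 0 = Polynomial.C ((m.factorial : ℚ))⁻¹ *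
      ∏ k ∈ Finset.range m, (Polynomial.X + Polynomial.C ((k : ℚ) + 1)) := by
    unfold genHilb; simp
  have hm : (∏ k ∈ Finset.range m, (Polynomial.X + Polynomial.C ((k : ℚ) + 1))).Monic :=
    Polynomial.monic_prod_of_monic _ _ fun k _ => Polynomial.monic_X_add_C _
  have h0 : ((m.factorial : ℚ))⁻¹ ≠ 0 := by positivity
  rw [e]
  refine ⟨mul_ne_zero (by simpa using m.factorial_ne_zero) hm.ne_zero, ?_⟩
  rw [Polynomial.natDegree_C_mul h0, Polynomial.natDegree_prod_of_monic _ _ fun k _ => Polynomial.monic_X_add_C _]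
  simp only [Polynomial.natDegree_X_add_C]
  simp

/-- the moment functional of a complex -/
def mom {K : Type} [Field K] {n : ℕ} (F : FreeComplex K n) : Polynomial ℚ →ₗ[ℚ] ℚ :=
  ∑ i ∈ Finset.range (F.len + 1), (-1:ℚ)^i • ∑ p : Fin (F.rk i), Polynomial.leval (F.deg i p : ℚ)

lemma mom_apply {K : Type} [Field K] {n : ℕ} (F : FreeComplex K n) (f : Polynomial ℚ) :
    mom F f = ∑ i ∈ Finset.range (F.len + 1), (-1:ℚ)^i * ∑ p : Fin (F.rk i), f.eval (F.deg i p : ℚ) := by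
  simp [mom, Polynomial.leval_apply]

lemma hilb_coeff {K : Type} [Field K] {m : ℕ} (F : FreeComplex K (m+1)) (t : ℕ) :
    (hilbPoly F).coeff t = mom F (hT (genHilb (m+1) 0) t) := by
  rw [mom_apply, hilbPoly, Polynomial.finset_sum_coeff]
  refine Finset.sum_congr rfl fun i _ => ?_
  rw [Polynomial.coeff_C_mul, Polynomial.finset_sum_coeff]
  congr 1
  refine Finset.sum_congr rfl fun p _ => ?_
  rw [genHilb_comp, ← Polynomial.taylor_apply, Polynomial.taylor_coeff, hT]
  simp

theorem HK_of_CM {K : Type} [Field K] {n c : ℕ} (hc : c ≤ n) (F : FreeComplex K n)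
    (hd : polyDim (hilbPoly F) = n - c) (f : Polynomial ℚ) (hf : f.degree < c) : mom F f = 0 := by
  rcases n with _ | m
  · have : c = 0 := by omega
    subst this
    have : f = 0 := by simpa using hf
    rw [this, map_zero]
  · exact num_forward (mom F) (m+1) c hc _ _ (genHilb_zero m).1 (genHilb_zero m).2 (hilb_coeff F) hd f hf

theorem dim_of_HK {K : Type} [Field K] {n c : ℕ} (hc : c ≤ n) (F : FreeComplex K n)
    (hk : ∀ f : Polynomial ℚ, f.degree < c → mom F f = 0)
    (hne : ∀ f : Polynomial ℚ, f ≠ 0 → f.natDegree = c → mom F f ≠ 0) : polyDim (hilbPoly F) = n - c := by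
  rcases n with _ | m
  · have : hilbPoly F = 0 := by
      simp [hilbPoly, genHilb]
    rw [this]; simp [polyDim]
  · exact num_backward (mom F) (m+1) c hc _ _ (genHilb_zero m).1 (genHilb_zero m).2 (hilb_coeff F) hk hne

end numer
end BS

namespace BS

section exist

/-- graded pieces as additive subgroups -/
def hZ (K : Type) [Field K] (n : ℕ) (z : ℤ) : AddSubgroup (MvPolynomial (Fin n) K) :=
  (homogZ K n z).toAddSubgroup

lemma mem_homogZ_nonneg {K : Type} [Field K] {n : ℕ} {z : ℤ} (hz : 0 ≤ z) (x : PolyS K n) :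
    x ∈ homogZ K n z ↔ x.IsHomogeneous z.toNat := by
  unfold homogZ
  rw [iSup_pos hz, mem_homogeneousSubmodule]

lemma mem_homogZ_neg {K : Type} [Field K] {n : ℕ} {z : ℤ} (hz : ¬ 0 ≤ z) (x : PolyS K n) :
    x ∈ homogZ K n z ↔ x = 0 := by
  unfold homogZ
  rw [iSup_neg hz, Submodule.mem_bot]

lemma mem_hZ {K : Type} [Field K] {n : ℕ} {z : ℤ} (x : PolyS K n) :
    x ∈ hZ K n z ↔ x ∈ homogZ K n z := Iff.rfl

lemma mulP_hZ (K : Type) [Field K] (n : ℕ) : MulP (hZ K n) := by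
  intro k l x y hx hy
  rw [mem_hZ] at *
  by_cases hk : 0 ≤ k
  · by_cases hl : 0 ≤ l
    · rw [mem_homogZ_nonneg hk] at hx
      rw [mem_homogZ_nonneg hl] at hy
      rw [mem_homogZ_nonneg (by omega), Int.toNat_add hk hl]
      exact hx.mul hy
    · rw [mem_homogZ_neg hl] at hy
      rw [hy, mul_zero]; exact zero_mem _
  · rw [mem_homogZ_neg hk] at hx
    rw [hx, zero_mul]; exact zero_mem _

/-- index type at position `i` -/
abbrev PosI {I : Type} (pos : I → ℤ) (i : ℕ) : Type := {x : I // pos x = (i:ℤ)}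

variable {K : Type} [Field K] {n : ℕ} {I : Type} [Fintype I] [DecidableEq I]

open Classical in
/-- enumeration of the index set at position `i` -/
def enumP (pos : I → ℤ) (i : ℕ) : Fin (Fintype.card (PosI pos i)) ≃ PosI pos i :=
  (Fintype.equivFin (PosI pos i)).symm

lemma sum_pos_eq {R : Type} [CommRing R] (pos : I → ℤ) (i : ℕ) (f : I → R) (h : ∀ x, f x ≠ 0 → pos x = i) :
    ∑ x, f x = ∑ p, f (enumP pos i p).1 := by
  classical
  rw [Equiv.sum_comp (enumP pos i) (fun x => f x.1)]
  rw [← Finset.sum_filter_of_ne (p := fun x => pos x = (i:ℤ)) (fun x _ hx => h x hx)]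
  exact Finset.sum_subtype _ (by simp) f

/-- the complex attached to a differential module with positions -/
def mkF (D : Matrix I I (PolyS K n)) (deg pos ord : I → ℤ) (H : IsDM (hZ K n) D deg pos ord) (a : ℤ) (c : ℕ)
    (hc : ∀ x, pos x ≤ c) : FreeComplex K n where
  len := c
  rk i := Fintype.card (PosI pos i)
  deg i p := deg (enumP pos i p).1 + a
  dd i := Matrix.of fun p q => D (enumP pos i p).1 (enumP pos (i+1) q).1
  rk_eq_zero i hi := by
    rw [Fintype.card_eq_zero_iff]
    refine ⟨fun x => ?_⟩
    have := hc x.1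
    have := x.2
    omega
  isHomog i p q := by
    have := H.mem (enumP pos i p).1 (enumP pos (i+1) q).1
    rw [mem_hZ] at this
    rw [Matrix.of_apply, add_sub_add_right_eq_sub]
    exact this
  isComplex i := by
    ext1 p r
    have h1 := congrFun (congrFun H.sq (enumP pos i p).1) (enumP pos (i+1+1) r).1
    rw [Matrix.mul_apply] at h1
    rw [Matrix.mul_apply]
    simp only [Matrix.of_apply]
    rw [sum_pos_eq pos (i+1)] at h1
    · exact h1
    · intro x hx
      have := H.hpos _ _ (left_ne_zero_of_mul hx)
      have := (enumP pos i p).2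
      push_cast; omega


lemma mkF_res (D : Matrix I I (PolyS K n)) (deg pos ord : I → ℤ) (H : IsDM (hZ K n) D deg pos ord) (a : ℤ) (c : ℕ)
    (hc : ∀ x, pos x ≤ c) (hex : ∀ w, Sup pos 0 w → D.mulVec w = 0 → ∃ y, D.mulVec y = w) :
    IsResolution (mkF D deg pos ord H a c hc) := by
  classical
  intro i
  set F := mkF D deg pos ord H a c hc with hF
  have hdd : ∀ i p q, F.dd i p q = D (enumP pos i p).1 (enumP pos (i+1) q).1 := fun i p q => rfl
  refine le_antisymm ?_ ?_
  · intro v hv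
    rw [LinearMap.mem_ker, Matrix.mulVecLin_apply] at hv
    set w : I → PolyS K n := fun x => if h : pos x = ((i+1:ℕ):ℤ) then v ((enumP pos (i+1)).symm ⟨x, h⟩) else 0 with hw
    have hwe : ∀ q, w (enumP pos (i+1) q).1 = v q := by
      intro q
      simp only [hw]
      rw [dif_pos (enumP pos (i+1) q).2]
      congr 1
      exact (enumP pos (i+1)).symm_apply_apply q
    have hw0 : ∀ x, pos x ≠ ((i+1:ℕ):ℤ) → w x = 0 := fun x hx => by simp only [hw]; rw [dif_neg hx]
    have hDw : D.mulVec w = 0 := by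
      funext x
      by_cases hx : pos x = (i:ℤ)
      · have h1 := congrFun hv ((enumP pos i).symm ⟨x, hx⟩)
        simp only [Matrix.mulVec, dotProduct, Pi.zero_apply] at h1 ⊢
        rw [sum_pos_eq pos (i+1)]
        · refine Eq.trans ?_ h1
          refine Finset.sum_congr rfl fun q _ => ?_
          refine congrArg₂ (· * ·) ?_ (hwe q)
          refine Eq.trans ?_ (hdd i _ q).symm
          rw [Equiv.apply_symm_apply]
        · intro y hy
          by_contra hne
          exact hy (by rw [hw0 y hne, mul_zero])
      · simp only [Matrix.mulVec, dotProduct, Pi.zero_apply]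
        refine Finset.sum_eq_zero fun y _ => ?_
        by_cases hy : pos y = ((i+1:ℕ):ℤ)
        · have : D x y = 0 := by
            by_contra hne
            have := H.hpos _ _ hne
            push_cast at hy; omega
          rw [this, zero_mul]
        · rw [hw0 y hy, mul_zero]
    obtain ⟨y, hy⟩ := hex w (fun x hx => hw0 x (by push_cast; omega)) hDw
    refine ⟨fun q => y (enumP pos (i+1+1) q).1, ?_⟩
    rw [Matrix.mulVecLin_apply]
    funext p
    have h1 := congrFun hy (enumP pos (i+1) p).1
    refine Eq.trans ?_ (h1.trans (hwe p))
    simp only [Matrix.mulVec, dotProduct]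
    rw [sum_pos_eq pos (i+1+1)]
    · rfl
    · intro z hz
      have := H.hpos _ _ (left_ne_zero_of_mul hz)
      have := (enumP pos (i+1) p).2
      push_cast at *; omega
  · rintro _ ⟨v, rfl⟩
    rw [LinearMap.mem_ker, Matrix.mulVecLin_apply, Matrix.mulVecLin_apply, Matrix.mulVec_mulVec, F.isComplex,
      Matrix.zero_mulVec]

lemma card_enumP (pos : I → ℤ) (i : ℕ) (Q : I → Prop) [DecidablePred Q] :
    (univ.filter fun p => Q (enumP pos i p).1).card = (univ.filter fun x => pos x = (i:ℤ) ∧ Q x).card := by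
  classical
  refine Finset.card_bij (fun p _ => (enumP pos i p).1) ?_ ?_ ?_
  · intro p hp
    simp only [Finset.mem_filter, Finset.mem_univ, true_and] at hp ⊢
    exact ⟨(enumP pos i p).2, hp⟩
  · intro p _ q _ h
    exact (enumP pos i).injective (Subtype.ext h)
  · intro x hx
    simp only [Finset.mem_filter, Finset.mem_univ, true_and] at hx
    refine ⟨(enumP pos i).symm ⟨x, hx.1⟩, ?_, by simp⟩
    simp [hx.2]

end exist
end BS

namespace BS

section roots

lemma prod_fact (W q : ℕ) (h : q ≤ W) :
    ∏ m ∈ (Finset.Icc (0:ℤ) W).erase q, (m - q).natAbs = q.factorial * (W - q).factorial := by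
  have e : (Finset.Icc (0:ℤ) W).erase q = ((Finset.range (W+1)).erase q).image (fun m : ℕ => (m:ℤ)) := by
    ext m
    simp only [Finset.mem_erase, Finset.mem_Icc, Finset.mem_image, Finset.mem_range]
    constructor
    · rintro ⟨h1, h2, h3⟩
      exact ⟨m.toNat, ⟨by omega, by omega⟩, by omega⟩
    · rintro ⟨k, ⟨h1, h2⟩, rfl⟩
      exact ⟨by omega, by omega, by omega⟩
  rw [e, Finset.prod_image (by intro a _ b _ hab; simpa using hab)]
  have e2 : (Finset.range (W+1)).erase q = Finset.range q ∪ Finset.Ico (q+1) (W+1) := by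
    ext m
    simp only [Finset.mem_erase, Finset.mem_range, Finset.mem_union, Finset.mem_Ico]
    omega
  rw [e2, Finset.prod_union (by
    rw [Finset.disjoint_left]; intro m; simp only [Finset.mem_range, Finset.mem_Ico]; omega)]
  congr 1
  · rw [← Finset.prod_range_add_one_eq_factorial, ← Finset.prod_range_reflect]
    refine Finset.prod_congr rfl fun m hm => ?_
    have := Finset.mem_range.1 hm
    omega
  · rw [Finset.prod_Ico_eq_prod_range, ← Finset.prod_range_add_one_eq_factorial]
    have : W + 1 - (q + 1) = W - q := by omega
    rw [this]
    refine Finset.prod_congr rfl fun m hm => ?_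
    omega

variable {c : ℕ} (d : Fin (c+1) → ℤ)

/-- the missing degrees -/
def Rts : Finset ℤ := Finset.Icc 0 (d (Fin.last c) - d 0) \ univ.image fun i => d i - d 0

lemma d_mem (hd : StrictMono d) (i : Fin (c+1)) : d i - d 0 ∈ Finset.Icc 0 (d (Fin.last c) - d 0) := by
  have h1 := hd.monotone (Fin.zero_le i)
  have h2 := hd.monotone (Fin.le_last i)
  rw [Finset.mem_Icc]; omega

lemma d_inj (hd : StrictMono d) : Function.Injective fun i => d i - d 0 := by
  intro i j h
  exact hd.injective (by simpa using h)

lemma card_Rts (hd : StrictMono d) : (Rts d).card + c = (d (Fin.last c) - d 0).toNat := by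
  unfold Rts
  have h1 : (univ.image fun i => d i - d 0) ⊆ Finset.Icc 0 (d (Fin.last c) - d 0) := by
    intro x hx
    obtain ⟨i, _, rfl⟩ := Finset.mem_image.1 hx
    exact d_mem d hd i
  have h2 := Finset.card_le_card h1
  rw [Finset.card_sdiff_of_subset h1]
  rw [Finset.card_image_of_injective _ (d_inj d hd)] at *
  have h3 := hd.monotone (Fin.zero_le (Fin.last c))
  simp only [Int.card_Icc, card_univ, Fintype.card_fin] at *
  omega

lemma notMem_Rts {q : ℤ} (h0 : 0 ≤ q) (h1 : q ≤ d (Fin.last c) - d 0) (h : q ∉ Rts d) : ∃ i, q = d i - d 0 := by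
  unfold Rts at h
  simp only [Finset.mem_sdiff, Finset.mem_Icc, Finset.mem_image, Finset.mem_univ, true_and, not_and, not_not] at h
  obtain ⟨i, hi⟩ := h ⟨h0, h1⟩
  exact ⟨i, hi.symm⟩

lemma card_lt_Rts (hd : StrictMono d) (i : Fin (c+1)) :
    (((Rts d).filter (· < d i - d 0)).card : ℤ) = d i - d 0 - (i:ℕ) := by
  have e : (Rts d).filter (· < d i - d 0) =
      Finset.Ico 0 (d i - d 0) \ (Finset.Iio i).image fun i => d i - d 0 := by
    ext x
    have hl := hd.monotone (Fin.le_last i)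
    unfold Rts
    simp only [Finset.mem_filter, Finset.mem_sdiff, Finset.mem_Icc, Finset.mem_Ico, Finset.mem_image,
      Finset.mem_univ, true_and, Finset.mem_Iio]
    constructor
    · rintro ⟨⟨⟨h1, h2⟩, h3⟩, h4⟩
      exact ⟨⟨h1, h4⟩, fun ⟨j, _, hj⟩ => h3 ⟨j, hj⟩⟩
    · rintro ⟨⟨h1, h2⟩, h3⟩
      refine ⟨⟨⟨h1, by omega⟩, fun ⟨j, hj⟩ => h3 ⟨j, hd.lt_iff_lt.1 (by omega), hj⟩⟩, h2⟩
  have h1 : ((Finset.Iio i).image fun i => d i - d 0) ⊆ Finset.Ico 0 (d i - d 0) := by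
    intro x hx
    obtain ⟨j, hj, rfl⟩ := Finset.mem_image.1 hx
    have h1 := hd.monotone (Fin.zero_le j)
    have h2 := hd (Finset.mem_Iio.1 hj)
    rw [Finset.mem_Ico]; omega
  have h2 := Finset.card_le_card h1
  rw [e, Finset.card_sdiff_of_subset h1]
  rw [Finset.card_image_of_injective _ (d_inj d hd), Fin.card_Iio] at *
  have h3 := hd.monotone (Fin.zero_le i)
  rw [Int.card_Ico] at *
  omega

lemma prod_Rts (hd : StrictMono d) (i : Fin (c+1)) :
    (((d (Fin.last c) - d 0).toNat.choose (d i - d 0).toNat * ∏ r ∈ Rts d, (r - (d i - d 0)).natAbs : ℕ) : ℚ) =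
      (d (Fin.last c) - d 0).toNat.factorial * piC d i := by
  have hm := Finset.mem_Icc.1 (d_mem d hd i)
  obtain ⟨W, hW⟩ : ∃ W : ℕ, d (Fin.last c) - d 0 = W := ⟨(d (Fin.last c) - d 0).toNat, by omega⟩
  obtain ⟨q, hq⟩ : ∃ q : ℕ, d i - d 0 = q := ⟨(d i - d 0).toNat, by omega⟩
  have hqW : q ≤ W := by omega
  have e : (Finset.Icc (0:ℤ) W).erase q = Rts d ∪ (univ.erase i).image fun i => d i - d 0 := by
    ext x
    unfold Rts
    rw [hW]
    simp only [Finset.mem_erase, Finset.mem_union, Finset.mem_sdiff, Finset.mem_image, Finset.mem_univ,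
      true_and, and_true]
    constructor
    · rintro ⟨h1, h2⟩
      by_cases hx : ∃ a, d a - d 0 = x
      · obtain ⟨a, ha⟩ := hx
        exact Or.inr ⟨a, fun h => h1 (by rw [← ha, h, hq]), ha⟩
      · exact Or.inl ⟨h2, hx⟩
    · rintro (⟨h1, h2⟩ | ⟨a, ha, rfl⟩)
      · exact ⟨fun h => h2 ⟨i, by rw [hq, h]⟩, h1⟩
      · refine ⟨fun h => ha (hd.injective (by omega)), ?_⟩
        rw [← hW]; exact d_mem d hd a
  have hdis : Disjoint (Rts d) ((univ.erase i).image fun i => d i - d 0) := by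
    rw [Finset.disjoint_left]
    intro x hx hx'
    unfold Rts at hx
    obtain ⟨a, _, rfl⟩ := Finset.mem_image.1 hx'
    exact (Finset.mem_sdiff.1 hx).2 (Finset.mem_image.2 ⟨a, by simp, rfl⟩)
  have h1 := prod_fact W q hqW
  rw [e, Finset.prod_union hdis, Finset.prod_image (fun a _ b _ h => d_inj d hd h)] at h1
  have h2 : ∀ l, (d l - d 0 - (q:ℤ)).natAbs = (d l - d i).natAbs := by
    intro l; congr 1; omega
  simp only [h2] at h1
  have h3 := Nat.choose_mul_factorial_mul_factorial hqW
  rw [hW, hq]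
  simp only [Int.toNat_natCast]
  unfold piC
  rw [Finset.prod_inv_distrib]
  have h4 : (∏ l ∈ univ.erase i, ((d l - d i).natAbs : ℚ)) ≠ 0 := by
    refine Finset.prod_ne_zero_iff.2 fun l hl => ?_
    have : d l ≠ d i := fun h => (Finset.ne_of_mem_erase hl) (hd.injective h)
    exact_mod_cast Int.natAbs_ne_zero.2 (sub_ne_zero.2 this)
  rw [← div_eq_mul_inv, eq_div_iff h4]
  have h5 : W.choose q * ((∏ r ∈ Rts d, (r - (q:ℤ)).natAbs) * ∏ l ∈ univ.erase i, (d l - d i).natAbs) = W.factorial := by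
    rw [h1, ← h3]; ring
  rw [← h5]
  push_cast
  ring

end roots
end BS

namespace BS

section ex2

lemma pureTable_fin {c : ℕ} (d : Fin (c+1) → ℤ) (i : Fin (c+1)) (j : ℤ) :
    pureTable d (i:ℕ) j = pT d i j := by
  unfold pureTable pT piC
  rw [dif_pos i.2, Finsupp.single_apply]
  by_cases h : j = d i
  · rw [if_pos h, if_pos h.symm]
  · rw [if_neg h, if_neg (Ne.symm h)]

lemma pureTable_big {c : ℕ} (d : Fin (c+1) → ℤ) (i : ℕ) (hi : ¬ i < c + 1) (j : ℤ) :
    pureTable d i j = 0 := by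
  unfold pureTable
  rw [dif_neg hi]

/-- a pure, position-split, differential module gives a pure CM module -/
theorem pure_of_DM {K : Type} [Field K] {n c : ℕ} (hc : c ≤ n) (d : Fin (c+1) → ℤ) (hd : StrictMono d)
    {I : Type} [Fintype I] [DecidableEq I] (D : Matrix I I (PolyS K n)) (deg pos ord : I → ℤ)
    (H : IsDM (hZ K n) D deg pos ord) (lam : ℚ) (hlam : 0 < lam)
    (hx : ∀ x, ∃ i : Fin (c+1), deg x = d i - d 0 ∧ pos x = (i:ℕ))
    (hcard : ∀ i : Fin (c+1), ((univ.filter fun x => deg x = d i - d 0).card : ℚ) = lam * piC d i)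
    (hann : ∀ k : Fin c, (X (Fin.castLE hc k) : PolyS K n) ∈ (AnnH D).radical) :
    ∃ (G : FreeComplex K n), IsCMcodim G c ∧ ∀ (i : ℕ) (j : ℤ), (bettiNum G i j : ℚ) = lam * pureTable d i j := by
  classical
  have hc' : ∀ x, pos x ≤ c := by
    intro x
    obtain ⟨i, _, h⟩ := hx x
    have := i.2
    omega
  have hiff : ∀ x, ∀ i : Fin (c+1), pos x = (i:ℕ) ↔ deg x = d i - d 0 := by
    intro x i
    obtain ⟨i', h1, h2⟩ := hx x
    constructor
    · intro h
      have : i' = i := Fin.ext (by omega)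
      rw [← this, h1]
    · intro h
      have : i' = i := d_inj d hd (by show d i' - d 0 = d i - d 0; omega)
      rw [← this, h2]
  set G := mkF D deg pos ord H (d 0) c hc' with hG
  have hdeg : ∀ (i : ℕ) (h : i < c + 1) (p : Fin (G.rk i)), G.deg i p = d ⟨i, h⟩ := by
    intro i h p
    have h1 : G.deg i p = deg (enumP pos i p).1 + d 0 := rfl
    rw [h1, (hiff _ ⟨i, h⟩).1 (enumP pos i p).2]; ring
  have hb : ∀ i j, bettiNum G i j = (univ.filter fun x => pos x = (i:ℤ) ∧ deg x + d 0 = j).card := by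
    intro i j
    rw [← card_enumP]; rfl
  have hbetti : ∀ (i : ℕ) (j : ℤ), (bettiNum G i j : ℚ) = lam * pureTable d i j := by
    intro i j
    rw [hb]
    by_cases hi : i < c + 1
    · have e := pureTable_fin d ⟨i, hi⟩ j
      simp only at e
      rw [e, pT, Finsupp.single_apply]
      split_ifs with h
      · rw [← hcard]
        congr 2
        ext x
        simp only [Finset.mem_filter, Finset.mem_univ, true_and]
        rw [← hiff x ⟨i, hi⟩]
        constructor
        · exact fun h => h.1
        · intro h'
          refine ⟨h', ?_⟩
          rw [(hiff x ⟨i, hi⟩).1 h', ← h]; ring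
      · rw [mul_zero, Nat.cast_eq_zero, Finset.card_eq_zero, Finset.filter_eq_empty_iff]
        rintro x _ ⟨h1, h2⟩
        rw [(hiff x ⟨i, hi⟩).1 h1] at h2
        exact h (by omega)
    · rw [pureTable_big d i hi, mul_zero, Nat.cast_eq_zero, Finset.card_eq_zero, Finset.filter_eq_empty_iff]
      rintro x _ ⟨h1, h2⟩
      have := hc' x
      omega
  have hrk : ∀ i : Fin (c+1), (G.rk i : ℚ) = lam * piC d i := by
    intro i
    have h1 := hbetti i (d i)
    rw [pureTable_fin, pT, Finsupp.single_eq_same] at h1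
    rw [← h1, bettiNum, Finset.filter_true_of_mem (fun p _ => hdeg i i.2 p)]
    simp
  have hmom : ∀ f : Polynomial ℚ, mom G f = lam * Phi (fun _ j => f.eval (j:ℚ)) (pT d) := by
    intro f
    rw [mom_apply, Phi_pT, Finset.mul_sum]
    have : G.len = c := rfl
    rw [this, Finset.sum_range]
    refine Finset.sum_congr rfl fun i _ => ?_
    rw [Finset.sum_congr rfl fun p _ => by rw [hdeg i i.2 p]]
    rw [Finset.sum_const, card_univ, Fintype.card_fin, nsmul_eq_mul, hrk]
    ring
  refine ⟨G, ⟨?_, ?_, ?_, ?_, ?_⟩, hbetti⟩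
  · refine mkF_res D deg pos ord H (d 0) c hc' ?_
    refine acyclic c _ _ (reg_X K c n hc) D H.sq pos H.hpos 0 (by simpa using hc') ?_
    intro k
    obtain ⟨M, hM⟩ := hann k
    exact ⟨M, fun w _ hw => mem_AnnH.1 hM w hw⟩
  · intro i p q h
    by_cases hi : i + 1 < c + 1
    · rw [hdeg (i+1) hi, hdeg i (by omega)] at h
      have := hd.injective h
      simp at this
    · have : G.rk (i+1) = 0 := G.rk_eq_zero (i+1) (by show c < i + 1; omega)
      exact absurd q.2 (by omega)
  · intro i hi
    exact G.rk_eq_zero i hi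
  · intro h
    have h1 := hrk (Fin.last c)
    have h2 := mul_pos hlam (piC_pos hd (Fin.last c))
    rw [← h1] at h2
    simp only [Fin.val_last] at h2
    rw [h] at h2; simp at h2
  · refine dim_of_HK hc G ?_ ?_
    · intro f hf
      rw [hmom, HK_pT hd f hf, mul_zero]
    · intro f hf hfc
      rw [hmom, pT_top hd f (by rw [Polynomial.degree_eq_natDegree hf, hfc])]
      have : f.coeff c ≠ 0 := by rw [← hfc]; exact Polynomial.leadingCoeff_ne_zero.2 hf
      refine mul_ne_zero hlam.ne' (mul_ne_zero (by simp) this)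

theorem pure_exists (K : Type) [Field K] (n c : ℕ) (hc : c ≤ n) (d : Fin (c+1) → ℤ) (hd : StrictMono d) :
    ∃ (G : FreeComplex K n) (lam : ℚ), 0 < lam ∧
        IsCMcodim G c ∧ ∀ (i : ℕ) (j : ℤ), (bettiNum G i j : ℚ) = lam * pureTable d i j := by
  classical
  set p : Polynomial (PolyS K n) := ∑ k : Fin c, Polynomial.monomial (k:ℕ) (X (Fin.castLE hc k)) with hp
  have hpc : ∀ m, p.coeff m = if h : m < c then X (Fin.castLE hc ⟨m, h⟩) else 0 := by
    intro m
    rw [hp, Polynomial.finset_sum_coeff]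
    simp only [Polynomial.coeff_monomial]
    split_ifs with h
    · rw [Finset.sum_eq_single ⟨m, h⟩]
      · simp
      · intro b _ hb
        rw [if_neg fun h' => hb (Fin.ext h')]
      · simp
    · refine Finset.sum_eq_zero fun k _ => ?_
      rw [if_neg fun h' => h (by rw [← h']; exact k.2)]
  set N := (Rts d).card with hN
  have hW := card_Rts d hd
  rw [← hN] at hW
  obtain ⟨R, _, Q, q, ι, hQ, hq1, hq0, -, hpush⟩ := tower N (PolyS K n) (hZ K n) (mulP_hZ K n) p (by
    intro k
    rw [hpc]
    split_ifs with h
    · rw [mem_hZ, mem_homogZ_nonneg (by norm_num)]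
      exact isHomogeneous_X _ _
    · exact zero_mem _) c (by
    intro k hk
    rw [hpc, dif_neg (by omega)])
  obtain ⟨I, _, _, D, deg, hDM, hch, hH⟩ := koszul Q (c + N) (fun k => q.coeff k) (fun k => hq1 k)
  have hrad : ∀ k, q.coeff k ∈ (AnnH D).radical := by
    intro k
    by_cases hk : k < c + N
    · obtain ⟨Hm, hHm⟩ := hH ⟨k, hk⟩
      exact Ideal.le_radical (ann_of_homotopy D Hm _ hHm)
    · rw [hq0 k (by omega)]; exact zero_mem _
  set rt : Fin N → ℤ := fun l => ((Rts d).equivFin.symm l).1 with hrt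
  obtain ⟨I', _, _, o, D', hDM', hfib, hann⟩ := hpush D _ _ _ hDM hrad rt
  have hprod : ∀ z : ℤ, ∏ l, (rt l - z).natAbs = ∏ r ∈ Rts d, (r - z).natAbs := by
    intro z
    rw [← Finset.prod_coe_sort (Rts d) (fun r => (r - z).natAbs)]
    exact Equiv.prod_comp (Rts d).equivFin.symm (fun r => (r.1 - z).natAbs)
  have hcnt : ∀ z : ℤ, (univ.filter fun l => rt l < z).card = ((Rts d).filter (· < z)).card := by
    intro z
    rw [Finset.card_filter, Finset.card_filter, ← Finset.sum_coe_sort (Rts d) (fun r => if r < z then 1 else 0)]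
    exact Equiv.sum_comp (Rts d).equivFin.symm (fun r => if r.1 < z then 1 else 0)
  have hlast := hd.monotone (Fin.zero_le (Fin.last c))
  have hle : ∀ x, (deg x : ℤ) ≤ d (Fin.last c) - d 0 := by
    intro x
    have h1 := hch (deg x)
    have h2 : 0 < (univ.filter fun y => deg y = deg x).card := Finset.card_pos.2 ⟨x, by simp⟩
    rw [h1] at h2
    have : deg x ≤ c + N := by
      by_contra h
      rw [Nat.choose_eq_zero_of_lt (by omega)] at h2
      omega
    omega
  refine Exists.elim (pure_of_DM hc d hd D' _ _ _ hDM' ((d (Fin.last c) - d 0).toNat.factorial)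
    (by positivity) ?_ ?_ ?_) fun G hG => ⟨G, _, by positivity, hG⟩
  · intro x
    have h1 := hfib (o x)
    have h2 : 0 < (univ.filter fun y => o y = o x).card := Finset.card_pos.2 ⟨x, by simp⟩
    rw [h1, hprod] at h2
    obtain ⟨i, hi⟩ := notMem_Rts d (q := deg (o x)) (by omega) (hle _) (fun hmem => by
      rw [Finset.prod_eq_zero hmem (by simp)] at h2
      omega)
    refine ⟨i, hi, ?_⟩
    beta_reduce
    rw [hcnt, hi, card_lt_Rts d hd]
    ring
  · intro i
    have h0 := Finset.mem_Icc.1 (d_mem d hd i)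
    rw [← prod_Rts d hd i]
    congr 1
    have e1 : (univ.filter fun x => ((fun p => (deg p : ℤ)) ∘ o) x = d i - d 0) =
        (univ.filter fun y => deg y = (d i - d 0).toNat).biUnion fun y => univ.filter fun x => o x = y := by
      ext x
      simp only [Finset.mem_filter, Finset.mem_univ, true_and, Finset.mem_biUnion, Function.comp, exists_eq_right']
      omega
    rw [e1, Finset.card_biUnion]
    · rw [Finset.sum_congr rfl (g := fun _ => ∏ r ∈ Rts d, (r - (d i - d 0)).natAbs)]
      · rw [Finset.sum_const, hch, smul_eq_mul, ← hW, add_comm c N]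
      · intro y hy
        rw [hfib, hprod]
        have : (deg y : ℤ) = d i - d 0 := by
          have := (Finset.mem_filter.1 hy).2
          omega
        rw [this]
    · intro a _ b _ hab
      rw [Function.onFun, Finset.disjoint_left]
      intro x hx hx'
      exact hab ((Finset.mem_filter.1 hx).2.symm.trans (Finset.mem_filter.1 hx').2)
  · intro k
    have := hann k
    rw [hpc, dif_pos k.2] at this
    exact this

end ex2
end BS

namespace BS

section dmx

/-- total differential of a family of matrices -/
def DMx {R : Type} [CommRing R] {rk : ℕ → ℕ} (c : ℕ) (a : ∀ i, Matrix (Fin (rk i)) (Fin (rk (i+1))) R) :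
    Matrix (Σ i : Fin (c+1), Fin (rk i)) (Σ i : Fin (c+1), Fin (rk i)) R :=
  Matrix.of fun x y => if h : (y.1:ℕ) = x.1 + 1 then a x.1 x.2 (Fin.cast (congrArg rk h) y.2) else 0

variable {R : Type} [CommRing R] {rk : ℕ → ℕ} {c : ℕ}

lemma DMx_ne (a : ∀ i, Matrix (Fin (rk i)) (Fin (rk (i+1))) R) {x y} (h : DMx c a x y ≠ 0) : (y.1:ℕ) = x.1 + 1 := by
  by_contra hne
  exact h (by simp [DMx, hne])

lemma DMx_mem (a : ∀ i, Matrix (Fin (rk i)) (Fin (rk (i+1))) R) (Q : ℤ → AddSubgroup R) (dg : ∀ i, Fin (rk i) → ℤ)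
    (h : ∀ i p q, a i p q ∈ Q (dg (i+1) q - dg i p)) (x y) :
    DMx c a x y ∈ Q (dg y.1 y.2 - dg x.1 x.2) := by
  obtain ⟨⟨i, hi⟩, p⟩ := x
  obtain ⟨⟨k, hk⟩, q⟩ := y
  simp only [DMx, Matrix.of_apply]
  split_ifs with hh
  · subst hh
    exact h i p q
  · exact zero_mem _

lemma DMx_mulVec (hrk : ∀ i, c < i → rk i = 0) (a : ∀ i, Matrix (Fin (rk i)) (Fin (rk (i+1))) R) 
    (g : ∀ k, Fin (rk k) → R) :
    (DMx c a).mulVec (fun y => g y.1 y.2) = fun x => (a x.1).mulVec (g (x.1+1)) x.2 := by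
  funext x
  obtain ⟨⟨i, hi⟩, p⟩ := x
  simp only [Matrix.mulVec, dotProduct]
  rw [Fintype.sum_sigma]
  by_cases hlt : i + 1 < c + 1
  · rw [Finset.sum_eq_single ⟨i+1, hlt⟩]
    · refine Finset.sum_congr rfl fun q _ => ?_
      simp [DMx]
    · intro b _ hb
      refine Finset.sum_eq_zero fun q _ => ?_
      have : ¬ ((b:ℕ) = i + 1) := fun h => hb (Fin.ext h)
      simp [DMx, this]
    · simp
  · have h0 : rk (i+1) = 0 := hrk _ (by omega)
    have : IsEmpty (Fin (rk (i+1))) := by rw [h0]; infer_instance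
    rw [Finset.univ_eq_empty (α := Fin (rk (i+1))), Finset.sum_empty]
    refine Finset.sum_eq_zero fun b _ => Finset.sum_eq_zero fun q _ => ?_
    have : ¬ ((b:ℕ) = i + 1) := fun h => by have := b.2; omega
    simp [DMx, this]

lemma exists_fam (w : (Σ i : Fin (c+1), Fin (rk i)) → R) :
    ∃ g : ∀ k, Fin (rk k) → R, w = fun y => g y.1 y.2 :=
  ⟨fun k q => if h : k < c + 1 then w ⟨⟨k, h⟩, q⟩ else 0, by
    funext y
    obtain ⟨⟨i, hi⟩, p⟩ := y
    simp [hi]⟩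

lemma fam_zero (hrk : ∀ i, c < i → rk i = 0) (g : ∀ k, Fin (rk k) → R) (hg : (fun y : (Σ i : Fin (c+1), Fin (rk i)) => g y.1 y.2) = 0) :
    ∀ k, g k = 0 := by
  intro k
  funext q
  have hk : k < c + 1 := by
    by_contra h
    have := hrk k (by omega)
    exact absurd q.2 (by omega)
  exact congrFun hg ⟨⟨k, hk⟩, q⟩

lemma DMx_zero (hrk : ∀ i, c < i → rk i = 0) (a : ∀ i, Matrix (Fin (rk i)) (Fin (rk (i+1))) R) 
    (g : ∀ k, Fin (rk k) → R) (hg : (DMx c a).mulVec (fun y => g y.1 y.2) = 0) :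
    ∀ k, (a k).mulVec (g (k+1)) = 0 := by
  rw [DMx_mulVec hrk] at hg
  exact fam_zero hrk (fun k => (a k).mulVec (g (k+1))) hg

lemma DMx_sq (hrk : ∀ i, c < i → rk i = 0) (a : ∀ i, Matrix (Fin (rk i)) (Fin (rk (i+1))) R) 
    (hsq : ∀ i, a i * a (i+1) = 0) : DMx c a * DMx c a = 0 := by
  classical
  have : ∀ w, (DMx c a * DMx c a).mulVec w = 0 := by
    intro w
    obtain ⟨g, rfl⟩ := exists_fam w
    rw [← Matrix.mulVec_mulVec, DMx_mulVec hrk, DMx_mulVec hrk a (fun k => (a k).mulVec (g (k+1)))]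
    funext x
    rw [Matrix.mulVec_mulVec, hsq, Matrix.zero_mulVec]; rfl
  ext x y
  have h := congrFun (this (Pi.single y 1)) x
  rw [Matrix.mulVec_single_one] at h
  simpa using h

theorem DMx_isDM (hrk : ∀ i, c < i → rk i = 0) (a : ∀ i, Matrix (Fin (rk i)) (Fin (rk (i+1))) R) 
    (Q : ℤ → AddSubgroup R) (dg : ∀ i, Fin (rk i) → ℤ) (hsq : ∀ i, a i * a (i+1) = 0)
    (h : ∀ i p q, a i p q ∈ Q (dg (i+1) q - dg i p)) :
    IsDM Q (DMx c a) (fun x => dg x.1 x.2) (fun x => ((x.1:ℕ):ℤ)) (fun x => ((x.1:ℕ):ℤ)) := by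
  refine ⟨DMx_sq hrk a hsq, DMx_mem a Q dg h, fun x y hxy => ?_, fun x y hxy => ?_⟩
  · have := DMx_ne a hxy; omega
  · have := DMx_ne a hxy; omega

end dmx

section ann
variable {K : Type} [Field K] {n : ℕ}

/-- annihilator of the cokernel -/
def annI (F : FreeComplex K n) : Ideal (PolyS K n) where
  carrier := {f | ∀ w, ∃ y, (F.dd 0).mulVec y = f • w}
  zero_mem' := fun w => ⟨0, by simp⟩
  add_mem' := by
    intro f g hf hg w
    obtain ⟨y, hy⟩ := hf w
    obtain ⟨z, hz⟩ := hg w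
    exact ⟨y + z, by rw [Matrix.mulVec_add, hy, hz, add_smul]⟩
  smul_mem' := by
    intro r f hf w
    obtain ⟨y, hy⟩ := hf w
    exact ⟨r • y, by rw [Matrix.mulVec_smul, hy, smul_smul, smul_eq_mul]⟩

lemma mem_annI {F : FreeComplex K n} {f : PolyS K n} :
    f ∈ annI F ↔ ∀ w, ∃ y, (F.dd 0).mulVec y = f • w := Iff.rfl

lemma lift_mat {R : Type} [CommRing R] {p q r : ℕ} (A : Matrix (Fin p) (Fin q) R) (B : Matrix (Fin p) (Fin r) R)
    (h : ∀ w, ∃ y, A.mulVec y = B.mulVec w) : ∃ X : Matrix (Fin q) (Fin r) R, A * X = B := by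
  choose y hy using fun k => h (Pi.single k 1)
  refine ⟨Matrix.of fun i k => y k i, ?_⟩
  ext i k
  have := congrFun (hy k) i
  rw [Matrix.mulVec_single_one] at this
  rw [← show B.col k i = B i k from rfl, ← this]
  rfl

lemma homotopy_exists (F : FreeComplex K n) (hF : IsResolution F) (f : PolyS K n) (hf : f ∈ annI F) :
    ∃ h : ∀ i, Matrix (Fin (F.rk (i+1))) (Fin (F.rk i)) (PolyS K n),
      F.dd 0 * h 0 = f • 1 ∧ ∀ i, F.dd (i+1) * h (i+1) + h i * F.dd i = f • 1 := by
  have h0 : ∃ X : Matrix (Fin (F.rk 1)) (Fin (F.rk 0)) (PolyS K n), F.dd 0 * X = f • 1 := by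
    refine lift_mat _ _ fun w => ?_
    obtain ⟨y, hy⟩ := hf w
    exact ⟨y, by rw [hy, Matrix.smul_mulVec, Matrix.one_mulVec]⟩
  have hstep : ∀ i (X : Matrix (Fin (F.rk (i+1))) (Fin (F.rk i)) (PolyS K n)),
      F.dd i * X * F.dd i = f • F.dd i →
      ∃ Y : Matrix (Fin (F.rk (i+1+1))) (Fin (F.rk (i+1))) (PolyS K n), F.dd (i+1) * Y = f • 1 - X * F.dd i := by
    intro i X hX
    refine lift_mat _ _ fun w => ?_
    have : (f • (1 : Matrix (Fin (F.rk (i+1))) (Fin (F.rk (i+1))) (PolyS K n)) - X * F.dd i).mulVec w ∈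
        LinearMap.ker ((F.dd i).mulVecLin) := by
      rw [LinearMap.mem_ker, Matrix.mulVecLin_apply, Matrix.mulVec_mulVec, Matrix.mul_sub, ← Matrix.mul_assoc, hX]
      simp
    rw [hF i] at this
    obtain ⟨y, hy⟩ := this
    exact ⟨y, by rw [← hy, Matrix.mulVecLin_apply]⟩
  have hgood : ∀ i (X : Matrix (Fin (F.rk (i+1))) (Fin (F.rk i)) (PolyS K n))
      (Y : Matrix (Fin (F.rk (i+1+1))) (Fin (F.rk (i+1))) (PolyS K n)), F.dd (i+1) * Y = f • 1 - X * F.dd i →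
      F.dd (i+1) * Y * F.dd (i+1) = f • F.dd (i+1) := by
    intro i X Y h
    rw [h, Matrix.sub_mul, Matrix.mul_assoc, F.isComplex]; simp
  choose X0 hX0 using h0
  let nxt : ∀ i, {X : Matrix (Fin (F.rk (i+1))) (Fin (F.rk i)) (PolyS K n) // F.dd i * X * F.dd i = f • F.dd i} →
      {X : Matrix (Fin (F.rk (i+1+1))) (Fin (F.rk (i+1))) (PolyS K n) //
        F.dd (i+1) * X * F.dd (i+1) = f • F.dd (i+1)} :=
    fun i X => ⟨(hstep i X.1 X.2).choose, hgood i X.1 _ (hstep i X.1 X.2).choose_spec⟩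
  let H : ∀ i, {X : Matrix (Fin (F.rk (i+1))) (Fin (F.rk i)) (PolyS K n) // F.dd i * X * F.dd i = f • F.dd i} :=
    fun i => Nat.rec ⟨X0, by rw [hX0]; simp⟩ (fun i X => nxt i X) i
  refine ⟨fun i => (H i).1, hX0, fun i => ?_⟩
  have : F.dd (i+1) * (H (i+1)).1 = f • 1 - (H i).1 * F.dd i := (hstep i (H i).1 (H i).2).choose_spec
  rw [this]; simp

/-- base change annihilates homology -/
theorem ann_base {R : Type} [CommRing R] (F : FreeComplex K n) (hF : IsResolution F) {c : ℕ}
    (hrk : ∀ i, c < i → F.rk i = 0) (Φ : PolyS K n →+* R) (f : PolyS K n) (hf : f ∈ annI F) :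
    Φ f ∈ AnnH (DMx c fun i => (F.dd i).map Φ) := by
  obtain ⟨h, h0, hs⟩ := homotopy_exists F hF f hf
  rw [mem_AnnH]
  intro w hw
  obtain ⟨g, rfl⟩ := exists_fam w
  have hz := DMx_zero hrk _ g hw
  set y : ∀ k, Fin (F.rk k) → R := fun k => match k with
    | 0 => 0
    | k+1 => ((h k).map Φ).mulVec (g k) with hy
  refine ⟨fun x => y x.1 x.2, ?_⟩
  rw [DMx_mulVec hrk]
  have key : ∀ i, ((F.dd i).map Φ).mulVec (y (i+1)) = Φ f • g i := by
    intro i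
    have e : y (i+1) = ((h i).map Φ).mulVec (g i) := rfl
    rw [e, Matrix.mulVec_mulVec, ← Matrix.map_mul]
    cases i with
    | zero =>
      rw [h0]
      have : (f • (1 : Matrix (Fin (F.rk 0)) (Fin (F.rk 0)) (PolyS K n))).map Φ = Φ f • 1 := by
        ext a b; by_cases hab : a = b <;> simp [Matrix.one_apply, hab]
      rw [this, Matrix.smul_mulVec, Matrix.one_mulVec]
    | succ i =>
      rw [eq_sub_of_add_eq (hs i)]
      have : (f • (1 : Matrix (Fin (F.rk (i+1))) (Fin (F.rk (i+1))) (PolyS K n)) - h i * F.dd i).map Φ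
          = Φ f • 1 - (h i).map Φ * (F.dd i).map Φ := by
        have hm : (h i * F.dd i).map Φ = (h i).map Φ * (F.dd i).map Φ := Matrix.map_mul ..
        ext a b
        have hm' := congrFun (congrFun hm a) b
        rw [Matrix.map_apply] at hm'
        rw [Matrix.map_apply, Matrix.sub_apply, Matrix.sub_apply, map_sub, hm']
        by_cases hab : a = b <;> simp [Matrix.one_apply, hab]
      rw [this, Matrix.sub_mulVec, ← Matrix.mulVec_mulVec, hz i, Matrix.mulVec_zero, sub_zero,
        Matrix.smul_mulVec, Matrix.one_mulVec]
  funext x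
  rw [key]; rfl

end ann
end BS

namespace BS

section rankl
variable {k : Type} [Field k] {I : Type} [Fintype I] [DecidableEq I]

/-- vectors supported on `A` -/
def SS (k : Type) [Field k] {I : Type} (A : Finset I) : Submodule k (I → k) where
  carrier := {w | ∀ x, x ∉ A → w x = 0}
  zero_mem' := fun _ _ => rfl
  add_mem' := fun ha hb x hx => by simp [ha x hx, hb x hx]
  smul_mem' := fun r a ha x hx => by simp [ha x hx]

lemma mem_SS {A : Finset I} {w : I → k} : w ∈ SS k A ↔ ∀ x, x ∉ A → w x = 0 := Iff.rfl

lemma finrank_SS (A : Finset I) : finrank k (SS k A) = A.card := by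
  let e : SS k A ≃ₗ[k] (A → k) :=
    { toFun := fun w x => w.1 x.1
      map_add' := fun _ _ => rfl
      map_smul' := fun _ _ => rfl
      invFun := fun v => ⟨fun x => if h : x ∈ A then v ⟨x, h⟩ else 0, fun x hx => by simp [hx]⟩
      left_inv := fun w => by
        apply Subtype.ext; funext x
        by_cases h : x ∈ A
        · simp [h]
        · simp [h, w.2 x h]
      right_inv := fun v => by funext x; simp }
  rw [e.finrank_eq]; simp

lemma rank_null {V W : Type} [AddCommGroup V] [AddCommGroup W] [Module k V] [Module k W]
    [FiniteDimensional k V] (f : V →ₗ[k] W) (U : Submodule k V) :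
    finrank k (U.map f) + finrank k (U ⊓ LinearMap.ker f : Submodule k V) = finrank k U := by
  have h := LinearMap.finrank_range_add_finrank_ker (f.domRestrict U)
  rw [LinearMap.range_domRestrict] at h
  rw [← h]
  congr 1
  rw [LinearMap.ker_domRestrict]
  have : (Submodule.comap U.subtype (LinearMap.ker f)).map U.subtype = U ⊓ LinearMap.ker f := by
    rw [Submodule.map_comap_subtype]
  rw [← this]
  exact (Submodule.equivMapOfInjective _ U.injective_subtype _).finrank_eq.symm

variable (D : Matrix I I k) (pos : I → ℤ)

/-- layer -/
def lay {I : Type} [Fintype I] (pos : I → ℤ) (p : ℤ) : Finset I := Finset.univ.filter fun x => pos x = p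

/-- cycles -/
def zz (D : Matrix I I k) (pos : I → ℤ) (p : ℤ) : ℕ :=
  finrank k (SS k (lay pos p) ⊓ LinearMap.ker D.mulVecLin : Submodule k (I → k))

lemma card_lay (hsq : D * D = 0) (hpos : ∀ p q, D p q ≠ 0 → pos p + 1 = pos q)
    (hex : ∀ w, D.mulVec w = 0 → ∃ y, D.mulVec y = w) (p : ℤ) :
    (lay pos (p+1)).card = zz D pos p + zz D pos (p+1) := by
  rw [← finrank_SS (k := k), ← rank_null D.mulVecLin]
  unfold zz
  suffices hh : (SS k (lay pos (p+1))).map D.mulVecLin =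
      SS k (lay pos p) ⊓ LinearMap.ker D.mulVecLin by rw [hh]
  ext w
  constructor
  · rintro ⟨y, hy, rfl⟩
    refine ⟨?_, ?_⟩
    · intro x hx
      simp only [Matrix.mulVecLin_apply, Matrix.mulVec, dotProduct]
      refine Finset.sum_eq_zero fun q _ => ?_
      by_cases h : D x q = 0
      · simp [h]
      · have := hpos _ _ h
        rw [hy q, mul_zero]
        simp only [lay, mem_filter, mem_univ, true_and] at hx ⊢
        omega
    · change D.mulVecLin _ = 0
      simp [Matrix.mulVec_mulVec, hsq]
  · rintro ⟨h1, h2⟩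
    obtain ⟨y, rfl⟩ := hex w h2
    refine ⟨fun x => if pos x = p + 1 then y x else 0, ?_, ?_⟩
    · intro x hx
      have : ¬ pos x = p + 1 := by simpa [lay] using hx
      simp [this]
    · funext x
      by_cases hx : pos x = p
      · simp only [Matrix.mulVecLin_apply, Matrix.mulVec, dotProduct]
        refine Finset.sum_congr rfl fun q _ => ?_
        by_cases h : D x q = 0
        · simp [h]
        · have := hpos _ _ h
          rw [if_pos (by omega)]
      · rw [h1 x (by simpa [lay] using hx)]
        simp only [Matrix.mulVecLin_apply, Matrix.mulVec, dotProduct]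
        refine Finset.sum_eq_zero fun q _ => ?_
        by_cases h : D x q = 0
        · simp [h]
        · have := hpos _ _ h
          rw [if_neg (by omega), mul_zero]

lemma tele (hsq : D * D = 0) (hpos : ∀ p q, D p q ≠ 0 → pos p + 1 = pos q)
    (hex : ∀ w, D.mulVec w = 0 → ∃ y, D.mulVec y = w) (p : ℤ) :
    ∑ x ∈ Finset.univ.filter (fun x => p < pos x), (-1:ℚ)^(pos x) = - ((-1:ℚ)^p * zz D pos p) := by
  obtain ⟨B, hB⟩ : ∃ B : ℤ, ∀ x, pos x < B := by
    obtain ⟨B, hB⟩ := (Set.finite_range pos).bddAbove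
    exact ⟨B + 1, fun x => by have := hB ⟨x, rfl⟩; omega⟩
  have big : ∀ p, B ≤ p → 
    ∑ x ∈ Finset.univ.filter (fun x => p < pos x), (-1:ℚ)^(pos x) = - ((-1:ℚ)^p * zz D pos p) := by
    intro p hp
    rw [Finset.sum_eq_zero]
    · have : zz D pos p = 0 := by
        have h1 : zz D pos p ≤ finrank k (SS k (lay pos p)) := Submodule.finrank_mono inf_le_left
        rw [finrank_SS, show lay pos p = ∅ from ?_] at h1
        · simpa using h1
        · ext x; have := hB x; simp [lay]; omega
      simp [this]
    · intro x hx
      simp at hx; have := hB x; omega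
  have key : ∀ m : ℕ, ∀ p, B - m ≤ p → 
    ∑ x ∈ Finset.univ.filter (fun x => p < pos x), (-1:ℚ)^(pos x) = - ((-1:ℚ)^p * zz D pos p) := by
    intro m
    induction m with
    | zero => intro p hp; exact big p (by simpa using hp)
    | succ m ih =>
      intro p hp
      have h := ih (p+1) (by push_cast at hp; omega)
      have hs : Finset.univ.filter (fun x => p < pos x) =
          lay pos (p+1) ∪ Finset.univ.filter (fun x => p + 1 < pos x) := by
        ext x; simp [lay]; omega
      rw [hs, Finset.sum_union, h]
      · rw [Finset.sum_congr rfl (g := fun _ => (-1:ℚ)^(p+1)) (fun x hx => by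
          have : pos x = p + 1 := by simpa [lay] using hx
          rw [this])]
        rw [Finset.sum_const, card_lay D pos hsq hpos hex, zpow_add_one₀ (by norm_num)]
        push_cast [nsmul_eq_mul]
        ring
      · rw [Finset.disjoint_left]
        intro x hx hx'
        simp [lay] at hx hx'; omega
  exact key (B - p).toNat p (by omega)

theorem rank_ineq (hsq : D * D = 0) (hpos : ∀ p q, D p q ≠ 0 → pos p + 1 = pos q)
    (hex : ∀ w, D.mulVec w = 0 → ∃ y, D.mulVec y = w) (T : Finset I)
    (h0 : ∀ x ∈ T, 0 ≤ pos x) (h2 : ∀ x, 2 ≤ pos x → x ∈ T)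
    (hcl : ∀ x y, y ∈ T → pos y = 1 → D x y ≠ 0 → x ∈ T) :
    0 ≤ ∑ x ∈ T, (-1:ℚ)^(pos x) := by
  set T0 := T.filter fun x => pos x = 0
  set T1 := T.filter fun x => pos x = 1
  have hT : T = (Finset.univ.filter (fun x => 1 < pos x)) ∪ (T0 ∪ T1) := by
    ext x
    simp only [T0, T1, mem_union, mem_filter, mem_univ, true_and]
    constructor
    · intro hx
      have := h0 x hx
      by_cases h : 1 < pos x
      · exact Or.inl h
      · right
        rcases (by omega : pos x = 0 ∨ pos x = 1) with h | h <;> simp [hx, h]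
    · rintro (h | h | h)
      · exact h2 x (by omega)
      · exact h.1
      · exact h.1
  have hle : T1.card ≤ T0.card + zz D pos 1 := by
    rw [← finrank_SS (k := k) T1, ← rank_null D.mulVecLin, ← finrank_SS (k := k) T0]
    refine add_le_add (Submodule.finrank_mono ?_) (Submodule.finrank_mono ?_)
    · rintro _ ⟨y, hy, rfl⟩ x hx
      simp only [Matrix.mulVecLin_apply, Matrix.mulVec, dotProduct]
      refine Finset.sum_eq_zero fun q _ => ?_
      by_cases h : D x q = 0
      · simp [h]
      by_cases hq : q ∈ T1
      · exfalso
        apply hx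
        simp only [T1, mem_filter] at hq
        have := hpos _ _ h
        simp only [T0, mem_filter]
        exact ⟨hcl x q hq.1 hq.2 h, by omega⟩
      · rw [hy q hq, mul_zero]
    · refine inf_le_inf_right _ ?_
      intro w hw x hx
      refine hw x fun h => hx ?_
      simp only [T1, mem_filter] at h
      simp [lay, h.2]
  rw [hT, Finset.sum_union, Finset.sum_union, tele D pos hsq hpos hex]
  · rw [Finset.sum_congr rfl (g := fun _ => (1:ℚ)) (s₁ := T0) (fun x hx => by
          have : pos x = 0 := by simp only [T0, mem_filter] at hx; exact hx.2
          rw [this]; simp), Finset.sum_congr rfl (g := fun _ => (-1:ℚ)) (s₁ := T1) (fun x hx => by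
          have : pos x = 1 := by simp only [T1, mem_filter] at hx; exact hx.2
          rw [this]; simp)]
    have : (T1.card : ℚ) ≤ T0.card + zz D pos 1 := by exact_mod_cast hle
    simp
    linarith
  · rw [Finset.disjoint_left]
    intro x hx hx'
    simp [T0, T1] at hx hx'; omega
  · rw [Finset.disjoint_left]
    intro x hx hx'
    simp [T0, T1] at hx hx'; omega

end rankl
end BS

namespace BS

lemma monom_mem {R : Type} [CommRing R] (Q : ℤ → AddSubgroup R) (hQ : MulP Q) {n : ℕ} (y : Fin n → R)
    (hy : ∀ i, y i ∈ Q 1) : ∀ (m : ℕ) (d : Fin n →₀ ℕ), ∑ i, d i = m + 1 → ∏ i, y i ^ d i ∈ Q (m+1) := by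
  intro m
  induction m with
  | zero =>
    intro d hd
    obtain ⟨i, hi⟩ : ∃ i, d i ≠ 0 := by
      by_contra h; push Not at h
      simp [h] at hd
    have hs : ∑ k ∈ univ.erase i, d k + d i = 1 := by rw [Finset.sum_erase_add _ _ (mem_univ i), hd]
    have h1 : d i = 1 := by omega
    have h0 : ∀ k ∈ univ.erase i, d k = 0 := by
      intro k hk
      have : ∑ k ∈ univ.erase i, d k = 0 := by omega
      exact (Finset.sum_eq_zero_iff.1 this) k hk
    rw [← Finset.prod_erase_mul _ _ (mem_univ i), Finset.prod_eq_one (fun k hk => by rw [h0 k hk, pow_zero]),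
      h1]
    simpa using hy i
  | succ m ih =>
    intro d hd
    obtain ⟨i, hi⟩ : ∃ i, d i ≠ 0 := by
      by_contra h; push Not at h
      simp [h] at hd
    have hs : ∑ k ∈ univ.erase i, d k + d i = m+1+1 := by rw [Finset.sum_erase_add _ _ (mem_univ i), hd]
    have e1 : ∏ k, y k ^ d k = y i * ∏ k, y k ^ (d.update i (d i - 1)) k := by
      rw [← Finset.prod_erase_mul _ _ (mem_univ i), ← Finset.prod_erase_mul univ
        (fun k => y k ^ (d.update i (d i - 1)) k) (mem_univ i)]
      rw [Finset.prod_congr rfl (g := fun k => y k ^ d k) (s₁ := univ.erase i)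
        (f := fun k => y k ^ (d.update i (d i - 1)) k)]
      · obtain ⟨t, ht⟩ := Nat.exists_eq_succ_of_ne_zero hi
        simp [ht, pow_succ]; ring
      · intro k hk
        rw [Finsupp.update_apply, if_neg (Finset.ne_of_mem_erase hk)]
    have e2 : ∑ k, (d.update i (d i - 1)) k = m + 1 := by
      rw [← Finset.sum_erase_add _ _ (mem_univ i)]
      rw [Finset.sum_congr rfl (g := fun k => d k) (s₁ := univ.erase i)]
      · simp; omega
      · intro k hk
        rw [Finsupp.update_apply, if_neg (Finset.ne_of_mem_erase hk)]
    rw [e1]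
    have := hQ _ _ _ _ (hy i) (ih _ e2)
    convert this using 2
    push_cast; ring

lemma homog_image_mem {K : Type} [Field K] {n : ℕ} {R : Type} [CommRing R] (Q : ℤ → AddSubgroup R) (hQ : MulP Q)
    (Φ : PolyS K n →+* R) (hC : ∀ a : K, ∀ k, ∀ x ∈ Q k, Φ (C a) * x ∈ Q k) (hX : ∀ i, Φ (X i) ∈ Q 1)
    (m : ℕ) (f : PolyS K n) (hf : f.IsHomogeneous (m+1)) : Φ f ∈ Q (m+1) := by
  rw [f.as_sum, map_sum]
  refine AddSubgroup.sum_mem _ fun d hd => ?_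
  have hdeg : ∑ i, d i = m + 1 := by
    have := hf (mem_support_iff.1 hd)
    rw [← this, Finsupp.weight_apply, Finsupp.sum_fintype] <;> simp
  have : Φ (monomial d (coeff d f)) = Φ (C (coeff d f)) * ∏ i, Φ (X i) ^ d i := by
    rw [monomial_eq, map_mul, Finsupp.prod_fintype _ _ (by simp), map_prod]
    simp
  rw [this]
  exact hC _ _ _ (monom_mem Q hQ _ hX m d hdeg)

/-- Betti diagram as finitely supported functions -/
def gam {K : Type} [Field K] {n : ℕ} (F : FreeComplex K n) (c : ℕ) (i : Fin (c+1)) : ℤ →₀ ℚ :=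
  ∑ p : Fin (F.rk i), Finsupp.single (F.deg i p) 1

lemma gam_sum {K : Type} [Field K] {n : ℕ} (F : FreeComplex K n) (c : ℕ) (i : Fin (c+1)) (g : ℤ → ℚ) :
    ((gam F c i).sum fun j v => v * g j) = ∑ p, g (F.deg i p) := by
  unfold gam
  rw [← Finsupp.sum_finset_sum_index (by simp) (by intros; ring)]
  refine Finset.sum_congr rfl fun p _ => ?_
  rw [Finsupp.sum_single_index] <;> simp

lemma gam_apply {K : Type} [Field K] {n : ℕ} (F : FreeComplex K n) (c : ℕ) (i : Fin (c+1)) (j : ℤ) :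
    gam F c i j = bettiNum F i j := by
  unfold gam bettiNum
  rw [Finsupp.finset_sum_apply, Finset.card_filter]
  push_cast
  refine Finset.sum_congr rfl fun p _ => ?_
  simp [Finsupp.single_apply]

lemma Phi_gam {K : Type} [Field K] {n : ℕ} (F : FreeComplex K n) (c : ℕ) (g : Fin (c+1) → ℤ → ℚ) :
    Phi g (gam F c) = ∑ x : (Σ i : Fin (c+1), Fin (F.rk i)), (-1:ℚ)^(x.1:ℕ) * g x.1 (F.deg x.1 x.2) := by
  unfold Phi
  rw [Fintype.sum_sigma]
  refine Finset.sum_congr rfl fun i _ => ?_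
  rw [gam_sum, Finset.mul_sum]

/-- trivial filtration on a field -/
def PF (A : Type) [CommRing A] (k : ℤ) : AddSubgroup A := if 0 < k then ⊤ else ⊥

lemma PF_mul (A : Type) [CommRing A] : MulP (PF A) := by
  intro k l x y hx hy
  unfold PF at *
  split_ifs at hx hy with h1 h2 h2
  · rw [if_pos (by omega)]; trivial
  · rw [show y = 0 from hy, mul_zero]; exact zero_mem _
  · rw [show x = 0 from hx, zero_mul]; exact zero_mem _
  · rw [show x = 0 from hx, zero_mul]; exact zero_mem _

lemma prod_abs {c : ℕ} (e : Fin (c+1) → ℤ) (E : Finset (Fin (c+1))) (j : ℤ) :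
    ∏ l ∈ E, ((e l - j : ℤ):ℚ) = (-1:ℚ)^(E.filter fun l => e l < j).card * ∏ l ∈ E, ((e l - j).natAbs : ℚ) := by
  rw [← Finset.prod_const, Finset.prod_filter, ← Finset.prod_mul_distrib]
  refine Finset.prod_congr rfl fun l _ => ?_
  rw [Nat.cast_natAbs]
  split_ifs with h
  · rw [abs_of_neg (by omega)]; push_cast; ring
  · rw [abs_of_nonneg (by omega)]; push_cast; ring

lemma q_char {c : ℕ} (e : Fin (c+1) → ℤ) (he : StrictMono e) (j : ℤ) (i : Fin (c+1)) :
    e i < j ↔ (i:ℕ) < (univ.filter fun l => e l < j).card := by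
  constructor
  · intro h
    have hs : Finset.Iic i ⊆ univ.filter fun l => e l < j := by
      intro l hl
      simp only [Finset.mem_Iic] at hl
      simp only [mem_filter, mem_univ, true_and]
      exact lt_of_le_of_lt (he.monotone hl) h
    have := Finset.card_le_card hs
    rw [Fin.card_Iic] at this
    omega
  · intro h
    by_contra hn
    have hs : (univ.filter fun l => e l < j) ⊆ Finset.Iio i := by
      intro l hl
      simp only [Finset.mem_Iio]
      simp only [mem_filter, mem_univ, true_and] at hl
      by_contra h'
      have := he.monotone (not_lt.1 h')
      omega
    have := Finset.card_le_card hs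
    rw [Fin.card_Iio] at this
    omega

lemma r_char {c : ℕ} (e : Fin (c+1) → ℤ) (j : ℤ) (τ : Fin c) :
    (((univ.erase τ.castSucc).erase τ.succ).filter fun l => e l < j).card
      + (if e τ.castSucc < j then 1 else 0) + (if e τ.succ < j then 1 else 0)
      = (univ.filter fun l => e l < j).card := by
  simp only [Finset.card_filter]
  rw [← Finset.sum_erase_add univ _ (mem_univ τ.castSucc),
    ← Finset.sum_erase_add (univ.erase τ.castSucc) _ (show τ.succ ∈ univ.erase τ.castSucc from ?_)]
  · ring
  · simp [Fin.ext_iff]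

end BS

namespace BS

/-- substitution of linear forms -/
def phi0 {K K' : Type} [Field K] [Field K'] {n c : ℕ} (j : K →+* K') (v : Fin c → Fin n → K') :
    PolyS K n →+* MvPolynomial (Fin c) K' :=
  eval₂Hom (C.comp j) (fun i => ∑ k, C (v k i) * X k)

theorem ineq_of_noether {K : Type} [Field K] {n c : ℕ} (F : FreeComplex K n) (hF : IsResolution F)
    (hmin : IsMinimal F) (hrk : ∀ i, c < i → F.rk i = 0) (K' : Type) [Field K'] (j : K →+* K')
    (v : Fin c → Fin n → K') (hv : ∀ k, (X k : MvPolynomial (Fin c) K') ∈ ((annI F).map (phi0 j v)).radical)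
    (e : Fin (c+1) → ℤ) (he : StrictMono e) (τ : Fin c) (hτ : e τ.succ = e τ.castSucc + 1) :
    0 ≤ Phi (Lw e τ) (gam F c) := by
  set E := (univ.erase τ.castSucc).erase τ.succ with hE
  have hcard : 1 + E.card = c := by
    have h1 : τ.succ ∈ univ.erase τ.castSucc := by simp [Fin.ext_iff]
    rw [hE, Finset.card_erase_of_mem h1, Finset.card_erase_of_mem (mem_univ _)]
    simp
    have := τ.2
    omega
  obtain ⟨R, _, Q, q, ι, hQ, hq1, hq0, hι, H⟩ := tower E.card K' (PF K') (PF_mul K') 1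
    (fun k => by simp [PF]) 1 (fun k hk => by rw [Polynomial.coeff_one, if_neg (by omega)])
  rw [hcard] at hq0
  set ψ : MvPolynomial (Fin c) K' →+* R := eval₂Hom ι (fun k => q.coeff k) with hψ
  set Φ : PolyS K n →+* R := ψ.comp (phi0 j v) with hΦ
  have hst : ∀ a : K', ∀ k, ∀ x ∈ Q k, ι a * x ∈ Q k := by
    intro a
    apply hι a
    intro k x hx
    unfold PF at *
    split_ifs at hx ⊢
    · trivial
    · rw [show x = 0 from hx, mul_zero]; exact zero_mem _
  have hC : ∀ a : K, Φ (C a) = ι (j a) := by intro a; simp [hΦ, hψ, phi0]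
  have hX : ∀ i, Φ (X i) ∈ Q 1 := by
    intro i
    have : Φ (X i) = ∑ k : Fin c, ι (v k i) * q.coeff k := by simp [hΦ, hψ, phi0]
    rw [this]
    exact AddSubgroup.sum_mem _ fun k _ => hst _ _ _ (hq1 k)
  have hent : ∀ i p r, ((F.dd i).map Φ) p r ∈ Q (F.deg (i+1) r - F.deg i p) := by
    intro i p r
    rw [Matrix.map_apply]
    have hh := F.isHomog i p r
    rcases lt_trichotomy (F.deg (i+1) r - F.deg i p) 0 with h | h | h
    · rw [mem_homogZ_neg (by omega)] at hh
      rw [hh, map_zero]; exact zero_mem _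
    · rw [hmin i p r (by omega), map_zero]; exact zero_mem _
    · rw [mem_homogZ_nonneg (by omega)] at hh
      obtain ⟨m, hm⟩ : ∃ m : ℕ, F.deg (i+1) r - F.deg i p = m + 1 :=
        ⟨(F.deg (i+1) r - F.deg i p - 1).toNat, by omega⟩
      rw [hm] at hh ⊢
      exact homog_image_mem Q hQ Φ (fun a => by rw [hC]; exact hst _) hX m _
        (by simpa using hh)
  have hDM := DMx_isDM (c := c) hrk (fun i => (F.dd i).map Φ) Q F.deg
    (fun i => by
      have := congrArg (fun M => M.map Φ) (F.isComplex i)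
      beta_reduce at this
      rw [Matrix.map_mul] at this
      rw [this]; ext a b; simp) hent
  have hrad : ∀ k, q.coeff k ∈ (AnnH (DMx c fun i => (F.dd i).map Φ)).radical := by
    intro k
    by_cases hk : k < c
    · have h1 := hv ⟨k, hk⟩
      rw [Ideal.mem_radical_iff] at h1 ⊢
      obtain ⟨m, hm⟩ := h1
      refine ⟨m, ?_⟩
      have h2 := Ideal.mem_map_of_mem ψ hm
      rw [Ideal.map_map] at h2
      have h3 : ψ (X ⟨k, hk⟩ ^ m) = q.coeff k ^ m := by simp [hψ]
      rw [h3] at h2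
      have h4 : (annI F).map (ψ.comp (phi0 j v)) ≤ AnnH (DMx c fun i => (F.dd i).map Φ) := by
        rw [Ideal.map_le_iff_le_comap]
        intro f hf
        exact ann_base F hF hrk Φ f hf
      exact h4 h2
    · rw [hq0 k (by omega)]; exact zero_mem _
  obtain ⟨I', _, _, o, D', hD', hfib, hann⟩ := H _ _ _ _ hDM hrad (fun l => e (E.equivFin.symm l).1)
  have hcnt : ∀ z : ℤ, ((univ.filter fun l : Fin E.card => e (E.equivFin.symm l).1 < z).card) =
      (E.filter fun l => e l < z).card := by
    intro z
    rw [Finset.card_filter, Finset.card_filter,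
      Equiv.sum_comp E.equivFin.symm (fun l : E => if e l.1 < z then 1 else 0),
      Finset.sum_coe_sort E (fun l => if e l < z then 1 else 0)]
  have hprod : ∀ z : ℤ, (∏ l : Fin E.card, (e (E.equivFin.symm l).1 - z).natAbs) =
      ∏ l ∈ E, (e l - z).natAbs := by
    intro z
    rw [Equiv.prod_comp E.equivFin.symm (fun l : E => (e l.1 - z).natAbs),
      Finset.prod_coe_sort E (fun l => (e l - z).natAbs)]
  simp only [hcnt] at hD'
  simp only [hprod] at hfib
  have hex : ∀ w, D'.mulVec w = 0 → ∃ y, D'.mulVec y = w := by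
    intro w hw
    have h1 := hann 0
    rw [Polynomial.coeff_one_zero, Ideal.mem_radical_iff] at h1
    obtain ⟨m, hm⟩ := h1
    rw [one_pow, mem_AnnH] at hm
    simpa using hm w hw
  -- combinatorial facts
  have hc1 := q_char e he
  have hr := fun z => r_char e z τ
  rw [← hE] at hr
  set r : ℤ → ℕ := fun z => (E.filter fun l => e l < z).card with hrdef
  set qq : ℤ → ℕ := fun z => (univ.filter fun l => e l < z).card with hqdef
  have hr' : ∀ z, r z + (if (τ:ℕ) < qq z then 1 else 0) + (if (τ:ℕ) + 1 < qq z then 1 else 0) = qq z := by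
    intro z
    have h0 := hr z
    have h1 : e τ.castSucc < z ↔ (τ:ℕ) < qq z := hc1 z τ.castSucc
    have h2 : e τ.succ < z ↔ (τ:ℕ) + 1 < qq z := by
      have := hc1 z τ.succ
      rw [Fin.val_succ] at this
      exact this
    rw [if_congr h1 rfl rfl, if_congr h2 rfl rfl] at h0
    exact h0
  have hi : ∀ z (i : Fin (c+1)), z ≤ e i ↔ qq z ≤ i := by
    intro z i
    have := hc1 z i
    rw [← not_lt, this, not_lt]
  have ha1 : ∀ z, z ≤ e τ.castSucc ↔ qq z ≤ τ := by intro z; rw [hi]; simp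
  have ha2 : ∀ z, z ≤ e τ.castSucc + 1 ↔ qq z ≤ τ + 1 := by intro z; rw [← hτ, hi]; simp
  set T : Finset I' := univ.filter fun x => F.deg (o x).1 (o x).2 ≤ e (o x).1 with hTdef
  have hfin := rank_ineq D' (fun x => (((o x).1:ℕ):ℤ) - (r (F.deg (o x).1 (o x).2) : ℤ)) hD'.sq hD'.hpos hex T
    (by
      intro x hx
      simp only [hTdef, mem_filter, mem_univ, true_and, hi] at hx
      have := hr' (F.deg (o x).1 (o x).2)
      beta_reduce
      split_ifs at this <;> omega)
    (by
      intro x hx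
      simp only [hTdef, mem_filter, mem_univ, true_and, hi]
      have := hr' (F.deg (o x).1 (o x).2)
      beta_reduce at hx
      split_ifs at this <;> omega)
    (by
      intro x y hy hy1 hne
      have hp := hD'.hpos _ _ hne
      have ho := hD'.hord _ _ hne
      have hm := hD'.mem x y
      have hdeg : F.deg (o x).1 (o x).2 < F.deg (o y).1 (o y).2 := by
        by_contra hcon
        unfold PF at hm
        rw [if_neg (by simp only [Function.comp]; omega)] at hm
        exact hne hm
      simp only [Function.comp] at ho
      beta_reduce at hy1 hp
      simp only [hTdef, mem_filter, mem_univ, true_and, hi] at hy ⊢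
      have h1 := hr' (F.deg (o x).1 (o x).2)
      have h2 := hr' (F.deg (o y).1 (o y).2)
      have h3 := ha1 (F.deg (o x).1 (o x).2)
      have h4 := ha2 (F.deg (o y).1 (o y).2)
      generalize F.deg (o x).1 (o x).2 = dx at *
      generalize F.deg (o y).1 (o y).2 = dy at *
      change ((o x).1:ℕ) - (r dx:ℤ) + 1 = ((o y).1:ℕ) - (r dy : ℤ) at hp
      split_ifs at h1 h2 <;> omega)
  have hsum : ∑ x ∈ T, (-1:ℚ)^((((o x).1:ℕ):ℤ) - (r (F.deg (o x).1 (o x).2) : ℤ)) = Phi (Lw e τ) (gam F c) := by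
    rw [Phi_gam, ← Finset.sum_fiberwise_of_maps_to (s := T) (t := univ) (g := o) (fun _ _ => mem_univ _)]
    refine Finset.sum_congr rfl fun b _ => ?_
    have h1 : T.filter (fun x => o x = b) = if F.deg b.1 b.2 ≤ e b.1 then univ.filter (fun x => o x = b) else ∅ := by
      ext x
      split_ifs with h
      · simp only [hTdef, mem_filter, mem_univ, true_and]
        constructor
        · exact fun h => h.2
        · rintro rfl; exact ⟨h, rfl⟩
      · simp only [hTdef, mem_filter, mem_univ, true_and, notMem_empty, iff_false]
        rintro ⟨h', rfl⟩; exact h h'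
    rw [Finset.sum_congr rfl (g := fun _ => (-1:ℚ)^(((b.1:ℕ):ℤ) - (r (F.deg b.1 b.2) : ℤ))) (fun x hx => by
      rw [(mem_filter.1 hx).2])]
    rw [Finset.sum_const, h1]
    unfold Lw
    split_ifs with h
    · rw [hfib, ← hE, prod_abs, zpow_sub₀ (by norm_num), nsmul_eq_mul]
      simp only [zpow_natCast, Nat.cast_prod]
      have : ((-1:ℚ)^(r (F.deg b.1 b.2)))⁻¹ = (-1:ℚ)^(r (F.deg b.1 b.2)) := by
        rw [← inv_pow]; norm_num
      rw [div_eq_mul_inv, this]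
      ring
    · simp
  rw [← hsum]; exact hfin

end BS

namespace BS

lemma finrank_homog (K : Type) [Field K] (m t : ℕ) :
    (finrank K (homogeneousSubmodule (Fin (m+1)) K t) : ℚ) = (genHilb (m+1) 0).eval (t:ℚ) := by
  have h1 : homogeneousSubmodule (Fin (m+1)) K t = restrictSupport K {d | d.degree = t} :=
    homogeneousSubmodule_eq_finsupp_supported _ _ _
  have h2 : ({d | d.degree = t} : Set (Fin (m+1) →₀ ℕ)) =
      ((Finset.finsuppAntidiag (univ : Finset (Fin (m+1))) t : Finset _) : Set (Fin (m+1) →₀ ℕ)) := by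
    ext d
    simp [Finsupp.degree_eq_sum]
  rw [h1, finrank_eq_nat_card_basis (basisRestrictSupport K _), h2]
  rw [Nat.card_coe_set_eq, Set.ncard_coe_finset, Finset.card_finsuppAntidiag_nat_eq_choose]
  unfold genHilb
  rw [if_neg (by omega)]
  simp only [Polynomial.eval_mul, Polynomial.eval_C, Polynomial.eval_prod, Polynomial.eval_add,
    Polynomial.eval_sub, Polynomial.eval_X, Nat.add_sub_cancel, Finset.card_univ, Fintype.card_fin]
  have h3 := Nat.ascFactorial_eq_factorial_mul_choose t m
  rw [Nat.ascFactorial_eq_prod_range] at h3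
  have h4 : (m + 1 + t - 1).choose t = (t+m).choose m := by
    rw [show m + 1 + t - 1 = t + m by omega, Nat.choose_symm_add]
  have h5 : ∏ k ∈ range m, ((t:ℚ) - ((0:ℤ):ℚ) + ((k:ℚ)+1)) = ((∏ k ∈ range m, (t + 1 + k) : ℕ) : ℚ) := by
    push_cast
    refine Finset.prod_congr rfl fun k _ => ?_
    ring
  rw [h4, h5, h3]
  have : (m.factorial : ℚ) ≠ 0 := by exact_mod_cast Nat.factorial_ne_zero m
  push_cast
  field_simp

instance homogZ_fin (K : Type) [Field K] (n : ℕ) (z : ℤ) : FiniteDimensional K (homogZ K n z) := by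
  by_cases hz : 0 ≤ z
  · have : homogZ K n z = homogeneousSubmodule (Fin n) K z.toNat := by
      unfold homogZ; rw [iSup_pos hz]
    rw [this]
    exact Module.Finite.iff_fg.2 (homogeneousSubmodule_fg _ _ _)
  · have : homogZ K n z = ⊥ := by
      unfold homogZ; rw [iSup_neg hz]
    rw [this]; infer_instance

lemma finrank_homogZ (K : Type) [Field K] (m : ℕ) (a z : ℤ) (hz : a ≤ z) :
    (finrank K (homogZ K (m+1) (z - a)) : ℚ) = (genHilb (m+1) a).eval (z:ℚ) := by
  have h : homogZ K (m+1) (z - a) = homogeneousSubmodule (Fin (m+1)) K (z-a).toNat := by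
      unfold homogZ; rw [iSup_pos (by omega)]
  rw [h, finrank_homog, genHilb_comp m a]
  simp only [Polynomial.eval_comp, Polynomial.eval_add, Polynomial.eval_X, Polynomial.eval_C]
  congr 1
  have : (((z - a).toNat : ℤ) : ℚ) = ((z - a : ℤ) : ℚ) := by rw [Int.toNat_of_nonneg (by omega)]
  rw [Int.cast_natCast] at this
  rw [this]; push_cast; ring

/-- freePiece as a product -/
def fpEquiv {K : Type} [Field K] {n r : ℕ} (dg : Fin r → ℤ) (ℓ : ℤ) :
    freePiece (K := K) (n := n) dg ℓ ≃ₗ[K] (∀ p, homogZ K n (ℓ - dg p)) where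
  toFun w p := ⟨w.1 p, w.2 p trivial⟩
  map_add' _ _ := rfl
  map_smul' _ _ := rfl
  invFun v := ⟨fun p => (v p).1, fun p _ => (v p).2⟩
  left_inv _ := rfl
  right_inv _ := rfl

instance fp_fin {K : Type} [Field K] {n r : ℕ} (dg : Fin r → ℤ) (ℓ : ℤ) :
    FiniteDimensional K (freePiece (K := K) (n := n) dg ℓ) :=
  Module.Finite.equiv (fpEquiv dg ℓ).symm

lemma finrank_fp {K : Type} [Field K] {m r : ℕ} (dg : Fin r → ℤ) (ℓ : ℤ) (h : ∀ p, dg p ≤ ℓ) :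
    (finrank K (freePiece (K := K) (n := m+1) dg ℓ) : ℚ) = ∑ p, (genHilb (m+1) (dg p)).eval (ℓ:ℚ) := by
  rw [(fpEquiv dg ℓ).finrank_eq, Module.finrank_pi_fintype]
  push_cast
  exact Finset.sum_congr rfl fun p _ => finrank_homogZ K m _ _ (h p)

lemma rank_null' {k V W : Type} [Field k] [AddCommGroup V] [AddCommGroup W] [Module k V] [Module k W]
    (f : V →ₗ[k] W) (U : Submodule k V) [FiniteDimensional k U] :
    finrank k (U.map f) + finrank k (U ⊓ LinearMap.ker f : Submodule k V) = finrank k U := by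
  have h := LinearMap.finrank_range_add_finrank_ker (f.domRestrict U)
  rw [LinearMap.range_domRestrict] at h
  rw [← h]
  congr 1
  rw [LinearMap.ker_domRestrict]
  have : (Submodule.comap U.subtype (LinearMap.ker f)).map U.subtype = U ⊓ LinearMap.ker f := by
    rw [Submodule.map_comap_subtype]
  rw [← this]
  exact (Submodule.equivMapOfInjective _ U.injective_subtype _).finrank_eq.symm

/-- homogeneous component of integer degree -/
def hcz {K : Type} [Field K] {n : ℕ} (z : ℤ) (f : PolyS K n) : PolyS K n :=
  if 0 ≤ z then homogeneousComponent z.toNat f else 0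

lemma hcz_mem {K : Type} [Field K] {n : ℕ} (z : ℤ) (f : PolyS K n) : hcz z f ∈ homogZ K n z := by
  unfold hcz
  split_ifs with h
  · rw [mem_homogZ_nonneg h]; exact homogeneousComponent_isHomogeneous _ _
  · exact zero_mem _

lemma hcz_self {K : Type} [Field K] {n : ℕ} (z : ℤ) (f : PolyS K n) (hf : f ∈ homogZ K n z) : hcz z f = f := by
  unfold hcz
  split_ifs with h
  · rw [mem_homogZ_nonneg h] at hf
    rw [homogeneousComponent_of_mem hf, if_pos rfl]
  · rw [mem_homogZ_neg h] at hf; exact hf.symm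

lemma hcz_sum {K : Type} [Field K] {n : ℕ} (z : ℤ) {ι : Type} (s : Finset ι) (f : ι → PolyS K n) :
    hcz z (∑ i ∈ s, f i) = ∑ i ∈ s, hcz z (f i) := by
  unfold hcz
  split_ifs <;> simp

lemma hcz_mul {K : Type} [Field K] {n : ℕ} (z a : ℤ) (f g : PolyS K n) (hf : f ∈ homogZ K n a) :
    hcz z (f * g) = f * hcz (z - a) g := by
  by_cases ha : 0 ≤ a
  swap
  · rw [mem_homogZ_neg ha] at hf
    rw [hf]; simp [hcz]
  have key : ∀ k : ℕ, hcz z (f * homogeneousComponent k g) = if z - a = k then f * homogeneousComponent k g else 0 := by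
    intro k
    have hm : (f * homogeneousComponent k g).IsHomogeneous (a.toNat + k) :=
      ((mem_homogZ_nonneg ha f).1 hf).mul (homogeneousComponent_isHomogeneous _ _)
    unfold hcz
    split_ifs with h1 h2 h2
    · rw [homogeneousComponent_of_mem hm, if_pos (by omega)]
    · rw [homogeneousComponent_of_mem hm, if_neg (by omega)]
    · omega
    · rfl
  conv_lhs => rw [← sum_homogeneousComponent g]
  rw [Finset.mul_sum, hcz_sum, Finset.sum_congr rfl (fun k _ => key k)]
  unfold hcz
  split_ifs with h
  · by_cases hlt : (z - a).toNat < g.totalDegree + 1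
    · rw [Finset.sum_eq_single (z-a).toNat, if_pos (by omega)]
      · intro k _ hk
        rw [if_neg (by omega)]
      · intro hh; simp at hh; omega
    · rw [homogeneousComponent_eq_zero _ _ (by omega), mul_zero]
      refine Finset.sum_eq_zero fun k hk => ?_
      simp at hk
      rw [if_neg (by omega)]
  · rw [mul_zero]
    exact Finset.sum_eq_zero fun k _ => by rw [if_neg (by omega)]

end BS

namespace BS

section
variable {K : Type} [Field K] {n : ℕ}

/-- differential, `K`-linear -/
def dK (F : FreeComplex K n) (i : ℕ) : (Fin (F.rk (i+1)) → PolyS K n) →ₗ[K] (Fin (F.rk i) → PolyS K n) :=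
  (F.dd i).mulVecLin.restrictScalars K

lemma dK_apply (F : FreeComplex K n) (i : ℕ) (w) : dK F i w = (F.dd i).mulVec w := rfl

lemma map_piece (F : FreeComplex K n) (ℓ : ℤ) (i : ℕ) :
    (freePiece (K := K) (n := n) (F.deg (i+1)) ℓ).map (dK F i) =
      freePiece (K := K) (n := n) (F.deg i) ℓ ⊓ LinearMap.range (dK F i) := by
  ext w
  constructor
  · rintro ⟨y, hy, rfl⟩
    refine ⟨?_, ⟨y, rfl⟩⟩
    intro p _
    rw [dK_apply]
    simp only [Matrix.mulVec, dotProduct]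
    refine Submodule.sum_mem _ fun q _ => ?_
    have h1 := mulP_hZ K n _ _ _ _ (F.isHomog i p q) (hy q trivial)
    rw [mem_hZ] at h1
    convert h1 using 2
    ring
  · rintro ⟨hw, y, rfl⟩
    refine ⟨fun q => hcz (ℓ - F.deg (i+1) q) (y q), fun q _ => hcz_mem _ _, ?_⟩
    funext p
    rw [dK_apply, dK_apply]
    have h1 := hcz_self _ _ (hw p trivial)
    rw [dK_apply] at h1
    rw [← h1]
    simp only [Matrix.mulVec, dotProduct]
    rw [hcz_sum]
    refine Finset.sum_congr rfl fun q _ => ?_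
    rw [hcz_mul _ _ _ _ (F.isHomog i p q)]
    congr 2
    ring

lemma ker_dK (F : FreeComplex K n) (hF : IsResolution F) (i : ℕ) :
    LinearMap.ker (dK F i) = LinearMap.range (dK F (i+1)) := by
  ext w
  have h := hF i
  have h2 : w ∈ LinearMap.ker ((F.dd i).mulVecLin) ↔ w ∈ LinearMap.range ((F.dd (i+1)).mulVecLin) := by rw [h]
  exact h2

/-- boundary ranks -/
def rr (F : FreeComplex K n) (ℓ : ℤ) (i : ℕ) : ℕ :=
  finrank K (freePiece (K := K) (n := n) (F.deg i) ℓ ⊓ LinearMap.range (dK F i) : Submodule K _)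

lemma rr_add (F : FreeComplex K n) (hF : IsResolution F) (ℓ : ℤ) (i : ℕ) :
    rr F ℓ i + rr F ℓ (i+1) = finrank K (freePiece (K := K) (n := n) (F.deg (i+1)) ℓ) := by
  rw [← rank_null' (dK F i), map_piece, ker_dK F hF]
  rfl

lemma rr_last (F : FreeComplex K n) (hF : IsResolution F) (ℓ : ℤ) : rr F ℓ F.len = 0 := by
  have h := rr_add F hF ℓ F.len
  have h0 := F.rk_eq_zero (F.len+1) (by omega)
  have : finrank K (freePiece (K := K) (n := n) (F.deg (F.len+1)) ℓ) = 0 := by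
    rw [(fpEquiv _ ℓ).finrank_eq, Module.finrank_pi_fintype]
    have : IsEmpty (Fin (F.rk (F.len+1))) := by rw [h0]; infer_instance
    simp
  omega

lemma euler (F : FreeComplex K n) (hF : IsResolution F) (ℓ : ℤ) (L : ℕ) :
    (finrank K (freePiece (K := K) (n := n) (F.deg 0) ℓ) : ℚ) - rr F ℓ 0 =
      ∑ i ∈ range (L+1), (-1:ℚ)^i * finrank K (freePiece (K := K) (n := n) (F.deg i) ℓ) - (-1)^L * rr F ℓ L := by
  induction L with
  | zero => simp
  | succ L ih =>
    rw [Finset.sum_range_succ, ih, ← rr_add F hF ℓ L]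
    push_cast
    ring

theorem coker_dim {m : ℕ} (F : FreeComplex K (m+1)) (hF : IsResolution F) :
    ∃ L0 : ℤ, ∀ ℓ, L0 ≤ ℓ →
      (finrank K ((freePiece (K := K) (n := m+1) (F.deg 0) ℓ).map (LinearMap.range (dK F 0)).mkQ) : ℚ) =
        (hilbPoly F).eval (ℓ:ℚ) := by
  obtain ⟨B, hB⟩ : ∃ B : ℤ, ∀ x : (Σ i : Fin (F.len+1), Fin (F.rk i)), F.deg x.1 x.2 ≤ B := by
    obtain ⟨B, hB⟩ := (Set.finite_range fun x : (Σ i : Fin (F.len+1), Fin (F.rk i)) => F.deg x.1 x.2).bddAbove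
    exact ⟨B, fun x => hB ⟨x, rfl⟩⟩
  refine ⟨B, fun ℓ hℓ => ?_⟩
  have h1 := rank_null' (LinearMap.range (dK F 0)).mkQ (freePiece (K := K) (n := m+1) (F.deg 0) ℓ)
  rw [Submodule.ker_mkQ] at h1
  have h2 : (finrank K ((freePiece (K := K) (n := m+1) (F.deg 0) ℓ).map (LinearMap.range (dK F 0)).mkQ) : ℚ)
      = (finrank K (freePiece (K := K) (n := m+1) (F.deg 0) ℓ) : ℚ) - rr F ℓ 0 := by
    rw [eq_sub_iff_add_eq]
    unfold rr
    exact_mod_cast h1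
  rw [h2, euler F hF ℓ F.len, rr_last F hF]
  unfold hilbPoly
  simp only [Nat.cast_zero, mul_zero, sub_zero, Polynomial.eval_finset_sum, Polynomial.eval_mul, Polynomial.eval_C]
  refine Finset.sum_congr rfl fun i hi => ?_
  rw [finrank_fp]
  intro p
  exact (hB ⟨⟨i, by simpa using hi⟩, p⟩).trans hℓ

lemma lift_basis {V W : Type} [AddCommGroup V] [AddCommGroup W] [Module K V] [Module K W]
    [FiniteDimensional K V] [FiniteDimensional K W] (Θ : V →ₗ[K] W) :
    ∃ (N : ℕ) (B : Fin N → V), N ≤ finrank K W ∧ ∀ f, ∃ a : Fin N → K, Θ (f - ∑ i, a i • B i) = 0 := by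
  let b := Module.finBasis K (LinearMap.range Θ)
  choose B hB using fun i => (b i).2
  refine ⟨finrank K (LinearMap.range Θ), B, Submodule.finrank_le _, fun f => ?_⟩
  refine ⟨fun i => b.repr ⟨Θ f, ⟨f, rfl⟩⟩ i, ?_⟩
  have h1 := b.sum_repr ⟨Θ f, ⟨f, rfl⟩⟩
  have h2 := congrArg Subtype.val h1
  rw [AddSubmonoidClass.coe_finset_sum] at h2
  rw [map_sub, map_sum, sub_eq_zero]
  simp only [map_smul, hB]
  exact h2.symm

theorem annI_growth {m : ℕ} (F : FreeComplex K (m+1)) (hF : IsResolution F) :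
    ∃ t0 : ℕ, ∀ t : ℕ, t0 ≤ t → ∃ (N : ℕ) (B : Fin N → PolyS K (m+1)),
      (N : ℚ) ≤ ∑ p, (hilbPoly F).eval ((t:ℚ) + F.deg 0 p) ∧
      ∀ f : PolyS K (m+1), f.IsHomogeneous t → ∃ a : Fin N → K, f - ∑ i, C (a i) * B i ∈ annI F := by
  obtain ⟨L0, hL0⟩ := coker_dim F hF
  obtain ⟨b, hb⟩ : ∃ b : ℤ, ∀ p, b ≤ F.deg 0 p := by
    obtain ⟨B, hB⟩ := (Set.finite_range fun p => F.deg 0 p).bddBelow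
    exact ⟨B, fun x => hB ⟨x, rfl⟩⟩
  refine ⟨(L0 - b).toNat, fun t ht => ?_⟩
  set V := homogeneousSubmodule (Fin (m+1)) K t
  have hfin : FiniteDimensional K V := Module.Finite.iff_fg.2 (homogeneousSubmodule_fg _ _ _)
  set Np := fun p => (freePiece (K := K) (n := m+1) (F.deg 0) (t + F.deg 0 p)).map (LinearMap.range (dK F 0)).mkQ
    with hNp
  have hNfin : ∀ p, FiniteDimensional K (Np p) := fun p => by
    change FiniteDimensional K ((freePiece (K := K) (n := m+1) (F.deg 0) (t + F.deg 0 p)).map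
      (LinearMap.range (dK F 0)).mkQ : Submodule K _)
    infer_instance
  have hmem : ∀ p, ∀ f : V, (Pi.single p f.1 : Fin (F.rk 0) → PolyS K (m+1)) ∈
      freePiece (K := K) (n := m+1) (F.deg 0) (t + F.deg 0 p) := by
    intro p f q _
    change _ ∈ homogZ K (m+1) (t + F.deg 0 p - F.deg 0 q)
    by_cases h : q = p
    · subst h
      rw [Pi.single_eq_same, mem_homogZ_nonneg (by omega)]
      have := f.2
      rw [mem_homogeneousSubmodule] at this
      simpa using this
    · rw [Pi.single_eq_of_ne h]; exact zero_mem _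
  let Θ : V →ₗ[K] (∀ p, Np p) := LinearMap.pi fun p =>
    LinearMap.codRestrict (Np p) ((LinearMap.range (dK F 0)).mkQ ∘ₗ
      (LinearMap.single K (fun _ => PolyS K (m+1)) p) ∘ₗ V.subtype)
      (fun f => ⟨_, hmem p f, rfl⟩)
  have hker : ∀ f : V, Θ f = 0 → f.1 ∈ annI F := by
    intro f hf
    rw [mem_annI]
    have h1 : ∀ p, ∃ y, (F.dd 0).mulVec y = Pi.single p f.1 := by
      intro p
      have h2 := congrArg Subtype.val (congrFun hf p)
      have h3 : (LinearMap.range (dK F 0)).mkQ (Pi.single p f.1) = 0 := h2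
      rw [Submodule.mkQ_apply, Submodule.Quotient.mk_eq_zero] at h3
      obtain ⟨y, hy⟩ := h3
      exact ⟨y, hy⟩
    choose y hy using h1
    intro w
    refine ⟨∑ p, w p • y p, ?_⟩
    rw [Matrix.mulVec_sum]
    simp only [Matrix.mulVec_smul, hy]
    funext q
    rw [Finset.sum_apply, Finset.sum_eq_single q]
    · simp [mul_comm]
    · intro p _ hp
      simp [Pi.single_eq_of_ne (Ne.symm hp)]
    · simp
  obtain ⟨N, B, hN, hB⟩ := lift_basis Θ
  refine ⟨N, fun i => (B i).1, ?_, ?_⟩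
  · have h1 : N ≤ ∑ p, finrank K (Np p) := by
      rw [← Module.finrank_pi_fintype]
      exact hN
    have h2 : ∀ p, (finrank K (Np p) : ℚ) = (hilbPoly F).eval ((t:ℚ) + F.deg 0 p) := by
      intro p
      have := hL0 (t + F.deg 0 p) (by have := hb p; omega)
      have h3 : (finrank K (Np p) : ℚ) = (hilbPoly F).eval ((((t:ℤ) + F.deg 0 p : ℤ)) : ℚ) := this
      rw [h3]; push_cast; rfl
    rw [← Finset.sum_congr rfl (fun p _ => h2 p)]
    exact_mod_cast h1
  · intro f hf
    obtain ⟨a, ha⟩ := hB ⟨f, hf⟩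
    refine ⟨a, ?_⟩
    have h3 := hker _ ha
    have h4 : ((⟨f, hf⟩ : V) - ∑ i, a i • B i : V).1 = f - ∑ i, C (a i) * (B i).1 := by
      simp [MvPolynomial.C_mul']
    rw [h4] at h3
    exact h3

end
end BS

namespace BS

lemma genHilb_lc (m : ℕ) : 0 < (genHilb (m+1) 0).leadingCoeff := by
  have e : genHilb (m+1) 0 = Polynomial.C ((m.factorial : ℚ))⁻¹ *
      ∏ k ∈ Finset.range m, (Polynomial.X + Polynomial.C ((k : ℚ) + 1)) := by
    unfold genHilb; simp
  have hm : (∏ k ∈ Finset.range m, (Polynomial.X + Polynomial.C ((k : ℚ) + 1))).Monic :=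
    Polynomial.monic_prod_of_monic _ _ fun k _ => Polynomial.monic_X_add_C _
  rw [e, Polynomial.leadingCoeff_mul, hm.leadingCoeff, Polynomial.leadingCoeff_C]
  positivity

/-- growth comparison -/
lemma growth_contra (k : ℕ) (H : Polynomial ℚ) (hH : polyDim H < k + 1) {r : ℕ} (dg : Fin r → ℤ) (t0 : ℕ) :
    ∃ t : ℕ, t0 ≤ t ∧ ∑ p, H.eval ((t:ℚ) + dg p) < (genHilb (k+1) 0).eval (t:ℚ) := by
  set P := genHilb (k+1) 0
  set Q := ∑ p, H.comp (Polynomial.X + Polynomial.C (dg p : ℚ))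
  have hP0 : P ≠ 0 := (genHilb_zero k).1
  have hPd : P.degree = (k:ℕ) := by
    rw [Polynomial.degree_eq_natDegree hP0]
    have : P.natDegree + 1 = k + 1 := (genHilb_zero k).2
    exact_mod_cast (by omega : P.natDegree = k)
  have hQ : Q.degree < P.degree := by
    rw [hPd, ← Polynomial.mem_degreeLT]
    refine Submodule.sum_mem _ fun p _ => ?_
    rw [Polynomial.mem_degreeLT]
    by_cases h0 : H = 0
    · simp only [h0, Polynomial.zero_comp, Polynomial.degree_zero]
      exact WithBot.bot_lt_coe _
    · unfold polyDim at hH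
      rw [if_neg h0] at hH
      refine lt_of_le_of_lt Polynomial.degree_le_natDegree ?_
      rw [Polynomial.natDegree_comp, Polynomial.natDegree_X_add_C, mul_one]
      exact_mod_cast (by omega)
  have hd : (P - Q).degree = P.degree := Polynomial.degree_sub_eq_left_of_degree_lt hQ
  have hl : (P - Q).leadingCoeff = P.leadingCoeff := Polynomial.leadingCoeff_sub_of_degree_lt hQ
  have ht := Polynomial.tendsto_atTop_of_leadingCoeff_nonneg (Polynomial.X * (P - Q))
    (by rw [Polynomial.degree_mul, hd, hPd, Polynomial.degree_X]; exact_mod_cast (by omega))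
    (by rw [Polynomial.leadingCoeff_mul, hl, Polynomial.leadingCoeff_X, one_mul]; exact (genHilb_lc k).le)
  have h1 := (ht.comp (tendsto_natCast_atTop_atTop (R := ℚ))).eventually (Filter.eventually_gt_atTop 0)
  obtain ⟨t, ht1, ht2⟩ := (h1.and (Filter.eventually_ge_atTop t0)).exists
  refine ⟨t, ht2, ?_⟩
  simp only [Function.comp, Polynomial.eval_mul, Polynomial.eval_X, Polynomial.eval_sub] at ht1
  have h2 : (0:ℚ) ≤ t := Nat.cast_nonneg t
  have h3 : 0 < P.eval (t:ℚ) - Q.eval (t:ℚ) := pos_of_mul_pos_right ht1 h2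
  have h4 : Q.eval (t:ℚ) = ∑ p, H.eval ((t:ℚ) + dg p) := by
    simp [Q, Polynomial.eval_finset_sum]
  linarith

section
variable {L : Type} [Field L]

/-- linear form -/
def lf {n : ℕ} (u : Fin n → L) : MvPolynomial (Fin n) L := ∑ m, C (u m) * X m

lemma lf_homog {n : ℕ} (u : Fin n → L) : (lf u).IsHomogeneous 1 := by
  refine IsHomogeneous.sum _ _ _ fun m _ => ?_
  simpa using (isHomogeneous_C (Fin n) (u m)).mul (isHomogeneous_X L m)

lemma lf_sub_smul {n : ℕ} (u w : Fin n → L) (a : L) : lf (u - a • w) = lf u - C a * lf w := by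
  unfold lf
  rw [Finset.mul_sum, ← Finset.sum_sub_distrib]
  refine Finset.sum_congr rfl fun m _ => ?_
  simp [sub_mul, mul_assoc]

lemma homog_scale {k t : ℕ} {B : Type} [CommRing B] [Algebra L B] (f : MvPolynomial (Fin k) L)
    (hf : f.IsHomogeneous t) (a : Fin k → L) (z : B) :
    aeval (fun i => algebraMap L B (a i) * z) f = z ^ t * algebraMap L B (eval a f) := by
  rw [aeval_def, eval₂_eq', eval_eq', map_sum, Finset.mul_sum]
  refine Finset.sum_congr rfl fun d hd => ?_
  have hdeg : ∑ i, d i = t := by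
    have := hf (mem_support_iff.1 hd)
    rw [← this, Finsupp.weight_apply, Finsupp.sum_fintype] <;> simp
  rw [map_mul, map_prod]
  simp only [mul_pow, Finset.prod_mul_distrib, map_pow]
  rw [Finset.prod_pow_eq_pow_sum, hdeg]
  ring

lemma dep {n k t N : ℕ} (I : Ideal (MvPolynomial (Fin n) L)) (B : Fin N → MvPolynomial (Fin n) L)
    (hB : ∀ g : MvPolynomial (Fin n) L, g.IsHomogeneous t → ∃ a : Fin N → L, g - ∑ i, C (a i) * B i ∈ I)
    (l : Fin k → MvPolynomial (Fin n) L) (hl : ∀ i, (l i).IsHomogeneous 1)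
    (hN : N < finrank L (homogeneousSubmodule (Fin k) L t)) :
    ∃ f : MvPolynomial (Fin k) L, f ≠ 0 ∧ f.IsHomogeneous t ∧ aeval l f ∈ I := by
  set π := Ideal.Quotient.mkₐ L I
  set W := Submodule.span L (Set.range fun i => π (B i))
  have hfin : FiniteDimensional L (homogeneousSubmodule (Fin k) L t) :=
    Module.Finite.iff_fg.2 (homogeneousSubmodule_fg _ _ _)
  have hW : FiniteDimensional L W := FiniteDimensional.span_of_finite L (Set.finite_range _)
  have hWN : finrank L W ≤ N := by
    have := finrank_range_le_card (R := L) (fun i => π (B i))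
    rw [Fintype.card_fin] at this; exact this
  have hmem : ∀ f : homogeneousSubmodule (Fin k) L t, π (aeval l f.1) ∈ W := by
    intro f
    have h1 : (aeval l f.1).IsHomogeneous t := by
      simpa using (show f.1.IsHomogeneous t from f.2).aeval l hl
    obtain ⟨a, ha⟩ := hB _ h1
    have h2 : π (aeval l f.1) = π (∑ i, C (a i) * B i) := Ideal.Quotient.eq.2 ha
    rw [h2, map_sum]
    refine Submodule.sum_mem _ fun i _ => ?_
    rw [← MvPolynomial.smul_eq_C_mul, map_smul]
    exact Submodule.smul_mem _ _ (Submodule.subset_span ⟨i, rfl⟩)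
  let θ : homogeneousSubmodule (Fin k) L t →ₗ[L] W :=
    LinearMap.codRestrict W (π.toLinearMap ∘ₗ (aeval l).toLinearMap ∘ₗ Submodule.subtype _) hmem
  have hni : ¬ Function.Injective θ := by
    intro hi
    have := LinearMap.finrank_le_finrank_of_injective hi
    omega
  have : LinearMap.ker θ ≠ ⊥ := fun h => hni (LinearMap.ker_eq_bot.1 h)
  obtain ⟨f, hf, hf0⟩ := Submodule.exists_mem_ne_zero_of_ne_bot this
  refine ⟨f.1, fun h => hf0 (Subtype.ext h), f.2, ?_⟩
  have h3 : π (aeval l f.1) = 0 := congrArg Subtype.val (LinearMap.mem_ker.1 hf)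
  exact Ideal.Quotient.eq_zero_iff_mem.1 h3

lemma descent [Infinite L] {n k t : ℕ} (ht : 1 ≤ t) (I : Ideal (MvPolynomial (Fin n) L)) (Lm : Fin (k+1) → Fin n → L)
    (hL : ∀ i, (X i : MvPolynomial (Fin n) L) ∈ (I ⊔ Ideal.span (Set.range fun r => lf (Lm r))).radical)
    (f : MvPolynomial (Fin (k+1)) L) (hf0 : f ≠ 0) (hf : f.IsHomogeneous t)
    (hfI : aeval (fun r => lf (Lm r)) f ∈ I) :
    ∃ Lm' : Fin k → Fin n → L,
      ∀ i, (X i : MvPolynomial (Fin n) L) ∈ (I ⊔ Ideal.span (Set.range fun r => lf (Lm' r))).radical := by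
  obtain ⟨a, ha⟩ : ∃ a, eval a f ≠ 0 := by
    by_contra h; push Not at h
    exact hf0 (MvPolynomial.funext fun x => by rw [h x, map_zero])
  obtain ⟨m0, hm0⟩ : ∃ m0, a m0 ≠ 0 := by
    by_contra h; push Not at h
    have h1 := homog_scale (B := L) f hf 1 0
    have h2 : a = fun i => algebraMap L L ((1 : Fin (k+1) → L) i) * 0 := by
      funext i; simp [h i]
    rw [← h2, zero_pow (by omega), zero_mul] at h1
    apply ha
    rw [← h1, ← coe_aeval_eq_eval]
    rfl
  refine ⟨fun r => Lm (m0.succAbove r) - (a (m0.succAbove r) / a m0) • Lm m0, fun i => ?_⟩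
  set J' := I ⊔ Ideal.span (Set.range fun r => lf (Lm (m0.succAbove r) - (a (m0.succAbove r) / a m0) • Lm m0))
    with hJ'
  have hcong : ∀ i, lf (Lm i) - C (a i / a m0) * lf (Lm m0) ∈ J' := by
    intro i
    by_cases h : i = m0
    · rw [h, div_self hm0]; simp
    · obtain ⟨r, rfl⟩ := Fin.exists_succAbove_eq h
      rw [← lf_sub_smul]
      exact Ideal.mem_sup_right (Ideal.subset_span ⟨r, rfl⟩)
  have hz : lf (Lm m0) ∈ J'.radical := by
    set π := Ideal.Quotient.mkₐ L J'
    have h1 : π (aeval (fun r => lf (Lm r)) f) = 0 :=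
      Ideal.Quotient.eq_zero_iff_mem.2 (Ideal.mem_sup_left hfI)
    have h2 : ∀ i, π (lf (Lm i)) = algebraMap L _ (a i) * π (C (a m0)⁻¹ * lf (Lm m0)) := by
      intro i
      have : π (lf (Lm i)) = π (C (a i / a m0) * lf (Lm m0)) := Ideal.Quotient.eq.2 (hcong i)
      rw [this, ← AlgHom.commutes π, ← map_mul, MvPolynomial.algebraMap_eq, ← mul_assoc, ← C_mul, div_eq_mul_inv]
    rw [comp_aeval_apply] at h1
    simp only [h2] at h1
    rw [homog_scale f hf, ← AlgHom.commutes π, ← map_pow, ← map_mul] at h1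
    have h3 := Ideal.Quotient.eq_zero_iff_mem.1 h1
    rw [Ideal.mem_radical_iff]
    refine ⟨t, ?_⟩
    have h4 := Ideal.mul_mem_left J' (C ((a m0) ^ t * (eval a f)⁻¹)) h3
    have h5 : C ((a m0) ^ t * (eval a f)⁻¹) * ((C (a m0)⁻¹ * lf (Lm m0)) ^ t * algebraMap L _ (eval a f))
        = lf (Lm m0) ^ t := by
      rw [MvPolynomial.algebraMap_eq, mul_pow, ← C_pow]
      have : (a m0 ^ t * (eval a f)⁻¹) * ((a m0)⁻¹ ^ t) * eval a f = 1 := by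
        rw [inv_pow]; field_simp
      calc _ = C ((a m0 ^ t * (eval a f)⁻¹) * ((a m0)⁻¹ ^ t) * eval a f) * lf (Lm m0) ^ t := by
            simp only [C_mul]; ring
        _ = _ := by rw [this]; simp
    rw [h5] at h4
    exact h4
  have hall : ∀ i, lf (Lm i) ∈ J'.radical := by
    intro i
    have := Ideal.add_mem _ (Ideal.le_radical (hcong i)) (Ideal.mul_mem_left _ (C (a i / a m0)) hz)
    simpa using this
  have hle : I ⊔ Ideal.span (Set.range fun r => lf (Lm r)) ≤ J'.radical := by
    refine sup_le (le_sup_left.trans Ideal.le_radical) ?_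
    rw [Ideal.span_le]
    rintro _ ⟨r, rfl⟩
    exact hall r
  exact (Ideal.radical_le_radical_iff.2 hle) (hL i)

end
end BS

namespace BS

lemma base_change {K K' : Type} [Field K] [Field K'] (j : K →+* K') {n t N : ℕ} (I : Ideal (PolyS K n))
    (B : Fin N → PolyS K n)
    (hB : ∀ f : PolyS K n, f.IsHomogeneous t → ∃ a : Fin N → K, f - ∑ i, C (a i) * B i ∈ I) :
    ∀ g : MvPolynomial (Fin n) K', g.IsHomogeneous t → ∃ a : Fin N → K',
      g - ∑ i, C (a i) * MvPolynomial.map j (B i) ∈ I.map (MvPolynomial.map j) := by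
  intro g hg
  have h1 : ∀ d : Fin n →₀ ℕ, ∃ a : Fin N → K, d ∈ g.support → monomial d (1:K) - ∑ i, C (a i) * B i ∈ I := by
    intro d
    by_cases hd : d ∈ g.support
    · have : (monomial d (1:K)).IsHomogeneous t := by
        apply isHomogeneous_monomial
        have := hg (mem_support_iff.1 hd)
        rw [← this, Finsupp.weight_apply, Finsupp.degree_apply, Finsupp.sum]
        simp
      obtain ⟨a, ha⟩ := hB _ this
      exact ⟨a, fun _ => ha⟩
    · exact ⟨0, fun h => absurd h hd⟩
  choose a ha using h1
  refine ⟨fun i => ∑ d ∈ g.support, coeff d g * j (a d i), ?_⟩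
  have h2 : g - ∑ i, C (∑ d ∈ g.support, coeff d g * j (a d i)) * MvPolynomial.map j (B i)
      = ∑ d ∈ g.support, C (coeff d g) * MvPolynomial.map j (monomial d (1:K) - ∑ i, C (a d i) * B i) := by
    have e1 : g = ∑ d ∈ g.support, C (coeff d g) * MvPolynomial.map j (monomial d (1:K)) := by
      conv_lhs => rw [g.as_sum]
      refine Finset.sum_congr rfl fun d _ => ?_
      rw [map_monomial, map_one, C_mul_monomial, mul_one]
    have e2 : ∑ i, C (∑ d ∈ g.support, coeff d g * j (a d i)) * MvPolynomial.map j (B i)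
        = ∑ d ∈ g.support, C (coeff d g) * MvPolynomial.map j (∑ i, C (a d i) * B i) := by
      simp only [map_sum, Finset.sum_mul, map_mul, map_C, Finset.mul_sum]
      rw [Finset.sum_comm]
      refine Finset.sum_congr rfl fun d _ => Finset.sum_congr rfl fun i _ => ?_
      ring
    rw [e2]
    simp only [map_sub, mul_sub, Finset.sum_sub_distrib]
    rw [← e1]
  rw [h2]
  exact Ideal.sum_mem _ fun d hd => Ideal.mul_mem_left _ _ (Ideal.mem_map_of_mem _ (ha d hd))

lemma lf_single {L : Type} [Field L] {n : ℕ} (i : Fin n) : lf (Pi.single i (1:L)) = X i := by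
  unfold lf
  rw [Finset.sum_eq_single i]
  · simp
  · intro b _ hb; simp [Pi.single_eq_of_ne hb]
  · simp

lemma cut {K K' : Type} [Field K] [Field K'] [Infinite K'] (j : K →+* K') {m : ℕ} (F : FreeComplex K (m+1))
    (hF : IsResolution F) (c : ℕ) (hc : c ≤ m+1) (hd : polyDim (hilbPoly F) = m + 1 - c) (d : ℕ) (hdc : d ≤ c) :
    ∃ Lm : Fin (m+1-d) → Fin (m+1) → K', ∀ i, (X i : MvPolynomial (Fin (m+1)) K') ∈
      ((annI F).map (MvPolynomial.map j) ⊔ Ideal.span (Set.range fun r => lf (Lm r))).radical := by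
  induction d with
  | zero =>
    refine ⟨fun r => Pi.single r 1, fun i => Ideal.le_radical (Ideal.mem_sup_right (Ideal.subset_span ⟨i, ?_⟩))⟩
    exact lf_single i
  | succ d ih =>
    obtain ⟨k, hk⟩ : ∃ k, m + 1 - d = k + 1 := ⟨m - d, by omega⟩
    have hk' : m + 1 - (d+1) = k := by omega
    have ih := ih (by omega)
    rw [hk] at ih
    rw [hk']
    obtain ⟨Lm, hLm⟩ := ih
    obtain ⟨t0, ht0⟩ := annI_growth F hF
    obtain ⟨t, ht, hlt⟩ := growth_contra k (hilbPoly F) (by omega) (F.deg 0) (max t0 1)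
    obtain ⟨N, B, hN, hB⟩ := ht0 t (le_of_max_le_left ht)
    have hN' : N < finrank K' (homogeneousSubmodule (Fin (k+1)) K' t) := by
      have := finrank_homog K' k t
      rw [← this] at hlt
      exact_mod_cast lt_of_le_of_lt hN hlt
    obtain ⟨f, hf0, hf, hfI⟩ := dep _ _ (base_change j _ B hB) (fun r => lf (Lm r)) (fun r => lf_homog _) hN'
    exact descent (le_of_max_le_right ht) _ Lm hLm f hf0 hf hfI

lemma ker_vecs {L : Type} [Field L] {n c : ℕ} (hc : c ≤ n) (Lm : Fin (n-c) → Fin n → L) :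
    ∃ v : Fin c → Fin n → L, LinearIndependent L v ∧ ∀ k r, ∑ i, Lm r i * v k i = 0 := by
  set T := (Matrix.of Lm).mulVecLin
  have h1 := LinearMap.finrank_range_add_finrank_ker T
  have h2 : finrank L (LinearMap.range T) ≤ n - c := by
    have := Submodule.finrank_le (LinearMap.range T)
    simpa using this
  rw [Module.finrank_fin_fun] at h1
  have h3 : c ≤ finrank L (LinearMap.ker T) := by omega
  let b := Module.finBasis L (LinearMap.ker T)
  refine ⟨fun k => (b (Fin.castLE h3 k)).1, ?_, fun k r => ?_⟩
  · have := b.linearIndependent.comp (Fin.castLE h3) (Fin.castLE_injective h3)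
    exact this.map' (Submodule.subtype _) (Submodule.ker_subtype _)
  · have := (b (Fin.castLE h3 k)).2
    exact congrFun (LinearMap.mem_ker.1 this) r

lemma left_inv {L : Type} [Field L] {n c : ℕ} (v : Fin c → Fin n → L) (hv : LinearIndependent L v) :
    ∃ w : Fin c → Fin n → L, ∀ k l, ∑ i, w k i * v l i = if l = k then 1 else 0 := by
  obtain ⟨g, hg⟩ := LinearMap.exists_leftInverse_of_injective (Fintype.linearCombination L v)
    (LinearMap.ker_eq_bot.2 (hv.fintypeLinearCombination_injective))
  refine ⟨fun k i => g (Pi.single i 1) k, fun k l => ?_⟩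
  have h1 : g (v l) = Pi.single l 1 := by
    have := LinearMap.congr_fun hg (Pi.single l 1)
    simpa [Fintype.linearCombination_apply_single] using this
  have h2 : g (v l) = ∑ i, v l i • g (Pi.single i 1) := by
    conv_lhs => rw [pi_eq_sum_univ' (v l)]
    simp
  have h3 := congrFun (h2.symm.trans h1) k
  simp only [Finset.sum_apply, Pi.smul_apply, smul_eq_mul] at h3
  calc _ = ∑ i, v l i * g (Pi.single i 1) k := Finset.sum_congr rfl fun i _ => mul_comm _ _
    _ = _ := by rw [h3, Pi.single_apply]; simp [eq_comm]

theorem noether {K : Type} [Field K] {m c : ℕ} (F : FreeComplex K (m+1))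
    (hF : IsResolution F) (hc : c ≤ m+1) (hd : polyDim (hilbPoly F) = m + 1 - c) :
    ∃ (K' : Type) (_ : Field K') (j : K →+* K') (v : Fin c → Fin (m+1) → K'),
      ∀ k, (X k : MvPolynomial (Fin c) K') ∈ ((annI F).map (phi0 j v)).radical := by
  let K' := AlgebraicClosure K
  haveI : Infinite K' := IsAlgClosed.instInfinite
  let j : K →+* K' := algebraMap K K'
  obtain ⟨Lm, hLm⟩ := cut j F hF c hc hd c le_rfl
  obtain ⟨v, hvi, hv0⟩ := ker_vecs hc Lm
  obtain ⟨w, hw⟩ := left_inv v hvi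
  refine ⟨K', inferInstance, j, v, ?_⟩
  let φ : MvPolynomial (Fin (m+1)) K' →+* MvPolynomial (Fin c) K' :=
    eval₂Hom C (fun i => ∑ k, C (v k i) * X k)
  have hφ : phi0 j v = φ.comp (MvPolynomial.map j) := by
    apply MvPolynomial.ringHom_ext
    · intro r; simp [phi0, φ]
    · intro i; simp [phi0, φ]
  have hφX : ∀ i, φ (X i) = ∑ k, C (v k i) * X k := fun i => by simp [φ]
  have hφC : ∀ a, φ (C a) = C a := fun i => by simp [φ]
  have hφL : ∀ r, φ (lf (Lm r)) = 0 := by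
    intro r
    unfold lf
    simp only [map_sum, map_mul, hφX, hφC, Finset.mul_sum]
    rw [Finset.sum_comm]
    refine Finset.sum_eq_zero fun k _ => ?_
    have := congrArg (fun a => (C a : MvPolynomial (Fin c) K') * X k) (hv0 k r)
    simp only [map_sum, map_mul, Finset.sum_mul, map_zero, zero_mul] at this
    rw [← this]
    exact Finset.sum_congr rfl fun i _ => by ring
  have hXi : ∀ i, φ (X i) ∈ ((annI F).map (phi0 j v)).radical := by
    intro i
    rw [hφ, ← Ideal.map_map]
    obtain ⟨N, hN⟩ := Ideal.mem_radical_iff.1 (hLm i)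
    refine Ideal.mem_radical_iff.2 ⟨N, ?_⟩
    rw [← map_pow]
    have := Ideal.mem_map_of_mem φ hN
    rw [Ideal.map_sup, Ideal.map_span] at this
    have h0 : Ideal.span (φ '' Set.range fun r => lf (Lm r)) ≤ ⊥ := by
      rw [Ideal.span_le]
      rintro _ ⟨_, ⟨r, rfl⟩, rfl⟩
      exact hφL r
    exact (sup_le le_rfl (h0.trans bot_le)) this
  intro k
  have : (X k : MvPolynomial (Fin c) K') = ∑ i, C (w k i) * φ (X i) := by
    simp only [hφX, Finset.mul_sum]
    rw [Finset.sum_comm]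
    have : ∀ l, ∑ i, C (w k i) * (C (v l i) * (X l : MvPolynomial (Fin c) K')) = if l = k then X l else 0 := by
      intro l
      have h := congrArg (fun a => (C a : MvPolynomial (Fin c) K') * X l) (hw k l)
      simp only [map_sum, map_mul, Finset.sum_mul] at h
      simp only [← mul_assoc]
      rw [h]
      split_ifs <;> simp
    simp [this]
  rw [this]
  exact Ideal.sum_mem _ fun i _ => Ideal.mul_mem_left _ _ (hXi i)

end BS

namespace BS

lemma entry_const {K : Type} [Field K] {n : ℕ} (F : FreeComplex K n) (hmin : IsMinimal F) (i p q) :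
    constantCoeff (F.dd i p q) = 0 := by
  by_cases h : F.deg (i+1) q = F.deg i p
  · rw [hmin i p q h, map_zero]
  · have h1 := F.isHomog i p q
    by_cases hz : 0 ≤ F.deg (i+1) q - F.deg i p
    · rw [mem_homogZ_nonneg hz] at h1
      rw [constantCoeff_eq]
      refine h1.coeff_eq_zero ?_
      simp only [map_zero]
      omega
    · rw [mem_homogZ_neg hz] at h1
      rw [h1, map_zero]

lemma cod_le {K : Type} [Field K] {n c : ℕ} (F : FreeComplex K n) (hF : IsResolution F)
    (hmin : IsMinimal F) (hrk : ∀ i, c < i → F.rk i = 0) (hc0 : F.rk c ≠ 0) : c ≤ n := by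
  classical
  have key := syzygy_bound K n (DMx c F.dd) (DMx_sq hrk F.dd F.isComplex) (fun x => ((x.1:ℕ):ℤ))
    (fun x y hxy => by have := DMx_ne F.dd hxy; omega) 0
    (fun x y => by
      obtain ⟨⟨i, hi⟩, p⟩ := x
      obtain ⟨⟨k, hk⟩, q⟩ := y
      simp only [DMx, Matrix.of_apply]
      split_ifs with hh
      · exact entry_const F hmin _ _ _
      · simp)
    (fun w hw hD => by
      obtain ⟨g, rfl⟩ := exists_fam w
      have h0 := DMx_zero hrk F.dd g hD
      have h1 : ∀ k, ∃ y, (F.dd (k+1)).mulVec y = g (k+1) := by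
        intro k
        have : g (k+1) ∈ LinearMap.ker ((F.dd k).mulVecLin) := h0 k
        rw [hF k] at this
        exact this
      choose y hy using h1
      let Y : ∀ k, Fin (F.rk k) → PolyS K n := fun k =>
        match k with
        | 0 => 0
        | 1 => 0
        | (k+2) => y k
      refine ⟨fun x => Y x.1 x.2, ?_⟩
      rw [DMx_mulVec hrk]
      funext x
      obtain ⟨⟨i, hi⟩, p⟩ := x
      rcases i with _ | i
      · have : g 0 p = 0 := hw ⟨⟨0, hi⟩, p⟩ (by simp)
        change (F.dd 0).mulVec 0 p = g 0 p
        rw [this, Matrix.mulVec_zero]; rfl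
      · change (F.dd (i+1)).mulVec (y i) p = g (i+1) p
        rw [hy])
    ⟨⟨c, by omega⟩, ⟨0, Nat.pos_of_ne_zero hc0⟩⟩
  simp only at key
  omega

lemma gam_HK {K : Type} [Field K] {n c : ℕ} (F : FreeComplex K n) (hc : c ≤ n)
    (hrk : ∀ i, c < i → F.rk i = 0) (hd : polyDim (hilbPoly F) = n - c) : HK (gam F c) := by
  intro f hf
  have h := HK_of_CM hc F hd f hf
  rw [mom_apply] at h
  rw [Phi_gam, Fintype.sum_sigma, ← h]
  let T : ℕ → ℚ := fun i => (-1:ℚ)^i * ∑ p : Fin (F.rk i), f.eval (F.deg i p : ℚ)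
  have hT : ∀ i, F.rk i = 0 → T i = 0 := by
    intro i hi
    have : IsEmpty (Fin (F.rk i)) := by rw [hi]; infer_instance
    simp [T]
  have e1 : ∑ i ∈ range (F.len+1), T i = ∑ i ∈ range (F.len + 1 + (c+1)), T i :=
    Finset.sum_subset (range_mono (by omega)) fun i _ hi => hT i (F.rk_eq_zero i (by simp at hi; omega))
  have e2 : ∑ i ∈ range (c+1), T i = ∑ i ∈ range (F.len + 1 + (c+1)), T i :=
    Finset.sum_subset (range_mono (by omega)) fun i _ hi => hT i (hrk i (by simp at hi; omega))
  refine Eq.trans ?_ (e2.trans e1.symm)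
  rw [Finset.sum_range]
  refine Finset.sum_congr rfl fun i _ => ?_
  simp only [T, Finset.mul_sum]

lemma betti_big {K : Type} [Field K] {n c : ℕ} (F : FreeComplex K n) 
    (hrk : ∀ i, c < i → F.rk i = 0) (i : ℕ) (hi : ¬ i < c + 1) (j : ℤ) : bettiNum F i j = 0 := by
  have : IsEmpty (Fin (F.rk i)) := by rw [hrk i (by omega)]; infer_instance
  simp [bettiNum]

lemma gam_ineq {K : Type} [Field K] {n c : ℕ} (F : FreeComplex K n) (hF : IsResolution F)
    (hmin : IsMinimal F) (hrk : ∀ i, c < i → F.rk i = 0) (hc : c ≤ n) (hd : polyDim (hilbPoly F) = n - c)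
    (e : Fin (c+1) → ℤ) (he : StrictMono e) (τ : Fin c) (hτ : e τ.succ = e τ.castSucc + 1) :
    0 ≤ Phi (Lw e τ) (gam F c) := by
  rcases n with _ | m
  · exact absurd τ.2 (by omega)
  · obtain ⟨K', _, j, v, hv⟩ := noether F hF hc hd
    exact ineq_of_noether F hF hmin hrk K' j v hv e he τ hτ

end BS

theorem betti_table_decomposition_unique (K : Type) [Field K] (n c : ℕ)
    (F : FreeComplex K n) (hCM : IsCMcodim F c) :
    ∃! w : (Fin (c + 1) → ℤ) →₀ ℚ,
      (∀ d ∈ w.support, StrictMono d) ∧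
      (∀ d ∈ w.support, 0 < w d) ∧
      (∀ d₁ ∈ w.support, ∀ d₂ ∈ w.support,
        (∀ i, d₁ i ≤ d₂ i) ∨ (∀ i, d₂ i ≤ d₁ i)) ∧
      (∀ d ∈ w.support, ∃ (G : FreeComplex K n) (lam : ℚ), 0 < lam ∧
        IsCMcodim G c ∧ ∀ (i : ℕ) (j : ℤ), (bettiNum G i j : ℚ) = lam * pureTable d i j) ∧
      (∀ (i : ℕ) (j : ℤ), (bettiNum F i j : ℚ) = w.sum fun d v => v * pureTable d i j) := by
  obtain ⟨hF, hmin, hrk, hc0, hd⟩ := hCM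
  have hc : c ≤ n := BS.cod_le F hF hmin hrk hc0
  obtain ⟨w, hw1, hw2, hw3⟩ := BS.decomp_main (BS.gam F c)
    (fun i j => by rw [BS.gam_apply]; positivity) (BS.gam_HK F hc hrk hd)
    (BS.gam_ineq F hF hmin hrk hc hd)
  have htab : ∀ u : (Fin (c + 1) → ℤ) →₀ ℚ, ∀ (i : Fin (c+1)) (j : ℤ),
      (u.sum fun d v => v * pureTable d (i:ℕ) j) = BS.tab u i j := by
    intro u i j
    unfold BS.tab
    simp only [BS.pureTable_fin]
  refine ⟨w, ⟨fun d hd => (hw1 d hd).1, fun d hd => (hw1 d hd).2, hw2,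
    fun d hd => BS.pure_exists K n c hc d (hw1 d hd).1, fun i j => ?_⟩, ?_⟩
  · by_cases hi : i < c + 1
    · have h1 := htab w ⟨i, hi⟩ j
      have h2 := hw3 ⟨i, hi⟩ j
      rw [BS.gam_apply] at h2
      exact h2.trans h1.symm
    · rw [BS.betti_big F hrk i hi j]
      simp only [BS.pureTable_big _ i hi, mul_zero, Finsupp.sum_fun_zero, Nat.cast_zero]
  · rintro w' ⟨h1, h2, h3, _, h5⟩
    refine BS.good_unique _ w' w ⟨h1, h2, h3⟩ ⟨fun d hd => (hw1 d hd).1, fun d hd => (hw1 d hd).2, hw2⟩ ?_ le_rfl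
    funext i j
    rw [← htab w' i j, ← h5 i j, ← BS.gam_apply]
    exact hw3 i j


end
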